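/- arXiv:2307.14871 — 3 statements merged into one kernel-verified Lean document; each statement's English description precedes it below -/
import Mathlib

section
/- Let n_1, n_2, … be a lacunary sequence of positive integers and let ε > 0. Then there exists a set 𝒢 ⊆ ℬ with Hausdorff dimension dim_H(𝒢) = 2 (as a subset of ℝ²) such that for every pair (β, δ) ∈ 𝒢, there are infinitely many positive integers t with ‖n_t β − δ‖ < (log t)^(3+ε) / t. -/
open Real MeasureTheory Set

/-- Distance from `x` to the nearest integer. -/
noncomputable def nint (x : ℝ) : ℝ := ⨅ n : ℤ, |x - n|

/-- The set of badly approximable numbers. -/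
def Bad : Set ℝ := {α : ℝ | ∃ c > 0, ∀ n : ℕ, 1 ≤ n → c ≤ n * nint (n * α)}

/-- The set of `δ`-inhomogeneously badly approximable numbers. -/
def BadShift (δ : ℝ) : Set ℝ := {β : ℝ | ∃ c > 0, ∀ n : ℕ, 1 ≤ n → c ≤ n * nint (n * β - δ)}

/-- The set `ℬ = {(β, δ) : β ∈ Bad ∩ Bad(δ)}`. -/
def calB : Set (ℝ × ℝ) := {p : ℝ × ℝ | p.1 ∈ Bad ∧ p.1 ∈ BadShift p.2}

/-- The `k`-th continuant `q_k(α)` (denominator of the `k`-th convergent) of the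
continued fraction expansion of `α`. -/
noncomputable def contDen (α : ℝ) (k : ℕ) : ℝ := (GenContFract.of α).dens k

/-- `Λ(α) = sup_{k ≥ 1} (log q_k(α)) / k`. -/
noncomputable def Lam (α : ℝ) : ℝ := ⨆ k : ℕ+, Real.log (contDen α k) / k

/-- Membership in the set `𝒦` of irrational numbers with `Λ(α) < ∞`. -/
def memK (α : ℝ) : Prop :=
  Irrational α ∧ BddAbove (Set.range fun k : ℕ+ => Real.log (contDen α k) / k)

/-- The Fourier transform `μ̂(ξ) = ∫ e^{-2πiξx} dμ(x)` of a measure `μ` on `ℝ`. -/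
noncomputable def mFT (μ : Measure ℝ) (ξ : ℝ) : ℂ :=
  ∫ x, Complex.exp (-(2 * Real.pi * ξ * x : ℝ) * Complex.I) ∂μ

/-- Dispersion of a (finite) set `A ⊆ [0,1)`: the largest gap between circularly
consecutive elements, where the gap between the largest and the smallest element
wraps around, i.e. equals `min A + 1 - max A`. -/
noncomputable def disp (A : Set ℝ) : ℝ :=
  sSup {d : ℝ |
    (∃ a ∈ A, ∃ b ∈ A, a < b ∧ (∀ x ∈ A, x ≤ a ∨ b ≤ x) ∧ d = b - a) ∨
    (∃ a ∈ A, ∃ b ∈ A, (∀ x ∈ A, b ≤ x ∧ x ≤ a) ∧ d = b + 1 - a)}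

theorem exists_tree_map {K : ℕ} (hK : 2 ≤ K) (ℓ : ℕ → ℝ) (hℓ : ∀ j, 0 < ℓ j)
    (hℓ2 : ∀ j, 2 * ℓ (j + 1) ≤ ℓ j) (G : ℕ → ℝ → Prop) (a₀ : ℝ)
    (h0 : ∀ z ∈ Icc a₀ (a₀ + ℓ 0), G 0 z)
    (hstep : ∀ j a, (∀ z ∈ Icc a (a + ℓ j), G j z) → ∃ S : ℕ → ℝ,
      (∀ d < K, a ≤ S d ∧ S d + ℓ (j + 1) ≤ a + ℓ j ∧
        ∀ z ∈ Icc (S d) (S d + ℓ (j + 1)), G (j + 1) z) ∧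
      ∀ d < K, ∀ d' < K, d ≠ d' → 2 * ℓ (j + 1) ≤ |S d - S d'|) :
    ∃ f : ℝ → ℝ, (∀ x ∈ Ico (0 : ℝ) 1, f x ∈ Icc a₀ (a₀ + ℓ 0) ∧ ∀ j, G j (f x)) ∧
      ∀ x ∈ Ico (0 : ℝ) 1, ∀ x' ∈ Ico (0 : ℝ) 1, ∀ j : ℕ,
        ((K : ℝ) ^ j)⁻¹ < |x - x'| → ℓ j ≤ |f x - f x'| := by
  classical
  have hK0 : 0 < K := by omega
  choose! T hT1 hT2 using hstep
  let node : ℕ → ℕ → ℝ := fun j => Nat.rec (motive := fun _ => ℕ → ℝ) (fun _ => a₀)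
    (fun j g m => T j (g (m / K)) (m % K)) j
  have node_succ : ∀ j m, node (j + 1) m = T j (node j (m / K)) (m % K) := fun _ _ => rfl
  have hinv : ∀ j m, ∀ z ∈ Icc (node j m) (node j m + ℓ j), G j z := by
    intro j
    induction j with
    | zero => intro m; exact h0
    | succ j ih =>
      intro m
      rw [node_succ]
      exact (hT1 j _ (ih _) _ (Nat.mod_lt _ hK0)).2.2
  have hnest : ∀ j m, node j (m / K) ≤ node (j + 1) m ∧
      node (j + 1) m + ℓ (j + 1) ≤ node j (m / K) + ℓ j := by
    intro j m
    rw [node_succ]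
    have := hT1 j _ (hinv j (m / K)) _ (Nat.mod_lt m hK0)
    exact ⟨this.1, this.2.1⟩
  have hsep : ∀ j, ∀ m < K ^ j, ∀ m' < K ^ j, m ≠ m' →
      2 * ℓ j ≤ |node j m - node j m'| := by
    intro j
    induction j with
    | zero => intro m hm m' hm' hne; simp at hm hm'; omega
    | succ j ih =>
      intro m hm m' hm' hne
      have hmK : m / K < K ^ j := Nat.div_lt_of_lt_mul (by rw [pow_succ] at hm; linarith)
      have hmK' : m' / K < K ^ j := Nat.div_lt_of_lt_mul (by rw [pow_succ] at hm'; linarith)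
      by_cases h : m / K = m' / K
      · have hr : m % K ≠ m' % K := by
          intro hr
          apply hne
          rw [← Nat.div_add_mod m K, ← Nat.div_add_mod m' K, h, hr]
        rw [node_succ, node_succ, h]
        exact hT2 j _ (hinv j _) _ (Nat.mod_lt _ hK0) _ (Nat.mod_lt _ hK0) hr
      · have h1 := ih _ hmK _ hmK' h
        have h2 := hnest j m
        have h3 := hnest j m'
        have h4 := hℓ2 j
        have h5 := hℓ (j + 1)
        rcases le_abs.1 h1 with h6 | h6
        · exact le_abs.2 (Or.inl (by linarith))
        · exact le_abs.2 (Or.inr (by linarith))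
  let idx : ℝ → ℕ → ℕ := fun x j => ⌊x * (K : ℝ) ^ j⌋₊
  have hidx : ∀ x j, idx x (j + 1) / K = idx x j := by
    intro x j
    simp only [idx]
    rw [← Nat.floor_div_natCast]
    congr 1
    have : (K : ℝ) ≠ 0 := by positivity
    field_simp
    ring
  have hidx_lt : ∀ x ∈ Ico (0 : ℝ) 1, ∀ j, idx x j < K ^ j := by
    intro x hx j
    simp only [idx]
    have hp : (0 : ℝ) < (K : ℝ) ^ j := by positivity
    rw [Nat.floor_lt (mul_nonneg hx.1 hp.le)]
    push_cast
    nlinarith [hx.2]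
  let g : ℝ → ℕ → ℝ := fun x j => node j (idx x j)
  have hg : ∀ x j, g x j ≤ g x (j + 1) ∧ g x (j + 1) + ℓ (j + 1) ≤ g x j + ℓ j := by
    intro x j
    have := hnest j (idx x (j + 1))
    rwa [hidx] at this
  have hmono : ∀ x, Monotone (g x) := fun x => monotone_nat_of_le_succ fun j => (hg x j).1
  have hanti : ∀ x, Antitone (fun j => g x j + ℓ j) := fun x =>
    antitone_nat_of_succ_le fun j => (hg x j).2
  have hle : ∀ x i j, g x i ≤ g x j + ℓ j := by
    intro x i j
    calc g x i ≤ g x (max i j) := hmono x (le_max_left _ _)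
      _ ≤ g x (max i j) + ℓ (max i j) := by linarith [hℓ (max i j)]
      _ ≤ g x j + ℓ j := hanti x (le_max_right _ _)
  let f : ℝ → ℝ := fun x => ⨆ i, g x i
  have hf : ∀ x j, f x ∈ Icc (g x j) (g x j + ℓ j) := by
    intro x j
    refine ⟨le_ciSup (f := g x) ⟨g x 0 + ℓ 0, ?_⟩ j, ciSup_le fun i => hle x i j⟩
    rintro _ ⟨i, rfl⟩
    exact hle x i 0
  refine ⟨f, fun x _ => ⟨hf x 0, fun j => hinv j _ _ (hf x j)⟩, ?_⟩
  intro x hx x' hx' j hj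
  have hp : (0 : ℝ) < (K : ℝ) ^ j := by positivity
  have hne : idx x j ≠ idx x' j := by
    intro heq
    have h1 := Nat.floor_le (mul_nonneg hx.1 hp.le)
    have h2 := Nat.lt_floor_add_one (x * (K : ℝ) ^ j)
    have h3 := Nat.floor_le (mul_nonneg hx'.1 hp.le)
    have h4 := Nat.lt_floor_add_one (x' * (K : ℝ) ^ j)
    simp only [idx] at heq
    rw [heq] at h1 h2
    have h5 : |x - x'| * (K : ℝ) ^ j < 1 := by
      rw [← abs_of_pos hp, ← abs_mul, abs_lt]
      constructor <;> nlinarith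
    have h6 : 1 < |x - x'| * (K : ℝ) ^ j := by
      rwa [inv_lt_iff_one_lt_mul₀ hp] at hj
    linarith
  have h1 := hsep j _ (hidx_lt x hx j) _ (hidx_lt x' hx' j) hne
  have h2 := hf x j
  have h3 := hf x' j
  simp only [g] at h2 h3
  rcases le_abs.1 h1 with h6 | h6
  · exact le_abs.2 (Or.inl (by linarith [h2.1, h2.2, h3.1, h3.2]))
  · exact le_abs.2 (Or.inr (by linarith [h2.1, h2.2, h3.1, h3.2]))

/-- Among `K + 1` well separated pieces of an interval, at most one comes close to a point of a
sparse set. -/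
theorem exists_pieces_avoiding (K : ℕ) {R ℓ : ℝ} (hR : R = 2 * K + 2) (hℓ : 0 < ℓ) (a : ℝ)
    (B : Set ℝ) (hB : ∀ b ∈ B, ∀ b' ∈ B, b ≠ b' → 2 * ℓ ≤ |b - b'|) :
    ∃ S : ℕ → ℝ, (∀ d < K, a ≤ S d ∧ S d + ℓ / R ≤ a + ℓ ∧
        ∀ z ∈ Icc (S d) (S d + ℓ / R), ∀ b ∈ B, ℓ / (4 * R) ≤ |z - b|) ∧
      ∀ d < K, ∀ d' < K, d ≠ d' → 2 * (ℓ / R) ≤ |S d - S d'| := by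
  have hR2 : 2 ≤ R := by rw [hR]; have : (0 : ℝ) ≤ K := by positivity
                         linarith
  have hRpos : 0 < R := by linarith
  set e := ℓ / R with he
  have hepos : 0 < e := by positivity
  have heR : e * R = ℓ := by rw [he]; field_simp
  have he4 : ℓ / (4 * R) = e / 4 := by rw [he]; field_simp
  rw [he4]
  let P : ℕ → ℝ := fun i => a + 2 * i * e
  have hPsep : ∀ i i' : ℕ, i < i' → P i + 2 * e ≤ P i' := by
    intro i i' h
    have : (i : ℝ) + 1 ≤ i' := by exact_mod_cast h
    simp only [P]
    nlinarith
  have hPle : ∀ i ≤ K, P i + e ≤ a + ℓ := by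
    intro i hi
    have : (i : ℝ) ≤ K := by exact_mod_cast hi
    simp only [P]
    rw [← heR, hR]
    nlinarith
  have hPge : ∀ i, a ≤ P i := by
    intro i
    simp only [P]
    have : 0 ≤ 2 * (i : ℝ) * e := by positivity
    linarith
  let killed : ℕ → Prop := fun i => ∃ z ∈ Icc (P i) (P i + e), ∃ b ∈ B, |z - b| < e / 4
  have huniq : ∀ i ≤ K, ∀ i' ≤ K, killed i → killed i' → ¬ i < i' := by
    rintro i hi i' hi' ⟨z, hz, b, hb, hzb⟩ ⟨z', hz', b', hb', hzb'⟩ hlt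
    have h1 := hPsep i i' hlt
    rw [abs_lt] at hzb hzb'
    by_cases hbb : b = b'
    · subst hbb
      linarith [hz.1, hz.2, hz'.1, hz'.2]
    · have h2 := hB b hb b' hb' hbb
      have h3 := hPle i' hi'
      have h4 := hPge i
      have h5 : e ≤ ℓ / 2 := by nlinarith
      rcases le_abs.1 h2 with h | h <;> linarith [hz.1, hz.2, hz'.1, hz'.2]
  obtain ⟨i₀, hi₀⟩ : ∃ i₀, ∀ i ≤ K, i ≠ i₀ → ¬ killed i := by
    by_cases h : ∃ i₀ ≤ K, killed i₀
    · obtain ⟨i₀, hK, hk⟩ := h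
      refine ⟨i₀, fun i hi hne hki => ?_⟩
      rcases lt_or_gt_of_ne hne with h | h
      · exact huniq i hi i₀ hK hki hk h
      · exact huniq i₀ hK i hi hk hki h
    · push Not at h
      exact ⟨0, fun i hi _ => h i hi⟩
  let σ : ℕ → ℕ := fun d => if d < i₀ then d else d + 1
  have hσle : ∀ d < K, σ d ≤ K := by
    intro d hd; simp only [σ]; split_ifs <;> omega
  have hσne : ∀ d, σ d ≠ i₀ := by
    intro d; simp only [σ]; split_ifs <;> omega
  have hσinj : ∀ d d', d < d' → σ d < σ d' := by
    intro d d' h; simp only [σ]; split_ifs <;> omega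
  refine ⟨fun d => P (σ d), fun d hd => ⟨hPge _, hPle _ (hσle d hd), fun z hz b hb => ?_⟩, ?_⟩
  · by_contra hcon
    push Not at hcon
    exact hi₀ _ (hσle d hd) (hσne d) ⟨z, hz, b, hb, hcon⟩
  · intro d _ d' _ hne
    rcases lt_or_gt_of_ne hne with h | h
    · exact le_abs.2 (Or.inr (by linarith [hPsep _ _ (hσinj _ _ h)]))
    · exact le_abs.2 (Or.inl (by linarith [hPsep _ _ (hσinj _ _ h)]))

theorem one_le_mul_abs_div_sub_div {a b a' b' : ℤ} (hb : 0 < b) (hb' : 0 < b')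
    (h : (a : ℝ) / b ≠ a' / b') : 1 ≤ (b : ℝ) * b' * |(a : ℝ) / b - a' / b'| := by
  have hbR : (0 : ℝ) < b := by exact_mod_cast hb
  have hbR' : (0 : ℝ) < b' := by exact_mod_cast hb'
  have h1 : (a : ℝ) / b - a' / b' = ((a * b' - b * a' : ℤ) : ℝ) / (b * b') := by
    push_cast; field_simp
  have h2 : (a * b' - b * a' : ℤ) ≠ 0 := by
    intro h0
    rw [h0] at h1
    apply h
    simp at h1
    linarith
  rw [h1, abs_div, abs_of_pos (mul_pos hbR hbR'), mul_div_cancel₀ _ (mul_pos hbR hbR').ne']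
  exact_mod_cast Int.one_le_abs h2

/-- Subdividing an interval while staying away from rationals with denominators in a range. -/
theorem exists_pieces_avoiding_rat (K : ℕ) {R l X : ℝ} (hR : R = 2 * K + 2) (hl : 0 < l)
    (a : ℝ) : ∃ S : ℕ → ℝ, (∀ d < K, a ≤ S d ∧ S d + l / R ≤ a + l ∧
        ∀ z ∈ Icc (S d) (S d + l / R), ∀ p b : ℤ, 0 < b → X ≤ b ^ 2 * l → b ^ 2 * l < 1 / 4 →
          X / (4 * R) ≤ b * |b * z - p|) ∧
      ∀ d < K, ∀ d' < K, d ≠ d' → 2 * (l / R) ≤ |S d - S d'| := by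
  have hRpos : 0 < R := by rw [hR]; positivity
  obtain ⟨S, hS1, hS2⟩ := exists_pieces_avoiding K hR hl a
    {x | ∃ p b : ℤ, 0 < b ∧ X ≤ b ^ 2 * l ∧ b ^ 2 * l < 1 / 4 ∧ x = (p : ℝ) / b} (by
      rintro _ ⟨p, b, hb, -, hb2, rfl⟩ _ ⟨p', b', hb', -, hb2', rfl⟩ hne
      have h1 := one_le_mul_abs_div_sub_div hb hb' hne
      set D := |(p : ℝ) / b - p' / b'|
      have hD : 0 ≤ D := abs_nonneg _
      have hbR : (0 : ℝ) < b := by exact_mod_cast hb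
      have hbR' : (0 : ℝ) < b' := by exact_mod_cast hb'
      have h2 : (b : ℝ) * b' * l ≤ 1 / 4 := by nlinarith [sq_nonneg ((b : ℝ) - b')]
      have h3 : l ≤ (b : ℝ) * b' * l * D := by nlinarith
      nlinarith)
  refine ⟨S, fun d hd => ⟨(hS1 d hd).1, (hS1 d hd).2.1, ?_⟩, hS2⟩
  intro z hz p b hb h1 h2
  have h3 := (hS1 d hd).2.2 z hz _ ⟨p, b, hb, h1, h2, rfl⟩
  have hbR : (0 : ℝ) < b := by exact_mod_cast hb
  have h4 : (b : ℝ) * |b * z - p| = b ^ 2 * |z - p / b| := by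
    rw [show (b : ℝ) * z - p = b * (z - p / b) by field_simp, abs_mul, abs_of_pos hbR]
    ring
  rw [h4]
  calc X / (4 * R) ≤ b ^ 2 * l / (4 * R) := by gcongr
    _ = b ^ 2 * (l / (4 * R)) := by ring
    _ ≤ _ := by gcongr

/-- A Cantor-type set of points which are badly approximable by rationals whose denominator is
not too small. -/
theorem exists_tree_badly_approximable {K : ℕ} (hK : 2 ≤ K) {R l : ℝ} (hR : R = 2 * K + 2)
    (hl : 0 < l) (a : ℝ) : ∃ f : ℝ → ℝ, (∀ x ∈ Ico (0 : ℝ) 1, f x ∈ Icc a (a + l) ∧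
        ∀ p b : ℤ, 0 < b → 1 / (8 * R) ≤ b ^ 2 * l → 1 / (32 * R ^ 2) ≤ b * |b * f x - p|) ∧
      ∀ x ∈ Ico (0 : ℝ) 1, ∀ x' ∈ Ico (0 : ℝ) 1, ∀ j : ℕ,
        ((K : ℝ) ^ j)⁻¹ < |x - x'| → l / R ^ j ≤ |f x - f x'| := by
  have hK' : (2 : ℝ) ≤ K := by exact_mod_cast hK
  have hRpos : 0 < R := by rw [hR]; positivity
  have hR6 : 6 ≤ R := by rw [hR]; linarith
  have key := exists_tree_map hK (fun j => l / R ^ j) (fun j => by positivity) (fun j => by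
      have h : l / R ^ (j + 1) * R = l / R ^ j := by field_simp; ring
      have h2 : 0 < l / R ^ (j + 1) := by positivity
      show 2 * (l / R ^ (j + 1)) ≤ l / R ^ j
      rw [← h]; nlinarith)
    (fun j z => ∀ p b : ℤ, 0 < b → 1 / (8 * R) ≤ b ^ 2 * l → b ^ 2 * (l / R ^ j) < 1 / (8 * R) →
      1 / (32 * R ^ 2) ≤ b * |b * z - p|) a
    (by intro z _ p b _ h1 h2
        simp at h1 h2
        linarith)
    (by
      intro j a hG
      obtain ⟨S, hS1, hS2⟩ := exists_pieces_avoiding_rat K (X := 1 / (8 * R)) hR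
        (show 0 < l / R ^ j by positivity) a
      have e1 : l / R ^ (j + 1) = l / R ^ j / R := by field_simp; ring
      refine ⟨S, fun d hd => ?_, ?_⟩
      · obtain ⟨h1, h2, h3⟩ := hS1 d hd
        refine ⟨h1, by rwa [e1], ?_⟩
        intro z hz p b hb hb1 hb2
        by_cases hc : b ^ 2 * (l / R ^ j) < 1 / (8 * R)
        · refine hG z ⟨h1.trans hz.1, hz.2.trans (by rwa [e1])⟩ p b hb hb1 hc
        · have := h3 z (by rwa [e1] at hz) p b hb (not_lt.1 hc) (by
            have h5 : b ^ 2 * (l / R ^ j) = b ^ 2 * (l / R ^ (j + 1)) * R := by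
              field_simp; ring
            have h6 : 1 / (8 * R) * R = 1 / 8 := by field_simp
            rw [h5]
            nlinarith)
          calc _ = 1 / (8 * R) / (4 * R) := by field_simp; norm_num
            _ ≤ _ := this
      · intro d hd d' hd' hne
        show 2 * (l / R ^ (j + 1)) ≤ _
        rw [e1]
        exact hS2 d hd d' hd' hne)
  obtain ⟨f, hf1, hf2⟩ := key
  refine ⟨f, fun x hx => ⟨by simpa using (hf1 x hx).1, ?_⟩, hf2⟩
  intro p b hb hbl
  have hlim : Filter.Tendsto (fun j : ℕ => (b : ℝ) ^ 2 * (l / R ^ j)) Filter.atTop (nhds 0) := by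
    have h1 : Filter.Tendsto (fun j : ℕ => (1 / R) ^ j) Filter.atTop (nhds 0) :=
      tendsto_pow_atTop_nhds_zero_of_lt_one (by positivity)
        (by rw [div_lt_one hRpos]; linarith)
    have h2 := h1.const_mul ((b : ℝ) ^ 2 * l)
    rw [mul_zero] at h2
    refine h2.congr fun j => ?_
    rw [one_div, inv_pow]; ring
  obtain ⟨j, hj⟩ := (hlim.eventually_lt_const (show (0 : ℝ) < 1 / (8 * R) by positivity)).exists
  exact (hf1 x hx).2 j p b hb hbl hj

/-- For badly approximable `β`, a Cantor-type set of `δ` with `β` in `Bad(δ)`. -/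
theorem exists_tree_inhomogeneous {K : ℕ} (hK : 2 ≤ K) {R c β : ℝ} (hR : R = 2 * K + 2)
    (hc : 0 < c) (hc1 : c ≤ 1) (hβ : ∀ p b : ℤ, 0 < b → c ≤ b * |b * β - p|) :
    ∃ f : ℝ → ℝ, (∀ x ∈ Ico (0 : ℝ) 1, ∀ n p : ℤ, 0 < n →
        c / (8 * R ^ 3) ≤ n * |n * β - f x - p|) ∧
      ∀ x ∈ Ico (0 : ℝ) 1, ∀ x' ∈ Ico (0 : ℝ) 1, ∀ j : ℕ,
        ((K : ℝ) ^ j)⁻¹ < |x - x'| → 1 / R ^ (j + 1) ≤ |f x - f x'| := by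
  have hK' : (2 : ℝ) ≤ K := by exact_mod_cast hK
  have hRpos : 0 < R := by rw [hR]; positivity
  have hR6 : 6 ≤ R := by rw [hR]; linarith
  have hY : c / (2 * R) < 1 := by rw [div_lt_one (by positivity)]; linarith
  have hYpos : 0 < c / (2 * R) := by positivity
  have e1 : ∀ j, 1 / R ^ (j + 1 + 1) = 1 / R ^ (j + 1) / R := by
    intro j; field_simp; ring
  have key := exists_tree_map hK (fun j => 1 / R ^ (j + 1)) (fun j => by positivity) (fun j => by
      have h2 : 0 < 1 / R ^ (j + 1 + 1) := by positivity
      have h3 : 1 / R ^ (j + 1) = 1 / R ^ (j + 1 + 1) * R := by field_simp; ring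
      show 2 * (1 / R ^ (j + 1 + 1)) ≤ 1 / R ^ (j + 1)
      rw [h3]; nlinarith)
    (fun j z => ∀ n p : ℤ, 0 < n → n * (1 / R ^ (j + 1)) < c / (2 * R) / R →
      c / (8 * R ^ 3) ≤ n * |n * β - z - p|) 0
    (by intro z _ n p hn h2
        exfalso
        have hn1 : (1 : ℝ) ≤ n := by exact_mod_cast hn
        have h3 : c / (2 * R) / R < 1 / R := by gcongr
        simp only [zero_add, pow_one] at h2
        have h4 : 0 < 1 / R := by positivity
        nlinarith)
    (by
      intro j a hG
      set l := 1 / R ^ (j + 1) with hl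
      have hlpos : 0 < l := by positivity
      have hl2 : 2 * l ≤ 1 := by
        rw [hl, mul_one_div, div_le_one (by positivity)]
        calc (2 : ℝ) ≤ R := by linarith
          _ = R ^ 1 := (pow_one R).symm
          _ ≤ R ^ (j + 1) := pow_le_pow_right₀ (by linarith) (by omega)
      obtain ⟨S, hS1, hS2⟩ := exists_pieces_avoiding K hR hlpos a
        {x | ∃ n p : ℤ, 0 < n ∧ c / (2 * R) / R ≤ n * l ∧ n * l < c / (2 * R) ∧
          x = n * β - p} (by
          have aux : ∀ n p n' p' : ℤ, n' < n → 0 < n' → n * l < c / (2 * R) →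
              2 * l ≤ |(n * β - p) - (n' * β - p')| := by
            intro n p n' p' hlt hn' hb
            have h1 := hβ (p - p') (n - n') (by omega)
            have h2 : ((n - n' : ℤ) : ℝ) * β - ((p - p' : ℤ) : ℝ)
                = (n * β - p) - (n' * β - p') := by push_cast; ring
            rw [h2] at h1
            set D := |(n * β - p) - (n' * β - p')|
            have hD : 0 ≤ D := abs_nonneg _
            have h3 : ((n - n' : ℤ) : ℝ) ≤ n := by
              have : (0 : ℝ) < n' := by exact_mod_cast hn'
              push_cast; linarith
            have h4 : c ≤ n * D := h1.trans (by gcongr)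
            have h5 : c / (2 * R) ≤ c / 2 := by
              gcongr; linarith
            have h6 : c * l ≤ n * l * D := by nlinarith
            have h7 : c * l ≤ c / 2 * D := h6.trans (by gcongr; linarith)
            have h8 : c * (2 * l) ≤ c * D := by linarith
            exact le_of_mul_le_mul_left h8 hc
          rintro _ ⟨n, p, hn, -, hb, rfl⟩ _ ⟨n', p', hn', -, hb', rfl⟩ hne
          rcases lt_trichotomy n n' with h | h | h
          · rw [abs_sub_comm]; exact aux _ _ _ _ h hn hb'
          · subst h
            have h1 : p' - p ≠ 0 := by
              intro h0
              apply hne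
              rw [show p = p' by omega]
            have h2 : (n * β - p) - (n * β - p') = ((p' - p : ℤ) : ℝ) := by push_cast; ring
            rw [h2]
            refine hl2.trans ?_
            exact_mod_cast Int.one_le_abs h1
          · exact aux _ _ _ _ h hn' hb)
      refine ⟨S, fun d hd => ?_, ?_⟩
      · obtain ⟨h1, h2, h3⟩ := hS1 d hd
        refine ⟨h1, by rwa [e1], ?_⟩
        intro z hz n p hn hn2
        rw [e1] at hz hn2
        by_cases hcase : n * l < c / (2 * R) / R
        · exact hG z ⟨h1.trans hz.1, hz.2.trans h2⟩ n p hn hcase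
        · have h5 : (n : ℝ) * l < c / (2 * R) := by
            rw [mul_div_assoc', div_lt_div_iff_of_pos_right hRpos] at hn2
            exact hn2
          have h4 := h3 z hz _ ⟨n, p, hn, not_lt.1 hcase, h5, rfl⟩
          have hnR : (0 : ℝ) < n := by exact_mod_cast hn
          rw [show n * β - z - p = -(z - (n * β - p)) by ring, abs_neg]
          calc c / (8 * R ^ 3) = c / (2 * R) / R / (4 * R) := by field_simp; norm_num
            _ ≤ n * l / (4 * R) := by gcongr; exact not_lt.1 hcase
            _ = n * (l / (4 * R)) := by ring
            _ ≤ n * |z - (n * β - p)| := by gcongr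
      · intro d hd d' hd' hne
        rw [e1]
        exact hS2 d hd d' hd' hne)
  obtain ⟨f, hf1, hf2⟩ := key
  refine ⟨f, fun x hx n p hn => ?_, hf2⟩
  have hlim : Filter.Tendsto (fun j : ℕ => (n : ℝ) * (1 / R ^ (j + 1))) Filter.atTop (nhds 0) := by
    have h1 : Filter.Tendsto (fun j : ℕ => (1 / R) ^ j) Filter.atTop (nhds 0) :=
      tendsto_pow_atTop_nhds_zero_of_lt_one (by positivity)
        (by rw [div_lt_one hRpos]; linarith)
    have h2 := ((Filter.tendsto_add_atTop_iff_nat 1).2 h1).const_mul (n : ℝ)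
    rw [mul_zero] at h2
    refine h2.congr fun j => ?_
    rw [one_div_pow]
  obtain ⟨j, hj⟩ := (hlim.eventually_lt_const
    (show (0 : ℝ) < c / (2 * R) / R by positivity)).exists
  exact (hf1 x hx).2 j n p hn hj

/-- A map separating points at every scale has a Hölder inverse. -/
theorem holder_of_separating {K : ℕ} (hK : 2 ≤ K) {A γ : ℝ} (hA : 0 < A) (hγ : 0 < γ)
    (l : ℕ → ℝ) (hl : ∀ j, 0 < l j) (hl2 : ∀ j, A * ((K : ℝ) ^ j)⁻¹ ≤ l j ^ γ) (f : ℝ → ℝ)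
    (hf : ∀ x ∈ Ico (0 : ℝ) 1, ∀ x' ∈ Ico (0 : ℝ) 1, ∀ j : ℕ,
        ((K : ℝ) ^ j)⁻¹ < |x - x'| → l j ≤ |f x - f x'|) :
    ∀ x ∈ Ico (0 : ℝ) 1, ∀ x' ∈ Ico (0 : ℝ) 1, |x - x'| ≤ K / A * |f x - f x'| ^ γ := by
  intro x hx x' hx'
  have hK0 : (0 : ℝ) < K := by exact_mod_cast (by omega : 0 < K)
  have hK1 : (1 : ℝ) < K := by exact_mod_cast (by omega : 1 < K)
  by_cases hne : x = x'
  · subst hne; simp; positivity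
  have hpos : 0 < |x - x'| := abs_pos.2 (sub_ne_zero.2 hne)
  have hex : ∃ j : ℕ, ((K : ℝ) ^ j)⁻¹ < |x - x'| := by
    obtain ⟨j, hj⟩ := exists_pow_lt_of_lt_one hpos (inv_lt_one_of_one_lt₀ hK1)
    exact ⟨j, by rwa [← inv_pow]⟩
  classical
  have hj := Nat.find_spec hex
  have hmin := fun m => Nat.find_min hex (m := m)
  obtain ⟨j, hj0⟩ : ∃ j, Nat.find hex = j := ⟨_, rfl⟩
  rw [hj0] at hj hmin
  obtain _ | j := j
  · exfalso
    simp at hj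
    have := abs_sub_lt_of_nonneg_of_lt hx.1 hx.2 hx'.1 hx'.2
    linarith
  have h1 : |x - x'| ≤ ((K : ℝ) ^ j)⁻¹ := not_lt.1 (hmin j (by omega))
  have h2 := hf x hx x' hx' _ hj
  calc |x - x'| ≤ ((K : ℝ) ^ j)⁻¹ := h1
    _ = K / A * (A * ((K : ℝ) ^ (j + 1))⁻¹) := by field_simp; ring
    _ ≤ K / A * l (j + 1) ^ γ := by gcongr; exact hl2 _
    _ ≤ _ := by gcongr; exact (hl _).le

/-- Mass distribution principle for a set fibred over a curve parameter, where both the base and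
the fibres are parametrised with Hölder inverses. -/
theorem le_dimH_of_holder_fibers {γ C : ℝ} (hγ : 0 < γ) (hC : 0 < C) (β : ℝ → ℝ) (δ : ℝ → ℝ → ℝ)
    (hβ : ∀ x ∈ Ico (0 : ℝ) 1, ∀ x' ∈ Ico (0 : ℝ) 1, |x - x'| ≤ C * |β x - β x'| ^ γ)
    (hδ : ∀ x ∈ Ico (0 : ℝ) 1, ∀ y ∈ Ico (0 : ℝ) 1, ∀ y' ∈ Ico (0 : ℝ) 1,
      |y - y'| ≤ C * |δ x y - δ x y'| ^ γ) (G : Set (ℝ × ℝ))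
    (hG : ∀ x ∈ Ico (0 : ℝ) 1, ∀ y ∈ Ico (0 : ℝ) 1, (β x, δ x y) ∈ G) :
    ENNReal.ofReal (2 * γ) ≤ dimH G := by
  have toE : ∀ u v a b : ℝ, |u - v| ≤ C * |a - b| ^ γ →
      edist u v ≤ ENNReal.ofReal C * edist a b ^ γ := by
    intro u v a b h
    rw [edist_dist, edist_dist, Real.dist_eq, Real.dist_eq,
      ENNReal.ofReal_rpow_of_nonneg (abs_nonneg _) hγ.le, ← ENNReal.ofReal_mul hC.le]
    exact ENNReal.ofReal_le_ofReal h
  set c := ENNReal.ofReal C with hc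
  have hc0 : c ≠ 0 := by simpa [hc] using hC
  have hctop : c ≠ ⊤ := ENNReal.ofReal_ne_top
  refine le_dimH_of_hausdorffMeasure_ne_zero (d := (2 * γ).toNNReal) ?_
  rw [Real.coe_toNNReal _ (by positivity)]
  have hlow : (2 * c * c)⁻¹ ≤ Measure.hausdorffMeasure (2 * γ) G := by
    rw [Measure.hausdorffMeasure_apply]
    refine le_iSup₂_of_le 1 one_pos ?_
    refine le_iInf fun t => le_iInf fun ht => le_iInf fun ht1 => ?_
    set E : ℕ → ENNReal := fun n => Metric.ediam (t n) ^ γ with hE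
    have hEtop : ∀ n, E n ≠ ⊤ := fun n =>
      ENNReal.rpow_ne_top_of_nonneg hγ.le (ne_top_of_le_ne_top ENNReal.one_ne_top (ht1 n))
    let A : ℕ → Set ℝ := fun n => {x | x ∈ Ico (0 : ℝ) 1 ∧ ∃ p ∈ t n, p.1 = β x}
    have hT : ∀ n, ∃ T : Set ℝ, MeasurableSet T ∧ A n ⊆ T ∧
        volume T ≤ ⨆ _ : (t n).Nonempty, 2 * c * E n := by
      intro n
      by_cases hA : (A n).Nonempty
      · obtain ⟨x, hx, p, hp, hpx⟩ := hA
        refine ⟨Metric.closedEBall x (c * E n), Metric.isClosed_closedEBall.measurableSet, ?_, ?_⟩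
        · rintro x' ⟨hx', p', hp', hpx'⟩
          rw [Metric.mem_closedEBall]
          refine (toE _ _ _ _ (hβ x' hx' x hx)).trans ?_
          simp only [hE]
          gcongr
          rw [← hpx, ← hpx']
          exact (by rw [Prod.edist_eq]; exact le_max_left _ _ :
            edist p'.1 p.1 ≤ edist p' p).trans (Metric.edist_le_ediam_of_mem hp' hp)
        · rw [iSup_pos ⟨p, hp⟩, Real.volume_closedEBall]
          rw [mul_assoc]
      · exact ⟨∅, MeasurableSet.empty, by rw [not_nonempty_iff_eq_empty.1 hA], by simp⟩
    choose T hTm hAT hTvol using hT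
    have hslice : ∀ x ∈ Ico (0 : ℝ) 1, 1 ≤ ∑' n, (T n).indicator (fun _ => c * E n) x := by
      intro x hx
      let B : ℕ → Set ℝ := fun n => {y | y ∈ Ico (0 : ℝ) 1 ∧ (β x, δ x y) ∈ t n}
      have hcov : Ico (0 : ℝ) 1 ⊆ ⋃ n, B n := by
        intro y hy
        obtain ⟨n, hn⟩ := mem_iUnion.1 (ht (hG x hx y hy))
        exact mem_iUnion.2 ⟨n, hy, hn⟩
      calc (1 : ENNReal) = volume (Ico (0 : ℝ) 1) := by simp
        _ ≤ ∑' n, volume (B n) := (measure_mono hcov).trans (measure_iUnion_le _)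
        _ ≤ _ := by
          refine ENNReal.tsum_le_tsum fun n => ?_
          by_cases hB : (B n).Nonempty
          · obtain ⟨y, hy, hyt⟩ := hB
            rw [indicator_of_mem (hAT n ⟨hx, _, hyt, rfl⟩)]
            refine (Real.volume_le_diam _).trans (Metric.ediam_le ?_)
            rintro u ⟨hu, hut⟩ v ⟨hv, hvt⟩
            refine (toE _ _ _ _ (hδ x hx u hu v hv)).trans ?_
            simp only [hE]
            gcongr
            exact (by rw [Prod.edist_eq]; exact le_max_right _ _ :
              edist (δ x u) (δ x v) ≤ edist (β x, δ x u) (β x, δ x v)).trans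
              (Metric.edist_le_ediam_of_mem hut hvt)
          · rw [not_nonempty_iff_eq_empty.1 hB]; simp
    have hmain : 1 ≤ 2 * c * c * ∑' n, ⨆ _ : (t n).Nonempty, Metric.ediam (t n) ^ (2 * γ) := by
      calc (1 : ENNReal) = ∫⁻ x in Ico (0 : ℝ) 1, 1 := by simp
        _ ≤ ∫⁻ x in Ico (0 : ℝ) 1, ∑' n, (T n).indicator (fun _ => c * E n) x :=
          setLIntegral_mono' measurableSet_Ico hslice
        _ ≤ ∫⁻ x, ∑' n, (T n).indicator (fun _ => c * E n) x := setLIntegral_le_lintegral _ _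
        _ = ∑' n, c * E n * volume (T n) := by
          rw [lintegral_tsum fun n => (measurable_const.indicator (hTm n)).aemeasurable]
          simp_rw [lintegral_indicator_const (hTm _)]
        _ ≤ ∑' n, 2 * c * c * ⨆ _ : (t n).Nonempty, Metric.ediam (t n) ^ (2 * γ) := by
          refine ENNReal.tsum_le_tsum fun n => ?_
          refine (mul_le_mul_right (hTvol n) _).trans ?_
          by_cases hne : (t n).Nonempty
          · rw [iSup_pos hne, iSup_pos hne, two_mul γ,
              ENNReal.rpow_add_of_nonneg _ _ hγ.le hγ.le]
            apply le_of_eq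
            simp only [hE]; ring
          · simp [hne]
        _ = _ := ENNReal.tsum_mul_left
    rw [ENNReal.inv_le_iff_le_mul (fun _ => by simp [hc0]) (fun h => by
      simp only [ENNReal.mul_eq_top] at h; simp [hc0, hctop] at h)]
    exact hmain
  intro h0
  rw [h0, le_zero_iff, ENNReal.inv_eq_zero] at hlow
  simp only [ENNReal.mul_eq_top] at hlow
  simp [hc0, hctop] at hlow

/-- First-derivative van der Corput bound for an oscillatory integral. -/
theorem norm_integral_exp_le_of_deriv {a b μ₁ μ₂ : ℝ} (hab : a ≤ b) (hμ : 0 < μ₁)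
    (φ φ' φ'' : ℝ → ℝ) (h1 : ∀ s ∈ Icc a b, HasDerivAt φ (φ' s) s)
    (h2 : ∀ s ∈ Icc a b, HasDerivAt φ' (φ'' s) s) (h3 : ContinuousOn φ'' (Icc a b))
    (h4 : ∀ s ∈ Icc a b, μ₁ ≤ |φ' s|) (h5 : ∀ s ∈ Icc a b, |φ'' s| ≤ μ₂) :
    ‖∫ s in a..b, Complex.exp (φ s * Complex.I)‖ ≤ 2 / μ₁ + (b - a) * (μ₂ / μ₁ ^ 2) := by
  have hne : ∀ s ∈ Icc a b, (φ' s : ℂ) ≠ 0 := by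
    intro s hs h
    have h0 : φ' s = 0 := by exact_mod_cast h
    have := h4 s hs
    rw [h0, abs_zero] at this
    linarith
  have c1 : ContinuousOn φ (Icc a b) := fun s hs => (h1 s hs).continuousAt.continuousWithinAt
  have c2 : ContinuousOn φ' (Icc a b) := fun s hs => (h2 s hs).continuousAt.continuousWithinAt
  have ce : ContinuousOn (fun s => Complex.exp (φ s * Complex.I)) (Icc a b) := by fun_prop
  let g : ℝ → ℂ := fun s => Complex.exp (φ s * Complex.I) * (φ'' s / (φ' s) ^ 2 * Complex.I)
  have cg : ContinuousOn g (Icc a b) := by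
    refine ce.mul (ContinuousOn.mul (ContinuousOn.div ?_ ?_ fun s hs => pow_ne_zero 2 (hne s hs))
      continuousOn_const)
    · fun_prop
    · fun_prop
  let H : ℝ → ℂ := fun s => Complex.exp (φ s * Complex.I) * (Complex.I * φ' s)⁻¹
  have hH : ∀ s ∈ Icc a b, HasDerivAt H (Complex.exp (φ s * Complex.I) + g s) s := by
    intro s hs
    have d1 : HasDerivAt (fun s => Complex.exp (φ s * Complex.I))
        (Complex.exp (φ s * Complex.I) * (φ' s * Complex.I)) s :=
      ((h1 s hs).ofReal_comp.mul_const Complex.I).cexp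
    have d2 : HasDerivAt (fun s => (Complex.I * (φ' s : ℂ))⁻¹)
        (-(Complex.I * φ'' s) / (Complex.I * φ' s) ^ 2) s :=
      ((h2 s hs).ofReal_comp.const_mul Complex.I).inv (mul_ne_zero Complex.I_ne_zero (hne s hs))
    refine (d1.mul d2).congr_deriv ?_
    have := hne s hs
    have hI := Complex.I_ne_zero
    simp only [g, mul_pow, Complex.I_sq]
    field_simp
  have hHle : ∀ s ∈ Icc a b, ‖H s‖ ≤ 1 / μ₁ := by
    intro s hs
    simp only [H, norm_mul, Complex.norm_exp_ofReal_mul_I, norm_inv, Complex.norm_I, one_mul,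
      Complex.norm_real, Real.norm_eq_abs]
    rw [← one_div]
    exact one_div_le_one_div_of_le hμ (h4 s hs)
  have hgle : ∀ s ∈ Icc a b, ‖g s‖ ≤ μ₂ / μ₁ ^ 2 := by
    intro s hs
    simp only [g, norm_mul, Complex.norm_exp_ofReal_mul_I, norm_div, norm_pow, Complex.norm_I,
      one_mul, mul_one, Complex.norm_real, Real.norm_eq_abs]
    have := h4 s hs
    have := h5 s hs
    have h0 : 0 ≤ μ₂ := (abs_nonneg _).trans this
    gcongr
  rw [← uIcc_of_le hab] at ce cg
  have hintegral : ∫ s in a..b, (Complex.exp (φ s * Complex.I) + g s) = H b - H a :=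
    intervalIntegral.integral_eq_sub_of_hasDerivAt
      (fun s hs => hH s (by rwa [uIcc_of_le hab] at hs))
      (ce.add cg).intervalIntegrable
  rw [intervalIntegral.integral_add ce.intervalIntegrable cg.intervalIntegrable] at hintegral
  have hg : ‖∫ s in a..b, g s‖ ≤ μ₂ / μ₁ ^ 2 * |b - a| :=
    intervalIntegral.norm_integral_le_of_norm_le_const fun s hs =>
      hgle s (by rw [uIoc_of_le hab] at hs; exact Ioc_subset_Icc_self hs)
  rw [abs_of_nonneg (by linarith)] at hg
  rw [eq_sub_of_add_eq hintegral]
  refine (norm_sub_le _ _).trans ?_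
  have := (norm_sub_le (H b) (H a)).trans
    (add_le_add (hHle b (right_mem_Icc.2 hab)) (hHle a (left_mem_Icc.2 hab)))
  have e : 2 / μ₁ = 1 / μ₁ + 1 / μ₁ := by ring
  rw [e]
  linarith

theorem exists_abs_affine_ge {a b τ : ℝ} (h : τ ≤ |a| + 4 * |b|) :
    ∃ s₀ : ℝ, ∀ s ∈ Icc (1 : ℝ) 3, τ / 32 * |s - s₀| ≤ |a * s + b| := by
  by_cases hτ : τ ≤ 0
  · exact ⟨0, fun s _ => (mul_nonpos_of_nonpos_of_nonneg (by linarith) (abs_nonneg _)).trans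
      (abs_nonneg _)⟩
  push Not at hτ
  by_cases ha : τ / 32 ≤ |a|
  · have ha0 : a ≠ 0 := by
      rintro rfl
      rw [abs_zero] at ha
      linarith
    refine ⟨-b / a, fun s _ => ?_⟩
    rw [show a * s + b = a * (s - -b / a) by field_simp; ring, abs_mul]
    gcongr
  · push Not at ha
    refine ⟨1, fun s hs => ?_⟩
    have h1 : |s - 1| ≤ 2 := by rw [abs_le]; constructor <;> linarith [hs.1, hs.2]
    have h2 : |b| - |a * s| ≤ |a * s + b| := by
      have := abs_sub_abs_le_abs_sub b (-(a * s))
      rw [abs_neg, sub_neg_eq_add, add_comm b] at this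
      exact this
    have h3 : |a * s| ≤ |a| * 3 := by
      rw [abs_mul, abs_of_nonneg (by linarith [hs.1] : (0 : ℝ) ≤ s)]
      exact mul_le_mul_of_nonneg_left hs.2 (abs_nonneg _)
    nlinarith [abs_nonneg (s - 1)]

/-- Splitting off a short interval around a stationary point. -/
theorem norm_integral_le_of_away {F : ℝ → ℂ} {s₀ ω η : ℝ} (hω : 0 ≤ ω) (hη : 0 ≤ η)
    (hF : ContinuousOn F (Icc 1 3)) (hF1 : ∀ s ∈ Icc (1 : ℝ) 3, ‖F s‖ ≤ 1)
    (h : ∀ a b : ℝ, 1 ≤ a → a ≤ b → b ≤ 3 → (∀ s ∈ Icc a b, ω ≤ |s - s₀|) →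
      ‖∫ s in a..b, F s‖ ≤ η) :
    ‖∫ s in (1 : ℝ)..3, F s‖ ≤ 2 * η + 2 * ω := by
  set p := max 1 (min 3 (s₀ - ω)) with hp
  set q := max 1 (min 3 (s₀ + ω)) with hq
  have hp1 : 1 ≤ p := le_max_left _ _
  have hq3 : q ≤ 3 := max_le (by norm_num) (min_le_left _ _)
  have hpq : p ≤ q := max_le_max le_rfl (min_le_min le_rfl (by linarith))
  have hpq2 : q - p ≤ 2 * ω := by
    simp only [hp, hq]
    rcases max_cases 1 (min 3 (s₀ + ω)) with h1 | h1 <;>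
    rcases max_cases 1 (min 3 (s₀ - ω)) with h2 | h2 <;>
    rcases min_cases 3 (s₀ + ω) with h3 | h3 <;>
    rcases min_cases 3 (s₀ - ω) with h4 | h4 <;> linarith
  have hintegral : ∀ a b : ℝ, 1 ≤ a → a ≤ b → b ≤ 3 → IntervalIntegrable F volume a b := by
    intro a b h1 h2 h3
    refine ContinuousOn.intervalIntegrable (hF.mono ?_)
    rw [uIcc_of_le h2]
    exact Icc_subset_Icc h1 h3
  have i1 : ‖∫ s in (1 : ℝ)..p, F s‖ ≤ η := by
    rcases hp1.eq_or_lt with h1 | h1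
    · rw [← h1]; simpa using hη
    · refine h 1 p le_rfl hp1 (hpq.trans hq3) fun s hs => ?_
      have : p ≤ s₀ - ω := by
        rw [hp] at h1 ⊢
        rcases lt_max_iff.1 h1 with h2 | h2
        · exact absurd h2 (lt_irrefl _)
        · rw [max_eq_right h2.le]; exact min_le_right _ _
      exact le_abs.2 (Or.inr (by linarith [hs.2]))
  have i3 : ‖∫ s in q..3, F s‖ ≤ η := by
    rcases hq3.eq_or_lt with h1 | h1
    · rw [h1]; simpa using hη
    · refine h q 3 (hp1.trans hpq) hq3 le_rfl fun s hs => ?_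
      have : s₀ + ω ≤ q := by
        rw [hq] at h1 ⊢
        have h2 := lt_of_le_of_lt (le_max_right _ _) h1
        rcases min_lt_iff.1 h2 with h3 | h3
        · exact absurd h3 (lt_irrefl _)
        · rw [min_eq_right h3.le]; exact le_max_right _ _
      exact le_abs.2 (Or.inl (by linarith [hs.1]))
  have i2 : ‖∫ s in p..q, F s‖ ≤ 2 * ω := by
    have := intervalIntegral.norm_integral_le_of_norm_le_const (a := p) (b := q) (f := F)
      (C := 1) fun s hs => hF1 s (by
        rw [uIoc_of_le hpq] at hs
        exact ⟨hp1.trans hs.1.le, hs.2.trans hq3⟩)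
    rw [abs_of_nonneg (by linarith)] at this
    linarith
  rw [← intervalIntegral.integral_add_adjacent_intervals (hintegral 1 p le_rfl hp1 (hpq.trans hq3))
      (hintegral p 3 hp1 (hpq.trans hq3) le_rfl),
    ← intervalIntegral.integral_add_adjacent_intervals (hintegral p q hp1 hpq hq3)
      (hintegral q 3 (hp1.trans hpq) hq3 le_rfl)]
  refine (norm_add_le _ _).trans ?_
  have := norm_add_le (∫ s in p..q, F s) (∫ s in q..3, F s)
  linarith

/-- Oscillation of the difference of two Möbius maps with separated denominators. -/
theorem norm_integral_exp_mobius_sub_le (m : ℕ) {q A B A' B' κ : ℝ} (hq : 0 < q) (hA : q ≤ A)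
    (hA4 : A ≤ 4 ^ m * q) (hB : A / 4 ≤ B) (hBA : B ≤ A) (hA' : q ≤ A') (hA4' : A' ≤ 4 ^ m * q)
    (hB' : A' / 4 ≤ B') (hBA' : B' ≤ A') (hψ : ((16 : ℝ) ^ m)⁻¹ ≤ |A / B - A' / B'|)
    (hκ : q ^ 2 * 2 ^ (23 * m + 29) ≤ |κ|) (φ : ℝ → ℝ)
    (hφ : ∀ s ∈ Icc (1 : ℝ) 3,
      HasDerivAt φ (κ * (1 / (A * s + B) ^ 2 - 1 / (A' * s + B') ^ 2)) s) :
    ‖∫ s in (1 : ℝ)..3, Complex.exp (φ s * Complex.I)‖ ≤ 3 * ((2 : ℝ) ^ m)⁻¹ := by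
  have hApos : 0 < A := hq.trans_le hA
  have hApos' : 0 < A' := hq.trans_le hA'
  have hBpos : 0 < B := by linarith
  have hBpos' : 0 < B' := by linarith
  have hτ : q * ((16 : ℝ) ^ m)⁻¹ / 4 ≤ |A - A'| + 4 * |B - B'| := by
    have h1 : A / B - A' / B' = (B' * (A - A') - A' * (B - B')) / (B * B') := by
      field_simp; ring
    rw [h1, abs_div, abs_of_pos (mul_pos hBpos hBpos'), le_div_iff₀ (by positivity)] at hψ
    have h2 : |B' * (A - A') - A' * (B - B')| ≤ B' * (|A - A'| + 4 * |B - B'|) := by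
      refine (abs_sub _ _).trans ?_
      rw [abs_mul, abs_mul, abs_of_pos hBpos', abs_of_pos hApos']
      nlinarith [abs_nonneg (B - B')]
    have h3 : ((16 : ℝ) ^ m)⁻¹ * B ≤ |A - A'| + 4 * |B - B'| := by
      refine le_of_mul_le_mul_left ?_ hBpos'
      calc B' * (((16 : ℝ) ^ m)⁻¹ * B) = ((16 : ℝ) ^ m)⁻¹ * (B * B') := by ring
        _ ≤ _ := hψ.trans h2
    refine le_trans ?_ h3
    have : 0 < ((16 : ℝ) ^ m)⁻¹ := by positivity
    nlinarith
  obtain ⟨s₀, hs₀⟩ := exists_abs_affine_ge hτ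
  set W := |κ| / q ^ 2 with hW
  have hWge : (2 : ℝ) ^ (23 * m + 29) ≤ W := by
    rw [hW, le_div_iff₀ (by positivity)]; linarith
  have hWpos : 0 < W := lt_of_lt_of_le (by positivity) hWge
  have hκpos : 0 < |κ| := lt_of_lt_of_le (by positivity) hκ
  set Z : ℝ := 2 ^ m with hZ
  have hZ1 : 1 ≤ Z := one_le_pow₀ (by norm_num)
  have hZpos : 0 < Z := by linarith
  have h4Z : (4 : ℝ) ^ m = Z ^ 2 := by rw [hZ, ← pow_mul, mul_comm, pow_mul]; norm_num
  have h16Z : (16 : ℝ) ^ m = Z ^ 4 := by rw [hZ, ← pow_mul, mul_comm, pow_mul]; norm_num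
  have hWZ : Z ^ 23 * 2 ^ 29 ≤ W := by
    refine le_trans (le_of_eq ?_) hWge
    rw [hZ, ← pow_mul, ← pow_add]; congr 1; ring
  rw [h16Z] at hs₀
  rw [h4Z] at hA4 hA4'
  have hu : ∀ s ∈ Icc (1 : ℝ) 3, q ≤ A * s + B ∧ A ≤ A * s + B ∧ A * s + B ≤ 4 * Z ^ 2 * q := by
    intro s hs
    refine ⟨?_, ?_, ?_⟩ <;> nlinarith [hs.1, hs.2]
  have hu' : ∀ s ∈ Icc (1 : ℝ) 3,
      q ≤ A' * s + B' ∧ A' ≤ A' * s + B' ∧ A' * s + B' ≤ 4 * Z ^ 2 * q := by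
    intro s hs
    refine ⟨?_, ?_, ?_⟩ <;> nlinarith [hs.1, hs.2]
  let φ' : ℝ → ℝ := fun s => κ * (1 / (A * s + B) ^ 2 - 1 / (A' * s + B') ^ 2)
  let φ'' : ℝ → ℝ := fun s => κ * (-(2 * A) / (A * s + B) ^ 3 - -(2 * A') / (A' * s + B') ^ 3)
  have dinv : ∀ a b s : ℝ, 0 < a * s + b →
      HasDerivAt (fun s => 1 / (a * s + b) ^ 2) (-(2 * a) / (a * s + b) ^ 3) s := by
    intro a b s h
    have h1 : HasDerivAt (fun s => a * s + b) a s := by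
      simpa using ((hasDerivAt_id s).const_mul a).add_const b
    have h2 := (h1.pow 2).inv (pow_ne_zero 2 h.ne')
    simp only [one_div]
    refine h2.congr_deriv ?_
    simp only [Pi.pow_apply]
    field_simp
    norm_num
    ring
  have hφ'' : ∀ s ∈ Icc (1 : ℝ) 3, HasDerivAt φ' (φ'' s) s := by
    intro s hs
    exact ((dinv A B s (hq.trans_le (hu s hs).1)).sub
      (dinv A' B' s (hq.trans_le (hu' s hs).1))).const_mul κ
  have hcφ'' : ContinuousOn φ'' (Icc 1 3) := by
    refine continuousOn_const.mul (ContinuousOn.sub ?_ ?_)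
    · refine ContinuousOn.div continuousOn_const (by fun_prop) fun s hs => ?_
      exact (pow_pos (hq.trans_le (hu s hs).1) 3).ne'
    · refine ContinuousOn.div continuousOn_const (by fun_prop) fun s hs => ?_
      exact (pow_pos (hq.trans_le (hu' s hs).1) 3).ne'
  have hup : ∀ s ∈ Icc (1 : ℝ) 3, |φ'' s| ≤ 4 * W := by
    have aux : ∀ a v : ℝ, q ≤ v → 0 < a → a ≤ v → |-(2 * a) / v ^ 3| ≤ 2 / q ^ 2 := by
      intro a v h1 h2 h3
      have hv : 0 < v := by linarith
      rw [abs_div, abs_neg, abs_of_pos (by positivity : 0 < 2 * a),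
        abs_of_pos (by positivity : 0 < v ^ 3), div_le_div_iff₀ (by positivity) (by positivity)]
      have : q ^ 2 ≤ v ^ 2 := by gcongr
      nlinarith [mul_pos h2 (pow_pos hv 2), pow_pos hv 2]
    intro s hs
    have h1 := aux A _ (hu s hs).1 hApos (hu s hs).2.1
    have h2 := aux A' _ (hu' s hs).1 hApos' (hu' s hs).2.1
    simp only [φ'']
    rw [abs_mul]
    calc _ ≤ |κ| * (2 / q ^ 2 + 2 / q ^ 2) := by
          gcongr
          exact (abs_sub _ _).trans (add_le_add h1 h2)
      _ = 4 * W := by rw [hW]; ring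
  have hlow : ∀ s ∈ Icc (1 : ℝ) 3, W / (Z ^ 10 * 2 ^ 12) * |s - s₀| ≤ |φ' s| := by
    intro s hs
    have h1 := hs₀ s hs
    obtain ⟨h2, -, h3⟩ := hu s hs
    obtain ⟨h2', -, h3'⟩ := hu' s hs
    set u := A * s + B with hu0
    set v := A' * s + B' with hv0
    have hupos : 0 < u := by linarith
    have hvpos : 0 < v := by linarith
    have e1 : (A - A') * s + (B - B') = u - v := by rw [hu0, hv0]; ring
    rw [e1] at h1
    set U := 4 * Z ^ 2 * q with hU
    have hUpos : 0 < U := by positivity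
    have e2 : |1 / u ^ 2 - 1 / v ^ 2| = |u - v| * (1 / (u ^ 2 * v) + 1 / (u * v ^ 2)) := by
      have : 1 / u ^ 2 - 1 / v ^ 2 = -((u - v) * (1 / (u ^ 2 * v) + 1 / (u * v ^ 2))) := by
        field_simp; ring
      rw [this, abs_neg, abs_mul, abs_of_pos (by positivity :
        0 < 1 / (u ^ 2 * v) + 1 / (u * v ^ 2))]
    have e3 : 2 / U ^ 3 ≤ 1 / (u ^ 2 * v) + 1 / (u * v ^ 2) := by
      have a1 : 1 / U ^ 3 ≤ 1 / (u ^ 2 * v) := by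
        apply one_div_le_one_div_of_le (by positivity)
        calc u ^ 2 * v ≤ U ^ 2 * U := by gcongr
          _ = U ^ 3 := by ring
      have a2 : 1 / U ^ 3 ≤ 1 / (u * v ^ 2) := by
        apply one_div_le_one_div_of_le (by positivity)
        calc u * v ^ 2 ≤ U * U ^ 2 := by gcongr
          _ = U ^ 3 := by ring
      calc 2 / U ^ 3 = 1 / U ^ 3 + 1 / U ^ 3 := by ring
        _ ≤ _ := add_le_add a1 a2
    simp only [φ']
    rw [abs_mul, e2]
    calc W / (Z ^ 10 * 2 ^ 12) * |s - s₀|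
        = |κ| * ((q * (Z ^ 4)⁻¹ / 4 / 32 * |s - s₀|) * (2 / U ^ 3)) := by
          rw [hW, hU]; field_simp; ring
      _ ≤ _ := by gcongr
  have hcont : ContinuousOn (fun s => Complex.exp (φ s * Complex.I)) (Icc 1 3) := by
    have : ContinuousOn φ (Icc 1 3) := fun s hs => (hφ s hs).continuousAt.continuousWithinAt
    fun_prop
  have hfin := norm_integral_le_of_away (s₀ := s₀) (ω := Z⁻¹) (η := Z⁻¹ / 2) (by positivity)
    (by positivity) hcont (fun s _ => (Complex.norm_exp_ofReal_mul_I _).le) (by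
      intro a b ha hab hb hs
      have hsub : Icc a b ⊆ Icc 1 3 := Icc_subset_Icc ha hb
      set μ₁ := W / (Z ^ 11 * 2 ^ 12) with hμ₁
      have hμpos : 0 < μ₁ := by positivity
      refine (norm_integral_exp_le_of_deriv (μ₁ := μ₁) (μ₂ := 4 * W) hab hμpos φ φ' φ''
        (fun s h => hφ s (hsub h)) (fun s h => hφ'' s (hsub h)) (hcφ''.mono hsub)
        (fun s h => ?_) (fun s h => hup s (hsub h))).trans ?_
      · refine le_trans ?_ (hlow s (hsub h))
        calc μ₁ = W / (Z ^ 10 * 2 ^ 12) * Z⁻¹ := by rw [hμ₁]; field_simp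
          _ ≤ _ := by gcongr; exact hs s h
      · have e1 : 2 / μ₁ = Z ^ 11 * 2 ^ 13 / W := by rw [hμ₁]; field_simp
        have e2 : 4 * W / μ₁ ^ 2 = Z ^ 22 * 2 ^ 26 / W := by rw [hμ₁]; field_simp; norm_num
        have e3 : (b - a) * (4 * W / μ₁ ^ 2) ≤ 2 * (Z ^ 22 * 2 ^ 26 / W) := by
          rw [e2]; gcongr; linarith
        have e4 : Z ^ 11 ≤ Z ^ 22 := pow_le_pow_right₀ hZ1 (by norm_num)
        calc 2 / μ₁ + (b - a) * (4 * W / μ₁ ^ 2)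
            ≤ Z ^ 22 * 2 ^ 13 / W + 2 * (Z ^ 22 * 2 ^ 26 / W) := by
              rw [e1]; gcongr
          _ = Z ^ 22 * (2 ^ 13 + 2 ^ 27) / W := by ring
          _ ≤ Z ^ 22 * 2 ^ 28 / (Z ^ 23 * 2 ^ 29) := by gcongr; norm_num
          _ = Z⁻¹ / 2 := by field_simp)
  calc _ ≤ _ := hfin
    _ = 3 * Z⁻¹ := by ring

theorem four_mul_le_norm_one_sub_exp {z θ : ℝ} (hz : ∀ p : ℤ, θ ≤ |z - p|) :
    4 * θ ≤ ‖1 - Complex.exp ((2 * π * z : ℝ) * Complex.I)‖ := by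
  have h1 : Complex.exp ((2 * π * z : ℝ) * Complex.I)
      = Complex.exp (Complex.I * ((2 * π * (z - round z) : ℝ) : ℂ)) := by
    rw [Complex.exp_eq_exp_iff_exists_int]
    exact ⟨round z, by push_cast; ring⟩
  rw [h1, norm_sub_rev, Complex.norm_exp_I_mul_ofReal_sub_one, norm_mul, Real.norm_eq_abs,
    Real.norm_eq_abs, abs_two]
  have h2 := abs_sub_round z
  have h3 : |2 * π * (z - round z) / 2| ≤ π / 2 := by
    rw [show 2 * π * (z - round z) / 2 = π * (z - round z) by ring, abs_mul, abs_of_pos pi_pos]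
    nlinarith [pi_pos]
  have h4 := Real.mul_abs_le_abs_sin h3
  rw [show 2 * π * (z - round z) / 2 = π * (z - round z) by ring, abs_mul, abs_of_pos pi_pos,
    ← mul_assoc, div_mul_cancel₀ _ pi_pos.ne'] at h4
  have h5 := hz (round z)
  rw [show 2 * π * (z - round z) / 2 = π * (z - round z) by ring]
  linarith

theorem one_sub_sq_mul_fejer (w : ℂ) (D : ℕ) :
    (1 - w) ^ 2 * ∑ k ∈ Finset.range D, ((D : ℂ) - k) * w ^ k = D * (1 - w) - w * (1 - w ^ D) := by
  induction D with
  | zero => simp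
  | succ D ih =>
    have h1 : ∑ k ∈ Finset.range (D + 1), (((D + 1 : ℕ) : ℂ) - k) * w ^ k
        = ∑ k ∈ Finset.range D, ((D : ℂ) - k) * w ^ k + ∑ k ∈ Finset.range (D + 1), w ^ k := by
      rw [Finset.sum_range_succ, Finset.sum_range_succ (fun k => w ^ k), ← add_assoc,
        ← Finset.sum_add_distrib]
      push_cast
      congr 1
      · exact Finset.sum_congr rfl fun k _ => by ring
      · ring
    have h2 := mul_neg_geom_sum w (D + 1)
    rw [h1, mul_add, ih, pow_two, mul_assoc (1 - w) (1 - w), h2]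
    push_cast
    ring

/-- A point of the unit circle away from `1` makes the Fejér sum small. -/
theorem re_fejer_le {w : ℂ} {θ : ℝ} {D : ℕ} (hθ : 0 < θ) (hw : ‖w‖ = 1) (h : 2 * θ ≤ ‖1 - w‖)
    (hD : 2 ≤ D * θ ^ 2) :
    (∑ k ∈ Finset.range D, ((D : ℂ) - k) * w ^ k).re ≤ 3 * D / 4 := by
  have hne : 1 - w ≠ 0 := by
    intro h0
    rw [h0, norm_zero] at h
    linarith
  have e : ∑ k ∈ Finset.range D, ((D : ℂ) - k) * w ^ k
      = (D : ℝ) * (1 - w)⁻¹ - w * (1 - w ^ D) / (1 - w) ^ 2 := by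
    have := one_sub_sq_mul_fejer w D
    field_simp
    push_cast
    linear_combination this
  have hre : ((1 - w)⁻¹).re = 1 / 2 := by
    have h1 : w.re * w.re + w.im * w.im = 1 := by
      rw [← Complex.normSq_apply, Complex.normSq_eq_norm_sq, hw]; norm_num
    have h2 : Complex.normSq (1 - w) = 2 * (1 - w).re := by
      rw [Complex.normSq_apply]
      simp only [Complex.sub_re, Complex.sub_im, Complex.one_re, Complex.one_im]
      nlinarith
    have h3 : Complex.normSq (1 - w) ≠ 0 := by simpa using hne
    rw [Complex.inv_re, h2]
    rw [h2] at h3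
    have h4 : (1 - w).re ≠ 0 := fun h0 => h3 (by rw [h0, mul_zero])
    field_simp
  have hsmall : ‖w * (1 - w ^ D) / (1 - w) ^ 2‖ ≤ D / 4 := by
    rw [norm_div, norm_mul, hw, one_mul, norm_pow]
    have h1 : ‖1 - w ^ D‖ ≤ 2 := by
      refine (norm_sub_le _ _).trans ?_
      rw [norm_pow, hw, norm_one, one_pow]; norm_num
    have h2 : (2 * θ) ^ 2 ≤ ‖1 - w‖ ^ 2 := by gcongr
    rw [div_le_iff₀ (lt_of_lt_of_le (by positivity) h2)]
    have hD0 : (0 : ℝ) ≤ D := by positivity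
    nlinarith
  rw [e, Complex.sub_re, Complex.re_ofReal_mul, hre]
  have := (abs_le.1 ((Complex.abs_re_le_norm _).trans hsmall)).1
  linarith

/-- Points of the circle all avoiding an arc have a large exponential sum. -/
theorem sum_sq_norm_exp_sum_ge {ι : Type*} [Fintype ι] (z : ι → ℝ) {θ : ℝ} {D : ℕ}
    (hθ : 0 < θ) (hD : 2 ≤ D * θ ^ 2) (hz : ∀ l, ∀ p : ℤ, θ / 2 ≤ |z l - p|) :
    (Fintype.card ι : ℝ) ^ 2 / (16 * D) ≤
      ∑ k ∈ Finset.Ico 1 D, ‖∑ l, Complex.exp ((2 * π * (k * z l) : ℝ) * Complex.I)‖ ^ 2 := by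
  set M : ℝ := (Fintype.card ι : ℝ) with hM
  set w : ι → ℂ := fun l => Complex.exp ((2 * π * z l : ℝ) * Complex.I) with hw
  have hw1 : ∀ l, ‖w l‖ = 1 := fun l => Complex.norm_exp_ofReal_mul_I _
  have hpow : ∀ (k : ℕ) l, Complex.exp ((2 * π * (k * z l) : ℝ) * Complex.I) = w l ^ k := by
    intro k l
    rw [hw, ← Complex.exp_nat_mul]
    congr 1
    push_cast
    ring
  simp_rw [hpow]
  set T : ℕ → ℂ := fun k => ∑ l, w l ^ k with hT
  have hDpos : 0 < (D : ℝ) := by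
    by_contra h
    push Not at h
    nlinarith [sq_nonneg θ]
  have hDpos' : 0 < D := by exact_mod_cast hDpos
  have h1 : (∑ k ∈ Finset.range D, ((D : ℂ) - k) * T k).re ≤ 3 * D / 4 * M := by
    have : ∑ k ∈ Finset.range D, ((D : ℂ) - k) * T k
        = ∑ l, ∑ k ∈ Finset.range D, ((D : ℂ) - k) * w l ^ k := by
      rw [Finset.sum_comm]
      exact Finset.sum_congr rfl fun k _ => by rw [hT, Finset.mul_sum]
    rw [this, Complex.re_sum]
    calc _ ≤ ∑ l : ι, (3 * D / 4 : ℝ) := Finset.sum_le_sum fun l _ =>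
          re_fejer_le hθ (hw1 l) (by
            have := four_mul_le_norm_one_sub_exp (hz l); linarith) hD
      _ = _ := by simp [hM]; ring
  have h2 : (D : ℝ) * M - D * ∑ k ∈ Finset.Ico 1 D, ‖T k‖
      ≤ (∑ k ∈ Finset.range D, ((D : ℂ) - k) * T k).re := by
    rw [Finset.range_eq_Ico, ← Finset.sum_Ioo_add_eq_sum_Ico hDpos', Complex.add_re]
    have e0 : (((D : ℂ) - (0 : ℕ)) * T 0).re = D * M := by
      simp [hT, hM]
    rw [e0, show Finset.Ioo 0 D = Finset.Ico 1 D from rfl]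
    have : |(∑ k ∈ Finset.Ico 1 D, ((D : ℂ) - k) * T k).re| ≤ D * ∑ k ∈ Finset.Ico 1 D, ‖T k‖ := by
      refine (Complex.abs_re_le_norm _).trans ((norm_sum_le _ _).trans ?_)
      rw [Finset.mul_sum]
      refine Finset.sum_le_sum fun k hk => ?_
      rw [norm_mul]
      gcongr
      have hk2 := (Finset.mem_Ico.1 hk).2
      rw [← Nat.cast_sub hk2.le, Complex.norm_natCast]
      exact_mod_cast Nat.sub_le _ _
    linarith [(abs_le.1 this).1]
  have h3 : M / 4 ≤ ∑ k ∈ Finset.Ico 1 D, ‖T k‖ := by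
    have : D * (M / 4) ≤ D * ∑ k ∈ Finset.Ico 1 D, ‖T k‖ := by linarith
    exact le_of_mul_le_mul_left this hDpos
  have h4 := sq_sum_le_card_mul_sum_sq (s := Finset.Ico 1 D) (f := fun k => ‖T k‖)
  have h5 : ((Finset.Ico 1 D).card : ℝ) ≤ D := by
    rw [Nat.card_Ico]; exact_mod_cast Nat.sub_le _ _
  have h6 : 0 ≤ ∑ k ∈ Finset.Ico 1 D, ‖T k‖ ^ 2 := Finset.sum_nonneg fun _ _ => by positivity
  have hM0 : 0 ≤ M := by positivity
  rw [div_le_iff₀ (by positivity)]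
  have h7 : (M / 4) ^ 2 ≤ (∑ k ∈ Finset.Ico 1 D, ‖T k‖) ^ 2 := by gcongr
  nlinarith

/-- Mean square of an exponential sum whose terms are almost orthogonal. -/
theorem integral_sq_norm_exp_sum_le {ι : Type*} [Fintype ι] (φ : ι → ℝ → ℝ)
    (hφ : ∀ l, ContinuousOn (φ l) (Icc 1 3))
    (hpair : ∀ l l', l ≠ l' → ‖∫ s in (1 : ℝ)..3, Complex.exp (((φ l s - φ l' s : ℝ) : ℂ)
      * Complex.I)‖ ≤ 3 * (Fintype.card ι : ℝ)⁻¹) :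
    ∫ s in (1 : ℝ)..3, ‖∑ l, Complex.exp (φ l s * Complex.I)‖ ^ 2 ≤ 5 * Fintype.card ι := by
  classical
  have hsq : ∀ s, ((‖∑ l, Complex.exp (φ l s * Complex.I)‖ ^ 2 : ℝ) : ℂ)
      = ∑ l, ∑ l', Complex.exp (((φ l s - φ l' s : ℝ) : ℂ) * Complex.I) := by
    intro s
    rw [Complex.ofReal_pow, ← Complex.mul_conj', map_sum, Finset.sum_mul_sum]
    refine Finset.sum_congr rfl fun l _ => Finset.sum_congr rfl fun l' _ => ?_
    rw [← Complex.exp_conj, ← Complex.exp_add]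
    congr 1
    simp
    ring
  have hintegral : ∀ l l', IntervalIntegrable (fun s => Complex.exp (((φ l s - φ l' s : ℝ) : ℂ)
      * Complex.I)) volume 1 3 := by
    intro l l'
    refine ContinuousOn.intervalIntegrable ?_
    rw [uIcc_of_le (by norm_num)]
    have := (hφ l).sub (hφ l')
    exact Complex.continuous_exp.comp_continuousOn
      ((Complex.continuous_ofReal.comp_continuousOn this).mul continuousOn_const)
  have hintegral' : ∀ l, IntervalIntegrable (fun s => ∑ l', Complex.exp (((φ l s - φ l' s : ℝ) : ℂ)
      * Complex.I)) volume 1 3 := by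
    intro l
    have h := IntervalIntegrable.sum Finset.univ fun l' _ => hintegral l l'
    rwa [show (∑ l', fun s => Complex.exp (((φ l s - φ l' s : ℝ) : ℂ) * Complex.I))
      = fun s => ∑ l', Complex.exp (((φ l s - φ l' s : ℝ) : ℂ) * Complex.I) from
        funext fun s => Finset.sum_apply _ _ _] at h
  have h1 : ((∫ s in (1 : ℝ)..3, ‖∑ l, Complex.exp (φ l s * Complex.I)‖ ^ 2 : ℝ) : ℂ)
      = ∑ l, ∑ l', ∫ s in (1 : ℝ)..3, Complex.exp (((φ l s - φ l' s : ℝ) : ℂ) * Complex.I) := by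
    rw [← intervalIntegral.integral_ofReal]
    simp_rw [hsq]
    rw [intervalIntegral.integral_finsetSum fun l _ => hintegral' l]
    refine Finset.sum_congr rfl fun l _ => ?_
    rw [intervalIntegral.integral_finsetSum fun l' _ => hintegral l l']
  set M : ℝ := (Fintype.card ι : ℝ) with hM
  have h2 : ‖∑ l, ∑ l', ∫ s in (1 : ℝ)..3, Complex.exp (((φ l s - φ l' s : ℝ) : ℂ) * Complex.I)‖
      ≤ 5 * M := by
    refine (norm_sum_le _ _).trans ?_
    calc _ ≤ ∑ l : ι, (5 : ℝ) := Finset.sum_le_sum fun l _ => ?_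
      _ = 5 * M := by simp [hM]; ring
    refine (norm_sum_le _ _).trans ?_
    rw [← Finset.add_sum_erase _ _ (Finset.mem_univ l)]
    have hMpos : 0 < M := by
      have : Nonempty ι := ⟨l⟩
      rw [hM]
      exact_mod_cast Fintype.card_pos
    have a1 : ‖∫ s in (1 : ℝ)..3, Complex.exp (((φ l s - φ l s : ℝ) : ℂ) * Complex.I)‖ = 2 := by
      simp; norm_num
    have a2 : ∑ l' ∈ Finset.univ.erase l, ‖∫ s in (1 : ℝ)..3,
        Complex.exp (((φ l s - φ l' s : ℝ) : ℂ) * Complex.I)‖ ≤ 3 := by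
      calc _ ≤ ∑ l' ∈ Finset.univ.erase l, 3 * M⁻¹ := Finset.sum_le_sum fun l' hl' =>
            hpair l l' (Finset.ne_of_mem_erase hl').symm
        _ ≤ ∑ l' : ι, 3 * M⁻¹ := Finset.sum_le_univ_sum_of_nonneg fun _ => by positivity
        _ = 3 := by simp [← hM]; field_simp
    linarith
  rw [← h1, Complex.norm_real] at h2
  exact (le_abs_self _).trans h2

/-- If a large family of functions is mutually oscillating, then on any set of many separated
points some member of the family comes close to a prescribed residue. -/
theorem exists_close_of_oscillation {ι : Type*} [Fintype ι] [Nonempty ι] (f : ι → ℝ → ℝ)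
    {θ ρ N : ℝ} {D P : ℕ} (x : ℝ) (s : ℕ → ℝ) (hθ : 0 < θ) (hρ : 0 < ρ) (hρ1 : ρ ≤ 1)
    (hN : N * ρ ≤ θ / 2) (hN0 : 0 ≤ N) (hD : 2 ≤ D * θ ^ 2)
    (hcont : ∀ l, ContinuousOn (f l) (Icc 1 3))
    (hlip : ∀ l, ∀ u ∈ Icc (1 : ℝ) 3, ∀ v ∈ Icc (1 : ℝ) 3, |f l u - f l v| ≤ N * |u - v|)
    (hpair : ∀ k : ℕ, 1 ≤ k → ∀ l l', l ≠ l' → ‖∫ s in (1 : ℝ)..3,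
      Complex.exp (((2 * π * k * (f l s - f l' s) : ℝ) : ℂ) * Complex.I)‖
        ≤ 3 * (Fintype.card ι : ℝ)⁻¹)
    (hs : ∀ i < P, s i ∈ Icc (1 : ℝ) 2)
    (hsep : ∀ i < P, ∀ i' < P, i ≠ i' → ρ ≤ |s i - s i'|)
    (hlarge : 80 * (D : ℝ) ^ 2 < P * ρ * Fintype.card ι) :
    ∃ i < P, ∃ l, ∃ p : ℤ, |f l (s i) - x - p| ≤ θ := by
  by_contra hcon
  push Not at hcon
  set M : ℝ := (Fintype.card ι : ℝ) with hM
  have hMpos : 0 < M := by rw [hM]; exact_mod_cast Fintype.card_pos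
  have hDpos : 0 < (D : ℝ) := by
    by_contra h
    push Not at h
    nlinarith [sq_nonneg θ]
  let φ : ℕ → ι → ℝ → ℝ := fun k l u => 2 * π * (k * (f l u - x))
  have hφc : ∀ k l, ContinuousOn (φ k l) (Icc 1 3) := fun k l =>
    continuousOn_const.mul (continuousOn_const.mul ((hcont l).sub continuousOn_const))
  let S : ℝ → ℝ := fun u => ∑ k ∈ Finset.Ico 1 D, ‖∑ l, Complex.exp (φ k l u * Complex.I)‖ ^ 2
  have hTc : ∀ k, ContinuousOn (fun u => ‖∑ l, Complex.exp (φ k l u * Complex.I)‖ ^ 2)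
      (Icc 1 3) := by
    intro k
    refine ContinuousOn.pow (ContinuousOn.norm (continuousOn_finsetSum _ fun l _ => ?_)) 2
    exact Complex.continuous_exp.comp_continuousOn
      ((Complex.continuous_ofReal.comp_continuousOn (hφc k l)).mul continuousOn_const)
  have hSc : ContinuousOn S (Icc 1 3) := continuousOn_finsetSum _ fun k _ => hTc k
  have hS0 : ∀ u, 0 ≤ S u := fun u => Finset.sum_nonneg fun _ _ => by positivity
  have hup : ∫ u in (1 : ℝ)..3, S u ≤ D * (5 * M) := by
    have h13 : uIcc (1 : ℝ) 3 = Icc 1 3 := uIcc_of_le (by norm_num)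
    have hTi : ∀ k, IntervalIntegrable
        (fun u => ‖∑ l, Complex.exp (φ k l u * Complex.I)‖ ^ 2) volume 1 3 := by
      intro k
      refine ContinuousOn.intervalIntegrable ?_
      rw [h13]
      exact hTc k
    rw [intervalIntegral.integral_finsetSum fun k _ => hTi k]
    calc _ ≤ ∑ k ∈ Finset.Ico 1 D, 5 * M := by
          refine Finset.sum_le_sum fun k hk => ?_
          refine integral_sq_norm_exp_sum_le (φ k) (hφc k) fun l l' hne => ?_
          have := hpair k (Finset.mem_Ico.1 hk).1 l l' hne
          convert this using 7
          simp only [φ]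
          ring
      _ = ((Finset.Ico 1 D).card : ℝ) * (5 * M) := by simp
      _ ≤ D * (5 * M) := by
          gcongr
          rw [Nat.card_Ico]; exact Nat.sub_le _ _
  let E : Set ℝ := ⋃ i ∈ Finset.range P, Ico (s i) (s i + ρ)
  have hEsub : E ⊆ Icc 1 3 := by
    intro u hu
    simp only [E, mem_iUnion, Finset.mem_range] at hu
    obtain ⟨i, hi, hu⟩ := hu
    exact ⟨(hs i hi).1.trans hu.1, by linarith [hu.2, (hs i hi).2]⟩
  have hEm : MeasurableSet E := Finset.measurableSet_biUnion _ fun _ _ => measurableSet_Ico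
  have hEvol : volume.real E = P * ρ := by
    rw [measureReal_biUnion_finset ?_ (fun _ _ => measurableSet_Ico)
      (fun i _ => by rw [Real.volume_Ico]; exact ENNReal.ofReal_ne_top)]
    · simp [hρ.le]
    · intro i hi i' hi' hne
      rw [Function.onFun, Set.disjoint_left]
      intro u hu hu'
      have := hsep i (by simpa using hi) i' (by simpa using hi') hne
      rcases le_abs.1 this with h | h <;> linarith [hu.1, hu.2, hu'.1, hu'.2]
  have hlow : ∀ u ∈ E, M ^ 2 / (16 * D) ≤ S u := by
    intro u hu
    have hu13 := hEsub hu
    simp only [E, mem_iUnion, Finset.mem_range] at hu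
    obtain ⟨i, hi, hu⟩ := hu
    refine sum_sq_norm_exp_sum_ge (fun l => f l u - x) hθ hD fun l p => ?_
    have h1 := hcon i hi l p
    have hsi : s i ∈ Icc (1 : ℝ) 3 := ⟨(hs i hi).1, by linarith [(hs i hi).2]⟩
    have h2 := hlip l (s i) hsi u hu13
    have h3 : |s i - u| ≤ ρ := by
      rw [abs_le]; constructor <;> linarith [hu.1, hu.2]
    have h4 : |f l (s i) - f l u| ≤ θ / 2 := h2.trans (le_trans (by gcongr) hN)
    have h5 := abs_add_le (f l (s i) - f l u) (f l u - x - p)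
    rw [show f l (s i) - f l u + (f l u - x - p) = f l (s i) - x - p by ring] at h5
    linarith
  have hIc : IntegrableOn S (Icc 1 3) := hSc.integrableOn_Icc
  have h1 : M ^ 2 / (16 * D) * volume.real E ≤ ∫ u in E, S u := by
    have hEfin : volume E ≠ ⊤ := by
      refine ne_top_of_le_ne_top ?_ (measure_mono hEsub)
      rw [Real.volume_Icc]; exact ENNReal.ofReal_ne_top
    exact setIntegral_ge_of_const_le_real hEm hEfin hlow (hIc.mono_set hEsub)
  have h2 : ∫ u in E, S u ≤ ∫ u in (1 : ℝ)..3, S u := by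
    rw [intervalIntegral.integral_of_le (by norm_num), ← integral_Icc_eq_integral_Ioc]
    exact setIntegral_mono_set hIc (Filter.Eventually.of_forall hS0)
      (Filter.Eventually.of_forall hEsub)
  have h3 := h1.trans (h2.trans hup)
  rw [hEvol, div_mul_eq_mul_div, div_le_iff₀ (by positivity)] at h3
  have h4 : M * (P * ρ * M) ≤ M * (80 * (D : ℝ) ^ 2) := by
    calc M * (P * ρ * M) = M ^ 2 * (P * ρ) := by ring
      _ ≤ _ := h3
      _ = _ := by ring
  exact absurd (le_of_mul_le_mul_left h4 hMpos) (not_le.2 hlarge)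

/-- Integer coefficients of a Möbius map, with `p₀` and `q₀` the constant terms of the numerator
and the denominator. -/
structure Mob where
  p : ℤ
  p₀ : ℤ
  q : ℤ
  q₀ : ℤ

namespace Mob

/-- The value of the Möbius map at a real point. -/
noncomputable def eval (V : Mob) (s : ℝ) : ℝ := (V.p * s + V.p₀) / (V.q * s + V.q₀)

/-- Composition with `s ↦ a + 1 / s`. -/
def step (V : Mob) (a : ℤ) : Mob := ⟨a * V.p + V.p₀, V.p, a * V.q + V.q₀, V.q⟩

/-- The determinant of the coefficient matrix. -/
def det (V : Mob) : ℤ := V.p * V.q₀ - V.p₀ * V.q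

/-- The partial quotient encoded by a bit. -/
def digit (b : Bool) : ℤ := if b then 3 else 1

/-- Appending a word of partial quotients, the head of the list being the last one. -/
def word (V : Mob) : List Bool → Mob
  | [] => V
  | b :: l => (V.word l).step (digit b)

/-- Unimodular coefficients with comparable positive denominators. -/
structure Good (V : Mob) : Prop where
  det_eq : V.det = 1 ∨ V.det = -1
  q_pos : 0 < V.q
  q_le : V.q ≤ 4 * V.q₀
  q₀_le : V.q₀ ≤ V.q

theorem Good.step {V : Mob} (h : V.Good) (b : Bool) : (V.step (digit b)).Good := by
  obtain ⟨h1, h2, h3, h4⟩ := h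
  have hdet : (V.step (digit b)).det = -V.det := by simp only [det, Mob.step]; ring
  refine ⟨?_, ?_, ?_, ?_⟩
  · rw [hdet]
    rcases h1 with h | h <;> rw [h] <;> simp
  all_goals cases b <;> simp [Mob.step, digit] <;> omega

theorem Good.word {V : Mob} (h : V.Good) (l : List Bool) : (V.word l).Good := by
  induction l with
  | nil => exact h
  | cons b l ih => exact ih.step b

theorem Good.q_pos_real {V : Mob} (h : V.Good) : (0 : ℝ) < V.q := by exact_mod_cast h.q_pos

theorem Good.q₀_pos_real {V : Mob} (h : V.Good) : (0 : ℝ) < V.q₀ := by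
  have := h.q_pos
  have := h.q_le
  exact_mod_cast (by omega : 0 < V.q₀)

theorem Good.q₀_le_real {V : Mob} (h : V.Good) : (V.q₀ : ℝ) ≤ V.q := by exact_mod_cast h.q₀_le

theorem Good.q_le_real {V : Mob} (h : V.Good) : (V.q : ℝ) ≤ 4 * V.q₀ := by exact_mod_cast h.q_le

theorem Good.den_pos {V : Mob} (h : V.Good) {s : ℝ} (hs : 1 ≤ s) : 0 < V.q * s + V.q₀ := by
  have := h.q_pos_real
  have := h.q₀_pos_real
  positivity

theorem det_word (V : Mob) (l : List Bool) : (V.word l).det = (-1) ^ l.length * V.det := by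
  induction l with
  | nil => simp [word]
  | cons b l ih =>
    have : ((V.word l).step (digit b)).det = -(V.word l).det := by simp only [det, step]; ring
    rw [word, this, ih, List.length_cons, pow_succ]
    ring

theorem Good.q_le_q_word {V : Mob} (h : V.Good) (l : List Bool) : V.q ≤ (V.word l).q := by
  induction l with
  | nil => exact le_rfl
  | cons b l ih =>
    have h1 := (h.word l).q_pos
    have h2 := (h.word l).q_le
    refine ih.trans ?_
    cases b <;> simp [Mob.word, Mob.step, digit] <;> omega

theorem Good.q_step_le {V : Mob} (h : V.Good) (b : Bool) : (V.step (digit b)).q ≤ 4 * V.q :=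
  (h.step b).q_le

theorem Good.q_word_le {V : Mob} (h : V.Good) (l : List Bool) :
    (V.word l).q ≤ 4 ^ l.length * V.q := by
  induction l with
  | nil => simp [Mob.word]
  | cons b l ih =>
    have := (h.word l).q_step_le b
    rw [List.length_cons, pow_succ, Mob.word]
    linarith

theorem cast_digit_true : (digit true : ℝ) = 3 := by simp [digit]

theorem cast_digit_false : (digit false : ℝ) = 1 := by simp [digit]

theorem digit_add_mem {s : ℝ} (hs : s ∈ Icc (1 : ℝ) 5) (b : Bool) :
    (digit b : ℝ) + 1 / s ∈ Icc (1 : ℝ) 5 := by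
  have h1 : 0 < 1 / s := by have := hs.1; positivity
  have h2 : 1 / s ≤ 1 := by
    have := hs.1
    rw [div_le_one (by linarith)]; exact this
  cases b
  · rw [cast_digit_false]; constructor <;> linarith
  · rw [cast_digit_true]; constructor <;> linarith

theorem eval_step (V : Mob) (a : ℤ) {s : ℝ} (hs : 0 < s) :
    (V.step a).eval s = V.eval (a + 1 / s) := by
  have e1 : (V.p : ℝ) * (a + 1 / s) + V.p₀ = (((V.step a).p : ℝ) * s + (V.step a).p₀) / s := by
    simp only [step]; push_cast; field_simp; ring
  have e2 : (V.q : ℝ) * (a + 1 / s) + V.q₀ = (((V.step a).q : ℝ) * s + (V.step a).q₀) / s := by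
    simp only [step]; push_cast; field_simp; ring
  rw [eval, eval, e1, e2, div_div_div_cancel_right₀ hs.ne']

theorem exists_eval_word (V : Mob) (l : List Bool) {s : ℝ} (hs : s ∈ Icc (1 : ℝ) 5) :
    ∃ s' ∈ Icc (1 : ℝ) 5, (V.word l).eval s = V.eval s' := by
  induction l generalizing s with
  | nil => exact ⟨s, hs, rfl⟩
  | cons b l ih =>
    rw [word, eval_step _ _ (by linarith [hs.1])]
    exact ih (digit_add_mem hs b)

theorem Good.abs_eval_sub_le {V : Mob} (h : V.Good) {s : ℝ} (hs : 1 ≤ s) :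
    |V.eval s - V.p / V.q| ≤ 1 / (V.q : ℝ) ^ 2 := by
  have hq := h.q_pos_real
  have hd := h.den_pos hs
  have e : V.eval s - V.p / V.q = -(V.det : ℝ) / (V.q * (V.q * s + V.q₀)) := by
    rw [eval, det, div_sub_div _ _ hd.ne' hq.ne', div_eq_div_iff (by positivity) (by positivity)]
    push_cast; ring
  have hdet : |(V.det : ℝ)| = 1 := by rcases h.det_eq with h | h <;> rw [h] <;> simp
  rw [e, abs_div, abs_neg, hdet, abs_of_pos (by positivity)]
  have h' := h.q₀_pos_real
  apply one_div_le_one_div_of_le (by positivity)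
  nlinarith

theorem Good.abs_mul_eval_sub {V : Mob} (h : V.Good) {s : ℝ} (hs : 1 ≤ s) (a' b' : ℤ) :
    |((V.q * a' + V.q₀ * b' : ℤ) : ℝ) * V.eval s - ((V.p * a' + V.p₀ * b' : ℤ) : ℝ)|
      = |b' * s - a'| / (V.q * s + V.q₀) := by
  have hd := h.den_pos hs
  have e : ((V.q * a' + V.q₀ * b' : ℤ) : ℝ) * V.eval s - ((V.p * a' + V.p₀ * b' : ℤ) : ℝ)
      = (V.det : ℝ) * ((b' * s - a') / (V.q * s + V.q₀)) := by
    rw [eval, det]; push_cast; field_simp; ring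
  have hdet : |(V.det : ℝ)| = 1 := by rcases h.det_eq with h | h <;> rw [h] <;> simp
  rw [e, abs_mul, hdet, one_mul, abs_div, abs_of_pos hd]

theorem Good.exists_coords {V : Mob} (h : V.Good) (a b : ℤ) :
    ∃ a' b' : ℤ, a = V.p * a' + V.p₀ * b' ∧ b = V.q * a' + V.q₀ * b' := by
  refine ⟨V.det * (V.q₀ * a - V.p₀ * b), V.det * (V.p * b - V.q * a), ?_, ?_⟩
  all_goals
    have hd : V.det * V.det = 1 := by rcases h.det_eq with h | h <;> rw [h] <;> norm_num
    nth_rewrite 2 [det] at hd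
  · linear_combination (-a) * hd
  · linear_combination (-b) * hd

/-- Rationals with small denominator are far from values of a unimodular Möbius map. -/
theorem Good.one_div_le_of_le {V : Mob} (h : V.Good) {s : ℝ} (hs : s ∈ Icc (1 : ℝ) 5) {a b : ℤ}
    (hb : 0 < b) (hbq : b ≤ V.q) : 1 / (6 * (V.q : ℝ)) ≤ |b * V.eval s - a| := by
  obtain ⟨a', b', rfl, rfl⟩ := h.exists_coords a b
  rw [h.abs_mul_eval_sub hs.1]
  have hq := h.q_pos_real
  have hq' := h.q₀_le_real
  have hd := h.den_pos hs.1
  have h1 : 1 ≤ |b' * s - a'| := by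
    have hq0 := h.q_pos
    have hq1 : 0 < V.q₀ := by exact_mod_cast h.q₀_pos_real
    rcases lt_trichotomy b' 0 with hb' | hb' | hb'
    · have ha : 0 < a' := by
        by_contra hc
        push Not at hc
        nlinarith
      have ha1 : (1 : ℝ) ≤ a' := by exact_mod_cast ha
      have hb1 : (b' : ℝ) ≤ -1 := by exact_mod_cast (by omega : b' ≤ -1)
      exact le_abs.2 (Or.inr (by nlinarith [hs.1]))
    · subst hb'
      have ha : 0 < a' := by
        by_contra hc
        push Not at hc
        nlinarith
      have ha1 : (1 : ℝ) ≤ a' := by exact_mod_cast ha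
      exact le_abs.2 (Or.inr (by simpa using ha1))
    · have ha : a' ≤ 0 := by
        by_contra hc
        push Not at hc
        nlinarith
      have ha1 : (a' : ℝ) ≤ 0 := by exact_mod_cast ha
      have hb1 : (1 : ℝ) ≤ b' := by exact_mod_cast hb'
      exact le_abs.2 (Or.inl (by nlinarith [hs.1]))
  rw [div_le_div_iff₀ (by positivity) hd]
  nlinarith [hs.2]

/-- Values at badly approximable points are badly approximable by rationals with large
denominator. -/
theorem Good.le_mul_of_ge {V : Mob} (h : V.Good) {s c : ℝ} (hs : s ∈ Icc (1 : ℝ) 2) (hc1 : c ≤ 1)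
    (hsc : ∀ p b : ℤ, 0 < b → c ≤ b * |b * s - p|) {a b : ℤ} (hbq : V.q ≤ b) :
    c / 12 ≤ b * |b * V.eval s - a| := by
  obtain ⟨a', b', rfl, rfl⟩ := h.exists_coords a b
  rw [h.abs_mul_eval_sub hs.1]
  have hq := h.q_pos_real
  have hq' := h.q₀_le_real
  have hq4 := h.q_le_real
  have hd := h.den_pos hs.1
  have hbR : (V.q : ℝ) ≤ ((V.q * a' + V.q₀ * b' : ℤ) : ℝ) := by exact_mod_cast hbq
  have hd3 : V.q * s + V.q₀ ≤ 3 * V.q := by nlinarith [hs.2]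
  have big : 1 ≤ |b' * s - a'| →
      c / 12 ≤ ((V.q * a' + V.q₀ * b' : ℤ) : ℝ) * (|b' * s - a'| / (V.q * s + V.q₀)) := by
    intro h1
    calc c / 12 ≤ 1 / 3 := by linarith
      _ = V.q * (1 / (3 * V.q)) := by field_simp
      _ ≤ _ := by
        gcongr
        exact hq.le.trans hbR
  by_cases h1 : 1 ≤ |b' * s - a'|
  · exact big h1
  push Not at h1
  set b := V.q * a' + V.q₀ * b' with hb
  have hbpos : (0 : ℝ) < b := hq.trans_le hbR
  have hq0 := h.q_pos
  have hq1 : 0 < V.q₀ := by exact_mod_cast h.q₀_pos_real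
  have hb'pos : 0 < b' := by
    by_contra hc
    push Not at hc
    have ha : 0 < a' := by
      by_contra hc'
      push Not at hc'
      nlinarith
    have ha1 : (1 : ℝ) ≤ a' := by exact_mod_cast ha
    have hb1 : (b' : ℝ) ≤ 0 := by exact_mod_cast hc
    rw [abs_lt] at h1
    nlinarith [hs.1]
  have ha' : 0 ≤ a' := by
    by_contra hc
    push Not at hc
    have ha1 : (a' : ℝ) ≤ -1 := by exact_mod_cast (by omega : a' ≤ -1)
    have hb1 : (1 : ℝ) ≤ b' := by exact_mod_cast hb'pos
    rw [abs_lt] at h1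
    nlinarith [hs.1]
  have hb'R : (0 : ℝ) < b' := by exact_mod_cast hb'pos
  have ha'R : (0 : ℝ) ≤ a' := by exact_mod_cast ha'
  have h2 := hsc a' b' hb'pos
  have h3 : (V.q : ℝ) * b' ≤ 4 * b := by
    rw [hb]; push_cast; nlinarith
  rw [mul_div_assoc', le_div_iff₀ hd]
  have h4 : c / 12 * (V.q * s + V.q₀) ≤ b' * |b' * s - a'| * V.q / 4 := by
    have hX : 0 ≤ b' * |b' * s - a'| := by positivity
    calc c / 12 * (V.q * s + V.q₀) ≤ (b' * |b' * s - a'|) / 12 * (V.q * s + V.q₀) := by gcongr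
      _ ≤ (b' * |b' * s - a'|) / 12 * (3 * V.q) := by gcongr
      _ = _ := by ring
  refine h4.trans ?_
  nlinarith [abs_nonneg (b' * s - a')]

theorem Good.le_mul_of_q_lt_of_le {V : Mob} (h : V.Good) (l : List Bool) {s : ℝ}
    (hs : s ∈ Icc (1 : ℝ) 5) {a b : ℤ} (hb : V.q < b) (hbl : b ≤ (V.word l).q) :
    1 / 24 ≤ b * |b * (V.word l).eval s - a| := by
  induction l generalizing s with
  | nil => exact absurd hbl (not_le.2 hb)
  | cons d l ih =>
    by_cases hbl' : b ≤ (V.word l).q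
    · rw [Mob.word, eval_step _ _ (by linarith [hs.1])]
      exact ih (digit_add_mem hs d) hbl'
    push Not at hbl'
    have h1 := (h.word (d :: l)).one_div_le_of_le hs (a := a) (h.q_pos.trans hb) hbl
    have h2 : ((V.word (d :: l)).q : ℝ) ≤ 4 * (V.word l).q := by
      exact_mod_cast (h.word l).q_step_le d
    have h3 : ((V.word l).q : ℝ) ≤ b := by exact_mod_cast hbl'.le
    have hbpos : (0 : ℝ) < b := by exact_mod_cast h.q_pos.trans hb
    have hq := (h.word (d :: l)).q_pos_real
    calc (1 : ℝ) / 24 = b * (1 / (6 * (4 * b))) := by field_simp; norm_num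
      _ ≤ b * (1 / (6 * ((V.word (d :: l)).q : ℝ))) := by gcongr; linarith
      _ ≤ _ := by gcongr

/-- The ratio of the two denominators of a word. -/
noncomputable def ratio (V : Mob) : ℝ := V.q / V.q₀

theorem Good.ratio_mem {V : Mob} (h : V.Good) : V.ratio ∈ Icc (1 : ℝ) 4 := by
  have h1 := h.q₀_pos_real
  exact ⟨by rw [ratio, le_div_iff₀ h1]; linarith [h.q₀_le_real],
    by rw [ratio, div_le_iff₀ h1]; exact h.q_le_real⟩

theorem Good.ratio_step {V : Mob} (h : V.Good) (a : ℤ) :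
    (V.step a).ratio = a + 1 / V.ratio := by
  have h1 := h.q₀_pos_real
  have h2 := h.q_pos_real
  simp only [ratio, Mob.step]
  push_cast
  field_simp

theorem Good.ratio_word_sep {V : Mob} (h : V.Good) (l l' : List Bool)
    (hlen : l.length = l'.length) (hne : l ≠ l') :
    ((16 : ℝ) ^ l.length)⁻¹ ≤ |(V.word l).ratio - (V.word l').ratio| := by
  induction l generalizing l' with
  | nil =>
    rw [List.length_nil] at hlen
    exact absurd (List.length_eq_zero_iff.1 hlen.symm).symm hne
  | cons d l ih =>
    cases l' with
    | nil => simp at hlen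
    | cons d' l' =>
      simp only [List.length_cons, add_left_inj] at hlen
      simp only [Mob.word, (h.word _).ratio_step]
      have h1 := (h.word l).ratio_mem
      have h2 := (h.word l').ratio_mem
      set u := (V.word l).ratio
      set v := (V.word l').ratio
      have hu : 0 < u := by linarith [h1.1]
      have hv : 0 < v := by linarith [h2.1]
      by_cases hd : d = d'
      · subst hd
        have := ih l' hlen (fun hl => hne (by rw [hl]))
        rw [show (digit d : ℝ) + 1 / u - (digit d + 1 / v) = -(u - v) / (u * v) by
          field_simp; ring, abs_div, abs_neg, abs_of_pos (mul_pos hu hv),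
          le_div_iff₀ (mul_pos hu hv), List.length_cons, pow_succ, mul_inv]
        have h3 : u * v ≤ 16 := by nlinarith [h1.2, h2.2]
        have h4 : (0 : ℝ) < (16 ^ l.length)⁻¹ := by positivity
        calc ((16 : ℝ) ^ l.length)⁻¹ * 16⁻¹ * (u * v) ≤ (16 ^ l.length)⁻¹ * 16⁻¹ * 16 := by gcongr
          _ ≤ _ := by rw [mul_assoc, inv_mul_cancel₀ (by norm_num), mul_one]; exact this
      · have hle : ((16 : ℝ) ^ (d :: l).length)⁻¹ ≤ 1 := inv_le_one_of_one_le₀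
          (one_le_pow₀ (by norm_num))
        have a1 : 1 / u ≤ 1 := by rw [div_le_one hu]; exact h1.1
        have a2 : 1 / v ≤ 1 := by rw [div_le_one hv]; exact h2.1
        have a3 : 0 < 1 / u := by positivity
        have a4 : 0 < 1 / v := by positivity
        refine hle.trans ?_
        cases d <;> cases d' <;>
          first | exact absurd rfl hd | rw [cast_digit_true, cast_digit_false]
        · exact le_abs.2 (Or.inr (by linarith))
        · exact le_abs.2 (Or.inl (by linarith))

theorem Good.hasDerivAt_eval {V : Mob} (h : V.Good) {s : ℝ} (hs : 1 ≤ s) :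
    HasDerivAt V.eval (V.det * (1 / (V.q * s + V.q₀) ^ 2)) s := by
  have hd := h.den_pos hs
  have lin : ∀ a b : ℝ, HasDerivAt (fun s => a * s + b) a s := fun a b => by
    simpa using ((hasDerivAt_id s).const_mul a).add_const b
  refine ((lin V.p V.p₀).div (lin V.q V.q₀) hd.ne').congr_deriv ?_
  rw [det]
  push_cast
  field_simp
  ring

end Mob

theorem Mob.Good.abs_eval_sub_eval_le {V : Mob} (h : V.Good) {u v : ℝ} (hu : 1 ≤ u) (hv : 1 ≤ v) :
    |V.eval u - V.eval v| ≤ 1 / (V.q : ℝ) ^ 2 * |u - v| := by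
  have hq := h.q_pos_real
  have hq' := h.q₀_pos_real
  have hdu := h.den_pos hu
  have hdv := h.den_pos hv
  have e : V.eval u - V.eval v
      = (V.det : ℝ) * ((u - v) / ((V.q * u + V.q₀) * (V.q * v + V.q₀))) := by
    rw [Mob.eval, Mob.eval, Mob.det, div_sub_div _ _ hdu.ne' hdv.ne', ← mul_div_assoc]
    congr 1
    push_cast; ring
  have hdet : |(V.det : ℝ)| = 1 := by rcases h.det_eq with h | h <;> rw [h] <;> simp
  rw [e, abs_mul, hdet, one_mul, abs_div, abs_of_pos (mul_pos hdu hdv), div_mul_eq_mul_div, one_mul]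
  refine div_le_div_of_nonneg_left (abs_nonneg _) (by positivity) ?_
  rw [sq]
  exact mul_le_mul (by nlinarith) (by nlinarith) hq.le hdu.le

/-- Among the maps obtained by appending `m` partial quotients to `V`, one sends a badly
approximable point to a number whose `n`-th multiple is close to `x` modulo one. -/
theorem Mob.Good.exists_word_close {K g k n : ℕ} {R : ℝ} (hK : 2 ≤ K) (hg : 9 ≤ g)
    (hR : R = 2 * K + 2) (hk : 1280 * R < 2 ^ k) {V : Mob} (h : V.Good)
    (hn : (V.q : ℝ) ^ 2 * 2 ^ (23 * (g * k) + 29) ≤ n)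
    (hn' : n ≤ (V.q : ℝ) ^ 2 * (R ^ (k + 1) / 2)) (x : ℝ) :
    ∃ l : List Bool, ∃ s ∈ Icc (1 : ℝ) 2,
      (∀ p b : ℤ, 0 < b → 1 / (32 * R ^ 2) ≤ b * |b * s - p|) ∧
      ∃ p : ℤ, |n * (V.word l).eval s - x - p| ≤ ((2 : ℝ) ^ k)⁻¹ := by
  have hK' : (2 : ℝ) ≤ K := by exact_mod_cast hK
  have hRpos : 0 < R := by rw [hR]; positivity
  have hR6 : 6 ≤ R := by rw [hR]; linarith
  have hRK : R ≤ 4 * K := by rw [hR]; linarith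
  have hq := h.q_pos_real
  obtain ⟨f, hf, hfsep⟩ := exists_tree_badly_approximable hK hR one_pos 1
  have hf1 : ∀ y ∈ Ico (0 : ℝ) 1, ∀ p b : ℤ, 0 < b → 1 / (32 * R ^ 2) ≤ b * |b * f y - p| := by
    intro y hy p b hb
    refine (hf y hy).2 p b hb ?_
    have : (1 : ℝ) ≤ b := by exact_mod_cast hb
    rw [mul_one, div_le_iff₀ (by positivity)]
    nlinarith
  set m := g * k with hm
  set P := K ^ (2 * k + 1) with hP
  have hPpos : (0 : ℝ) < P := by rw [hP]; positivity
  have hmem : ∀ i < P, (i : ℝ) / P ∈ Ico (0 : ℝ) 1 := fun i hi =>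
    ⟨by positivity, by rw [div_lt_one hPpos]; exact_mod_cast hi⟩
  have hsep : ∀ i < P, ∀ i' < P, i ≠ i' →
      1 / R ^ (2 * k + 2) ≤ |f ((i : ℝ) / P) - f ((i' : ℝ) / P)| := by
    intro i hi i' hi' hne
    refine hfsep _ (hmem i hi) _ (hmem i' hi') _ ?_
    have h1 : (1 : ℝ) ≤ |(i : ℝ) - i'| := by
      have : (1 : ℤ) ≤ |(i : ℤ) - i'| := Int.one_le_abs (by omega)
      exact_mod_cast this
    rw [← sub_div, abs_div, abs_of_pos hPpos, lt_div_iff₀ hPpos]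
    refine lt_of_lt_of_le ?_ h1
    rw [hP, Nat.cast_pow, inv_mul_lt_iff₀ (by positivity), mul_one]
    exact pow_lt_pow_right₀ (by linarith) (by omega)
  have hdet : ∀ l : List Bool, |((V.word l).det : ℝ)| = 1 := fun l => by
    rcases (h.word l).det_eq with h | h <;> rw [h] <;> simp
  have hkey := exists_close_of_oscillation (ι := List.Vector Bool m)
    (fun l s => n * (V.word l.1).eval s) (θ := ((2 : ℝ) ^ k)⁻¹) (ρ := 1 / R ^ (2 * k + 2))
    (N := n / (V.q : ℝ) ^ 2) (D := 2 * 4 ^ k) (P := P) x (fun i => f ((i : ℝ) / P))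
    (by positivity) (by positivity) ?_ ?_ (by positivity) ?_ ?_ ?_ ?_ ?_ hsep ?_
  · obtain ⟨i, hi, l, p, hp⟩ := hkey
    refine ⟨l.1, _, ?_, hf1 _ (hmem i hi), p, hp⟩
    have := (hf _ (hmem i hi)).1
    exact ⟨this.1, by linarith [this.2]⟩
  · rw [div_le_one (by positivity)]
    exact one_le_pow₀ (by linarith)
  · have h1 : n / (V.q : ℝ) ^ 2 ≤ R ^ (k + 1) / 2 := by
      rw [div_le_iff₀ (by positivity)]; linarith
    have h2 : (2 : ℝ) ^ k ≤ R ^ (k + 1) := by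
      calc (2 : ℝ) ^ k ≤ R ^ k := pow_le_pow_left₀ (by norm_num) (by linarith) _
        _ ≤ R ^ (k + 1) := pow_le_pow_right₀ (by linarith) (by omega)
    calc n / (V.q : ℝ) ^ 2 * (1 / R ^ (2 * k + 2))
        ≤ R ^ (k + 1) / 2 * (1 / R ^ (2 * k + 2)) := by gcongr
      _ = (R ^ (k + 1))⁻¹ / 2 := by
          field_simp; ring
      _ ≤ ((2 : ℝ) ^ k)⁻¹ / 2 := by gcongr
  · have : (4 : ℝ) ^ k = 2 ^ k * 2 ^ k := by rw [← mul_pow]; norm_num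
    push_cast
    rw [this]
    apply le_of_eq
    field_simp
  · intro l s hs
    exact ((h.word l.1).hasDerivAt_eval hs.1).continuousAt.continuousWithinAt.const_smul
      (n : ℝ)
  · intro l u hu v hv
    rw [← mul_sub, abs_mul, Nat.abs_cast, div_eq_mul_one_div, mul_assoc]
    refine mul_le_mul_of_nonneg_left (((h.word l.1).abs_eval_sub_eval_le hu.1 hv.1).trans ?_)
      (Nat.cast_nonneg _)
    have : (V.q : ℝ) ≤ (V.word l.1).q := by exact_mod_cast h.q_le_q_word l.1
    gcongr
  · intro j hj l l' hne
    have hj' : (1 : ℝ) ≤ j := by exact_mod_cast hj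
    have hlen : l.1.length = m := l.2
    have hlen' : l'.1.length = m := l'.2
    have hcard : (Fintype.card (List.Vector Bool m) : ℝ) = 2 ^ m := by simp [card_vector]
    rw [hcard]
    have hl := h.word l.1
    have hl' := h.word l'.1
    have hsame : ((V.word l'.1).det : ℝ) = (V.word l.1).det := by
      rw [Mob.det_word, Mob.det_word, hlen, hlen']
    refine norm_integral_exp_mobius_sub_le m (q := V.q) (A := (V.word l.1).q)
      (B := (V.word l.1).q₀) (A' := (V.word l'.1).q) (B' := (V.word l'.1).q₀)
      (κ := 2 * π * j * n * (V.word l.1).det) hq ?_ ?_ ?_ hl.q₀_le_real ?_ ?_ ?_ hl'.q₀_le_real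
      ?_ ?_ (fun s => 2 * π * j * (n * (V.word l.1).eval s - n * (V.word l'.1).eval s)) ?_
    · exact_mod_cast h.q_le_q_word l.1
    · have := h.q_word_le l.1
      rw [hlen] at this
      exact_mod_cast this
    · linarith [hl.q_le_real]
    · exact_mod_cast h.q_le_q_word l'.1
    · have := h.q_word_le l'.1
      rw [hlen'] at this
      exact_mod_cast this
    · linarith [hl'.q_le_real]
    · have := h.ratio_word_sep l.1 l'.1 (hlen.trans hlen'.symm) (fun e => hne (Subtype.ext e))
      rwa [hlen] at this
    · rw [abs_mul, hdet, mul_one, abs_of_nonneg (by positivity)]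
      refine hn.trans (le_mul_of_one_le_left (Nat.cast_nonneg _) ?_)
      nlinarith [pi_gt_three]
    · intro s hs
      refine ((((hl.hasDerivAt_eval hs.1).const_mul (n : ℝ)).sub
        ((hl'.hasDerivAt_eval hs.1).const_mul (n : ℝ))).const_mul (2 * π * j)).congr_deriv ?_
      rw [hsame]; ring
  · intro i hi
    have := (hf _ (hmem i hi)).1
    exact ⟨this.1, by linarith [this.2]⟩
  · have hcard : (Fintype.card (List.Vector Bool m) : ℝ) = 2 ^ m := by simp [card_vector]
    rw [hcard]
    have h1 : (2 : ℝ) ^ k * 256 ^ k ≤ 2 ^ m := by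
      rw [← mul_pow, hm, pow_mul]
      refine pow_le_pow_left₀ (by norm_num) ?_ _
      calc (2 : ℝ) * 256 = 2 ^ 9 := by norm_num
        _ ≤ 2 ^ g := pow_le_pow_right₀ (by norm_num) hg
    have h2 : R ^ (2 * k + 1) ≤ 4 * 16 ^ k * P := by
      rw [hP]
      calc R ^ (2 * k + 1) ≤ (4 * K) ^ (2 * k + 1) := pow_le_pow_left₀ hRpos.le hRK _
        _ = _ := by
          rw [mul_pow, pow_succ, pow_mul]; push_cast; norm_num; left; ring
    have h3 : (256 : ℝ) ^ k = 16 ^ k * 16 ^ k := by rw [← mul_pow]; norm_num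
    have h4 : (4 : ℝ) ^ k * 4 ^ k = 16 ^ k := by rw [← mul_pow]; norm_num
    have h5 : (80 : ℝ) * ((2 * 4 ^ k : ℕ) : ℝ) ^ 2 = 320 * 16 ^ k := by
      push_cast; rw [← h4]; ring
    rw [h5, mul_one_div, div_mul_eq_mul_div, lt_div_iff₀ (by positivity)]
    have h16 : (0 : ℝ) < 16 ^ k := by positivity
    calc 320 * 16 ^ k * R ^ (2 * k + 2) = 320 * 16 ^ k * R * R ^ (2 * k + 1) := by ring
      _ ≤ 320 * 16 ^ k * R * (4 * 16 ^ k * P) := by gcongr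
      _ = 1280 * R * (P * (16 ^ k * 16 ^ k)) := by ring
      _ < 2 ^ k * (P * (16 ^ k * 16 ^ k)) := by gcongr
      _ = P * (2 ^ k * 256 ^ k) := by rw [h3]; ring
      _ ≤ P * 2 ^ m := by gcongr

/-- A reduced fraction extends to a unimodular pair of fractions with comparable denominators. -/
theorem Mob.exists_good_of_coprime {p q : ℤ} (hq : 0 < q) (hpq : IsCoprime p q) :
    ∃ V : Mob, V.Good ∧ V.p = p ∧ V.q = q := by
  obtain ⟨u, v, huv⟩ := hpq
  have h0 : 0 ≤ u % q := Int.emod_nonneg _ hq.ne'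
  have h1 : u % q < q := Int.emod_lt_of_pos _ hq
  have h2 : p * (u % q) - (-v - p * (u / q)) * q = 1 := by
    linear_combination huv + p * Int.emod_add_mul_ediv u q
  by_cases h3 : q ≤ 2 * (u % q)
  · exact ⟨⟨p, -v - p * (u / q), q, u % q⟩, ⟨Or.inl h2, hq, by dsimp only; omega, h1.le⟩, rfl, rfl⟩
  · refine ⟨⟨p, p - (-v - p * (u / q)), q, q - u % q⟩,
      ⟨Or.inr ?_, hq, by dsimp only; omega, by dsimp only; omega⟩, rfl, rfl⟩
    simp only [Mob.det]
    linear_combination -h2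

theorem exists_mob_near {K : ℕ} (hK : 2 ≤ K) {R c c₄ C₀ a ℓ : ℝ} (hR : R = 2 * K + 2)
    (hc : c = 1 / (32 * R ^ 2)) (hc₄ : 0 < c₄) (hC₀ : 2 ≤ C₀ * c₄) (hC1 : 1 ≤ C₀)
    (hℓ : 0 < ℓ) (hℓ1 : ℓ ≤ 1)
    (hI : ∀ z ∈ Icc a (a + ℓ), ∀ p b : ℤ, 0 < b → b ^ 2 * ℓ < 1 / (4 * R) →
      c₄ ≤ b * |b * z - p|) :
    ∃ V : Mob, V.Good ∧ ∃ y ∈ Icc (a + ℓ / 4) (a + 3 * ℓ / 4), ∃ Q : ℝ, 0 < Q ∧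
      (∀ p b : ℤ, 0 < b → 1 / (4 * R) ≤ b ^ 2 * ℓ → c ≤ b * |b * y - p|) ∧
      C₀ ^ 2 ≤ Q ^ 2 * ℓ ∧ Q ^ 2 * ℓ ≤ 4 * C₀ ^ 2 ∧ c * Q ≤ V.q ∧ V.q ≤ Q ∧
      |y - V.p / V.q| ≤ 1 / (Q * V.q) := by
  have hK' : (2 : ℝ) ≤ K := by exact_mod_cast hK
  have hRpos : 0 < R := by rw [hR]; positivity
  have hR6 : 6 ≤ R := by rw [hR]; linarith
  obtain ⟨f, hf, -⟩ := exists_tree_badly_approximable hK hR (half_pos hℓ) (a + ℓ / 4)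
  obtain ⟨hy, hyb⟩ := hf 0 ⟨le_rfl, one_pos⟩
  set y := f 0
  have hsq : 0 < √ℓ := sqrt_pos.2 hℓ
  have hsq1 : √ℓ ≤ 1 := sqrt_le_one.2 hℓ1
  have hsqsq : √ℓ ^ 2 = ℓ := sq_sqrt hℓ.le
  obtain ⟨Q, hQ⟩ : ∃ Q : ℕ, Q = ⌈C₀ / √ℓ⌉₊ := ⟨_, rfl⟩
  have hQ1 : C₀ ≤ Q * √ℓ := by
    rw [← div_le_iff₀ hsq, hQ]; exact Nat.le_ceil _
  have hQ2 : Q * √ℓ ≤ 2 * C₀ := by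
    have : (Q : ℝ) < C₀ / √ℓ + 1 := by rw [hQ]; exact Nat.ceil_lt_add_one (by positivity)
    have h2 : (C₀ / √ℓ + 1) * √ℓ = C₀ + √ℓ := by field_simp
    nlinarith
  have hQpos : (0 : ℝ) < Q := by
    by_contra h
    have : (Q : ℝ) * √ℓ ≤ 0 := mul_nonpos_of_nonpos_of_nonneg (not_lt.1 h) hsq.le
    linarith
  obtain ⟨r, hr, hrden⟩ := Real.exists_rat_abs_sub_le_and_den_le y (Nat.cast_pos.1 hQpos)
  have hden : (0 : ℝ) < r.den := by exact_mod_cast r.pos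
  have hrcast : (r : ℝ) = r.num / r.den := Rat.cast_def r
  have hrQ : (r.den : ℝ) ≤ Q := by exact_mod_cast hrden
  obtain ⟨V, hV, hVp, hVq⟩ := Mob.exists_good_of_coprime (p := r.num) (q := r.den)
    (by exact_mod_cast r.pos) (Rat.isCoprime_num_den r)
  have hVp' : (V.p : ℝ) = r.num := by rw [hVp]
  have hVq' : (V.q : ℝ) = r.den := by rw [hVq]; simp
  have hyr : |y - V.p / V.q| ≤ 1 / (Q * V.q) := by
    rw [hVp', hVq', ← hrcast]
    refine hr.trans ?_
    gcongr
    linarith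
  have hqy : V.q * |V.q * y - V.p| * Q ≤ V.q := by
    have hq := hV.q_pos_real
    have : |V.q * y - V.p| = V.q * |y - V.p / V.q| := by
      rw [← abs_of_pos hq, ← abs_mul, abs_of_pos hq]; congr 1; field_simp
    rw [this]
    rw [le_div_iff₀ (by positivity)] at hyr
    nlinarith
  have hyI : ∀ p b : ℤ, 0 < b → 1 / (4 * R) ≤ b ^ 2 * ℓ → c ≤ b * |b * y - p| := by
    intro p b hb h
    rw [hc]
    refine hyb p b hb ?_
    have : 1 / (8 * R) = 1 / (4 * R) / 2 := by field_simp; norm_num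
    rw [this]; linarith
  refine ⟨V, hV, y, ⟨hy.1, by linarith [hy.2]⟩, Q, hQpos, hyI, ?_, ?_, ?_, by rw [hVq']; exact hrQ,
    hyr⟩
  · rw [← hsqsq, ← mul_pow]; exact pow_le_pow_left₀ (by linarith) hQ1 _
  · rw [← hsqsq, ← mul_pow, show 4 * C₀ ^ 2 = (2 * C₀) ^ 2 by ring]
    exact pow_le_pow_left₀ (by positivity) hQ2 _
  · by_cases hcase : 1 / (4 * R) ≤ (V.q : ℝ) ^ 2 * ℓ
    · exact (mul_le_mul_of_nonneg_right (hyI V.p V.q hV.q_pos hcase) hQpos.le).trans hqy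
    · exfalso
      have h1 := hI y ⟨by linarith [hy.1], by linarith [hy.2]⟩ V.p V.q hV.q_pos (not_le.1 hcase)
      have h2 : c₄ * Q ≤ V.q := (mul_le_mul_of_nonneg_right h1 hQpos.le).trans hqy
      have h3 : (V.q * √ℓ) ^ 2 < 1 := by
        rw [mul_pow, hsqsq]
        refine (not_le.1 hcase).trans_le ?_
        rw [div_le_one (by positivity)]; linarith
      have h4 : V.q * √ℓ < 1 := by
        have : 0 ≤ V.q * √ℓ := by have := hV.q_pos_real; positivity
        nlinarith
      nlinarith

/-- Badly approximable behaviour of the points produced from `exists_mob_near`. -/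
theorem le_mul_abs_of_near {V : Mob} (h : V.Good) {c y Q ℓ X : ℝ} (hc : 0 < c) (hc1 : c ≤ 1)
    (hQ : 0 < Q)
    (hy : ∀ p b : ℤ, 0 < b → X ≤ b ^ 2 * ℓ → c ≤ b * |b * y - p|)
    (hq' : V.q ≤ Q) (l : List Bool) {s : ℝ} (hs : s ∈ Icc (1 : ℝ) 2)
    (hsc : ∀ p b : ℤ, 0 < b → c ≤ b * |b * s - p|)
    (hdist : |(V.word l).eval s - y| ≤ 2 / (c * Q) ^ 2) {p b : ℤ} (hb : 0 < b)
    (hbX : X ≤ b ^ 2 * ℓ) : c ^ 2 / 24 ≤ b * |b * (V.word l).eval s - p| := by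
  have hb' : (0 : ℝ) < b := by exact_mod_cast hb
  have hs5 : s ∈ Icc (1 : ℝ) 5 := ⟨hs.1, by linarith [hs.2]⟩
  have hcc : c ^ 2 ≤ c := by nlinarith
  by_cases h1 : (b : ℝ) ≤ c ^ 2 / 2 * Q
  · have h2 := hy p b hb hbX
    have h3 : |b * y - p| ≤ |b * (V.word l).eval s - p| + b * |(V.word l).eval s - y| := by
      have e : b * |(V.word l).eval s - y| = |b * ((V.word l).eval s - y)| := by
        rw [abs_mul, abs_of_pos hb']
      rw [e]
      calc |b * y - p| = |(b * (V.word l).eval s - p) - b * ((V.word l).eval s - y)| := by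
            congr 1; ring
        _ ≤ _ := abs_sub _ _
    have h4 : (b : ℝ) ^ 2 * (2 / (c * Q) ^ 2) ≤ c ^ 2 / 2 := by
      calc (b : ℝ) ^ 2 * (2 / (c * Q) ^ 2) ≤ (c ^ 2 / 2 * Q) ^ 2 * (2 / (c * Q) ^ 2) := by gcongr
        _ = c ^ 2 / 2 := by field_simp
    have h5 : (b : ℝ) ^ 2 * |(V.word l).eval s - y| ≤ c ^ 2 / 2 :=
      (mul_le_mul_of_nonneg_left hdist (by positivity)).trans h4
    nlinarith
  by_cases h2 : b ≤ V.q
  · obtain ⟨s', hs', e⟩ := V.exists_eval_word l hs5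
    have h3 := h.one_div_le_of_le hs' hb h2 (a := p)
    rw [e]
    have hq := h.q_pos_real
    calc c ^ 2 / 24 ≤ (c ^ 2 / 2 * Q) * (1 / (6 * Q)) := by
          rw [show (c ^ 2 / 2 * Q) * (1 / (6 * Q)) = c ^ 2 / 12 by field_simp; norm_num]
          nlinarith [sq_nonneg c]
      _ ≤ (b : ℝ) * (1 / (6 * (V.q : ℝ))) := by
          have := not_le.1 h1
          gcongr
      _ ≤ _ := by gcongr
  by_cases h3 : b ≤ (V.word l).q
  · have := h.le_mul_of_q_lt_of_le l hs5 (not_le.1 h2) h3 (a := p)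
    nlinarith
  · have := (h.word l).le_mul_of_ge hs hc1 hsc (not_le.1 h3).le (a := p)
    nlinarith

/-- The approximation constant of a tower of intervals with ratio `R`. -/
noncomputable def towerConst (R : ℝ) : ℝ := (1 / (32 * R ^ 2)) ^ 2 / (192 * R)

theorem towerConst_pos {R : ℝ} (hR : 0 < R) : 0 < towerConst R := by
  unfold towerConst; positivity

set_option maxHeartbeats 600000 in
/-- Inside an interval of length `ℓ` of numbers that are badly approximable up to the scale of the
interval, there is a subinterval of numbers that are badly approximable up to its scale and whose
`n`-th multiples are close to a prescribed `x` modulo one. -/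
theorem exists_subinterval_close {K g : ℕ} (hK : 2 ≤ K) (hg : 9 ≤ g) {R : ℝ} (hR : R = 2 * K + 2)
    (hRg : R = 2 ^ (30 * g)) : ∃ k₀ : ℕ, ∀ k ≥ k₀, ∀ a ℓ : ℝ, 0 < ℓ → ℓ ≤ 1 →
      (∀ z ∈ Icc a (a + ℓ), ∀ p b : ℤ, 0 < b → b ^ 2 * ℓ < 1 / (4 * R) →
        towerConst R ≤ b * |b * z - p|) →
      ∀ n : ℕ, R ^ k ≤ n * ℓ → n * ℓ ≤ R ^ (k + 1) → ∀ x : ℝ,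
      ∃ a', a ≤ a' ∧ a' + ℓ / R ^ (2 * k + 1) ≤ a + ℓ ∧
        ∀ z ∈ Icc a' (a' + ℓ / R ^ (2 * k + 1)),
          (∃ p : ℤ, |n * z - x - p| ≤ 2 * ((2 : ℝ) ^ k)⁻¹) ∧
          ∀ p b : ℤ, 0 < b → b ^ 2 * (ℓ / R ^ (2 * k + 1)) < 4 * R * towerConst R →
            towerConst R ≤ b * |b * z - p| := by
  have hR8 : 8 ≤ R := by
    rw [hRg]
    calc (8 : ℝ) = 2 ^ 3 := by norm_num
      _ ≤ 2 ^ (30 * g) := pow_le_pow_right₀ (by norm_num) (by omega)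
  have hRpos : 0 < R := by linarith
  obtain ⟨c, hc⟩ : ∃ c, c = 1 / (32 * R ^ 2) := ⟨_, rfl⟩
  have hcpos : 0 < c := by rw [hc]; positivity
  have hc1 : c ≤ 1 := by
    rw [hc, div_le_one (by positivity)]; nlinarith
  obtain ⟨d, hd⟩ : ∃ d, d = towerConst R := ⟨_, rfl⟩
  have hdc : 8 * R * d = c ^ 2 / 24 := by
    rw [hd, towerConst, ← hc]; field_simp; norm_num
  rw [← hd]
  have hdpos : 0 < d := by rw [hd]; exact towerConst_pos hRpos
  have hdle : d ≤ c := by nlinarith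
  obtain ⟨k₀, hk₀⟩ := pow_unbounded_of_one_lt (1280 * R + 2 ^ 31 * (4 / d) ^ 2)
    (one_lt_two : (1 : ℝ) < 2)
  refine ⟨k₀, fun k hk a ℓ hℓ hℓ1 hI n hn hn' x => ?_⟩
  have hk' : 1280 * R + 2 ^ 31 * (4 / d) ^ 2 < 2 ^ k :=
    hk₀.trans_le (pow_le_pow_right₀ one_le_two hk)
  obtain ⟨C₀, hC₀⟩ : ∃ C₀, C₀ = 4 / d := ⟨_, rfl⟩
  have hC₀d : C₀ * d = 4 := by rw [hC₀]; field_simp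
  have hC₀pos : 0 < C₀ := by rw [hC₀]; positivity
  have hC₀c : 4 ≤ C₀ * c := by rw [← hC₀d]; gcongr
  have hC1 : 1 ≤ C₀ := by nlinarith
  rw [← hC₀] at hk'
  obtain ⟨V, hV, y, hyI, Q, hQ, hy, hQ1, hQ2, hq1, hq2, hyV⟩ := exists_mob_near hK hR hc hdpos
    (by rw [hC₀d]; norm_num) hC1 hℓ hℓ1 hI
  have hq := hV.q_pos_real
  have hcQ : 16 ≤ (c * Q) ^ 2 * ℓ := by
    calc (16 : ℝ) = 4 ^ 2 := by norm_num
      _ ≤ (C₀ * c) ^ 2 := pow_le_pow_left₀ (by norm_num) hC₀c _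
      _ = c ^ 2 * C₀ ^ 2 := by ring
      _ ≤ c ^ 2 * (Q ^ 2 * ℓ) := by gcongr
      _ = _ := by ring
  have hqℓ : 16 ≤ (V.q : ℝ) ^ 2 * ℓ := hcQ.trans (by gcongr)
  obtain ⟨l, s, hs, hsc, p, hp⟩ := hV.exists_word_close (k := k) (n := n) hK hg hR
    (by nlinarith [sq_nonneg C₀]) (by
      refine le_of_mul_le_mul_right ?_ hℓ
      calc (V.q : ℝ) ^ 2 * 2 ^ (23 * (g * k) + 29) * ℓ
          = (V.q : ℝ) ^ 2 * ℓ * 2 ^ (23 * (g * k) + 29) := by ring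
        _ ≤ (Q ^ 2 * ℓ) * 2 ^ (23 * (g * k) + 29) := by gcongr
        _ ≤ (4 * C₀ ^ 2) * 2 ^ (23 * (g * k) + 29) := by gcongr
        _ = (2 ^ 31 * C₀ ^ 2) * 2 ^ (23 * (g * k)) := by rw [pow_add]; ring
        _ ≤ 2 ^ k * 2 ^ (23 * (g * k)) := by gcongr; linarith
        _ = 2 ^ (k + 23 * (g * k)) := (pow_add _ _ _).symm
        _ ≤ 2 ^ (30 * (g * k)) := pow_le_pow_right₀ one_le_two (by nlinarith)
        _ = R ^ k := by rw [hRg, ← pow_mul, mul_assoc]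
        _ ≤ n * ℓ := hn) (by
      refine le_of_mul_le_mul_right ?_ hℓ
      refine hn'.trans ?_
      have : 0 < R ^ (k + 1) := by positivity
      nlinarith) x
  rw [← hc] at hsc
  obtain ⟨β, hβ⟩ : ∃ β, β = (V.word l).eval s := ⟨_, rfl⟩
  rw [← hβ] at hp
  have hdist : |β - y| ≤ 2 / (c * Q) ^ 2 := by
    obtain ⟨s', hs', e⟩ := V.exists_eval_word l (s := s) ⟨hs.1, by linarith [hs.2]⟩
    have h1 := hV.abs_eval_sub_le hs'.1
    rw [← e, ← hβ] at h1
    have h2 : 1 / (V.q : ℝ) ^ 2 ≤ 1 / (c * Q) ^ 2 := by gcongr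
    have h3 : 1 / (Q * V.q) ≤ 1 / (c * Q) ^ 2 := by
      have : (c * Q) ^ 2 ≤ Q * V.q := by
        rw [sq]; exact mul_le_mul (mul_le_of_le_one_left hQ.le hc1) hq1 (by positivity) hQ.le
      gcongr
    calc |β - y| = |(β - V.p / V.q) - (y - V.p / V.q)| := by congr 1; ring
      _ ≤ |β - V.p / V.q| + |y - V.p / V.q| := abs_sub _ _
      _ ≤ 1 / (c * Q) ^ 2 + 1 / (c * Q) ^ 2 := add_le_add (h1.trans h2) (hyV.trans h3)
      _ = _ := by ring
  have hdistℓ : |β - y| ≤ ℓ / 8 := by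
    refine hdist.trans ?_
    rw [div_le_iff₀ (by positivity)]
    nlinarith
  have hgood : ∀ p b : ℤ, 0 < b → 1 / (4 * R) ≤ b ^ 2 * ℓ → 8 * R * d ≤ b * |b * β - p| := by
    intro p b hb hbX
    rw [hdc, hβ]
    rw [hβ] at hdist
    exact le_mul_abs_of_near hV hcpos hc1 hQ hy hq2 l hs hsc hdist hb hbX
  obtain ⟨τ, hτ⟩ : ∃ τ, τ = ℓ / R ^ (2 * k + 1) := ⟨_, rfl⟩
  rw [← hτ]
  have hτpos : 0 < τ := by rw [hτ]; positivity
  have hτle : τ ≤ ℓ / 8 := by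
    rw [hτ]
    refine div_le_div_of_nonneg_left hℓ.le (by norm_num) (hR8.trans ?_)
    exact le_self_pow₀ (by linarith) (by omega)
  have hnτ : n * τ ≤ ((2 : ℝ) ^ k)⁻¹ := by
    calc n * τ = n * ℓ / R ^ (2 * k + 1) := by rw [hτ]; ring
      _ ≤ R ^ (k + 1) / R ^ (2 * k + 1) := by gcongr
      _ = (R ^ k)⁻¹ := by field_simp; ring
      _ ≤ ((2 : ℝ) ^ k)⁻¹ := by gcongr; linarith
  have hab := abs_le.1 hdistℓ
  refine ⟨β, by linarith [hyI.1], by linarith [hyI.2], fun z hz => ⟨⟨p, ?_⟩, fun p b hb hbτ => ?_⟩⟩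
  · have h1 : |(n : ℝ) * (z - β)| ≤ n * τ := by
      rw [abs_mul, Nat.abs_cast, abs_of_nonneg (by linarith [hz.1])]
      gcongr
      linarith [hz.2]
    calc |n * z - x - p| = |(n * β - x - p) + n * (z - β)| := by congr 1; ring
      _ ≤ _ := abs_add_le _ _
      _ ≤ _ := by linarith
  · by_cases hbX : (b : ℝ) ^ 2 * ℓ < 1 / (4 * R)
    · exact hI z ⟨by linarith [hz.1, hyI.1], by linarith [hz.2, hyI.2]⟩ p b hb hbX
    · have h1 := hgood p b hb (not_lt.1 hbX)
      have hb' : (0 : ℝ) < b := by exact_mod_cast hb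
      have h2 : |b * β - p| ≤ |b * z - p| + b * τ := by
        have h3 : |(b : ℝ) * (z - β)| ≤ b * τ := by
          rw [abs_mul, abs_of_pos hb', abs_of_nonneg (by linarith [hz.1])]
          gcongr
          linarith [hz.2]
        calc |b * β - p| = |(b * z - p) - b * (z - β)| := by congr 1; ring
          _ ≤ _ := abs_sub _ _
          _ ≤ _ := by linarith
      nlinarith

/-- A sequence of scales increasing by one except for sparse jumps of size `L i + 1` started
exactly at the scales `e i`. -/
theorem exists_schedule (M : ℕ) (e L : ℕ → ℕ)
    (he : ∀ i, e i + M * L (i + 1) + L i + 1 ≤ e (i + 1)) :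
    ∃ E I : ℕ → ℕ, E 0 = 0 ∧ I 0 = 0 ∧
      (∀ j, (E j = e (I j) ∧ E (j + 1) = E j + L (I j) + 1 ∧ I (j + 1) = I j + 1) ∨
        (E (j + 1) = E j + 1 ∧ I (j + 1) = I j)) ∧
      (∀ i, ∃ j, i < I j) ∧ ∀ j, M * E j ≤ (M + 1) * j + M * L 0 := by
  let st : ℕ → ℕ × ℕ := fun j => Nat.rec (0, 0)
    (fun _ s => if s.1 = e s.2 then (s.1 + L s.2 + 1, s.2 + 1) else (s.1 + 1, s.2)) j
  have hst : ∀ j, st (j + 1) = if (st j).1 = e (st j).2 then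
      ((st j).1 + L (st j).2 + 1, (st j).2 + 1) else ((st j).1 + 1, (st j).2) := fun _ => rfl
  have hle : ∀ j, (st j).1 ≤ e (st j).2 := by
    intro j
    induction j with
    | zero => exact Nat.zero_le _
    | succ j ih =>
      rw [hst]
      split_ifs with h
      · have := he (st j).2
        dsimp only; omega
      · dsimp only; omega
  have hsum : ∀ j, (st j).1 = j + ∑ i ∈ Finset.range (st j).2, L i := by
    intro j
    induction j with
    | zero => rfl
    | succ j ih =>
      rw [hst]
      split_ifs with h
      · rw [Finset.sum_range_succ]; dsimp only; omega
      · dsimp only; omega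
  have hS : ∀ i, M * ∑ i' ∈ Finset.range (i + 1), L i' + ∑ i' ∈ Finset.range i, L i'
      ≤ M * L 0 + e i := by
    intro i
    induction i with
    | zero => simp
    | succ i ih =>
      have := he i
      rw [Finset.sum_range_succ _ (i + 1), Finset.sum_range_succ _ i] at *
      nlinarith
  have hMS : ∀ j, M * ∑ i ∈ Finset.range (st j).2, L i ≤ M * L 0 + j := by
    intro j
    induction j with
    | zero => exact Nat.zero_le _
    | succ j ih =>
      rw [hst]
      split_ifs with h
      · have h1 := hS (st j).2
        have h2 := hsum j
        dsimp only; omega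
      · dsimp only; omega
  refine ⟨fun j => (st j).1, fun j => (st j).2, rfl, rfl, fun j => ?_, fun i => ?_, fun j => ?_⟩
  · by_cases h : (st j).1 = e (st j).2
    · left
      refine ⟨h, ?_, ?_⟩ <;> simp only [hst, if_pos h]
    · right
      constructor <;> simp only [hst, if_neg h]
  · by_contra hcon
    push Not at hcon
    have hmono : Monotone e := monotone_nat_of_le_succ fun i => by have := he i; omega
    have h1 := hle (e i + 1)
    have h2 := hsum (e i + 1)
    have h3 := hmono (hcon (e i + 1))
    omega
  · have h1 := hMS j
    dsimp only
    rw [hsum j]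
    nlinarith

/-- A tree of badly approximable numbers whose multiples by `n i` hit the targets `x i`. -/
theorem exists_tree_hitting {K g : ℕ} (hK : 2 ≤ K) (hg : 9 ≤ g) {R : ℝ} (hR : R = 2 * K + 2)
    (hRg : R = 2 ^ (30 * g)) : ∃ k₀ : ℕ, ∀ (M : ℕ) (n k e : ℕ → ℕ) (x : ℕ → ℝ),
      (∀ i, k₀ ≤ k i) →
      (∀ i, e i + M * (2 * k (i + 1) + 1) + (2 * k i + 1) + 1 ≤ e (i + 1)) →
      (∀ i, R ^ (e i + k i) ≤ n i) → (∀ i, n i ≤ R ^ (e i + k i + 1)) →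
      ∃ (f : ℝ → ℝ) (E : ℕ → ℕ), (∀ j, M * E j ≤ (M + 1) * j + M * (2 * k 0 + 1)) ∧
        (∀ y ∈ Ico (0 : ℝ) 1, (∀ p b : ℤ, 0 < b → towerConst R ≤ b * |b * f y - p|) ∧
          ∀ i, ∃ p : ℤ, |n i * f y - x i - p| ≤ 2 * ((2 : ℝ) ^ k i)⁻¹) ∧
        ∀ y ∈ Ico (0 : ℝ) 1, ∀ y' ∈ Ico (0 : ℝ) 1, ∀ j : ℕ, ((K : ℝ) ^ j)⁻¹ < |y - y'| →
          (R ^ E j)⁻¹ ≤ |f y - f y'| := by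
  obtain ⟨k₀, hk₀⟩ := exists_subinterval_close hK hg hR hRg
  refine ⟨k₀, fun M n k e x hk he hn hn' => ?_⟩
  obtain ⟨E, I, hE0, hI0, hEI, hI, hEM⟩ := exists_schedule M e (fun i => 2 * k i + 1) he
  have hK' : (2 : ℝ) ≤ K := by exact_mod_cast hK
  have hR6 : 6 ≤ R := by rw [hR]; linarith
  have hRpos : 0 < R := by linarith
  obtain ⟨d, hd⟩ : ∃ d, d = towerConst R := ⟨_, rfl⟩
  have hdpos : 0 < d := by rw [hd]; exact towerConst_pos hRpos
  have hdle : 4 * R * d ≤ 1 / (4 * R) := by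
    rw [hd, towerConst, show 4 * R * ((1 / (32 * R ^ 2)) ^ 2 / (192 * R)) = 1 / (49152 * R ^ 4) by
      field_simp; norm_num]
    refine one_div_le_one_div_of_le (by positivity) ?_
    have : R ≤ R ^ 4 := le_self_pow₀ (by linarith) (by norm_num)
    linarith
  have hEle : ∀ j, E j + 1 ≤ E (j + 1) := fun j => by
    rcases hEI j with h | h <;> omega
  have hEj : ∀ j, j ≤ E j := fun j => by
    induction j with
    | zero => exact Nat.zero_le _
    | succ j ih => have := hEle j; omega
  rw [← hd] at hk₀ ⊢
  obtain ⟨f, hf, hfsep⟩ := exists_tree_map hK (fun j => (R ^ E j)⁻¹) (fun j => by positivity)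
    (fun j => by
      have h1 : R ^ E j * R ≤ R ^ E (j + 1) := by
        rw [← pow_succ]; exact pow_le_pow_right₀ (by linarith) (hEle j)
      have h2 : 0 < R ^ E j := by positivity
      rw [← div_eq_mul_inv, div_le_iff₀ (by positivity), ← div_eq_inv_mul, le_div_iff₀ h2]
      nlinarith)
    (fun j z => (∀ p b : ℤ, 0 < b → b ^ 2 * (R ^ E j)⁻¹ < 1 / (4 * R) → d ≤ b * |b * z - p|) ∧
      ∀ i < I j, ∃ p : ℤ, |n i * z - x i - p| ≤ 2 * ((2 : ℝ) ^ k i)⁻¹) 0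
    (fun z _ => by
      constructor
      · intro p b hb h
        exfalso
        have hb' : (1 : ℝ) ≤ b := by exact_mod_cast hb
        rw [hE0, pow_zero, inv_one, mul_one, lt_div_iff₀ (by positivity)] at h
        nlinarith
      · intro i hi
        rw [hI0] at hi
        exact absurd hi (Nat.not_lt_zero i))
    (fun j a ha => by
      obtain ⟨a', τ, hτ, ha1, ha2, hz⟩ : ∃ a' τ : ℝ, τ / R = (R ^ E (j + 1))⁻¹ ∧ a ≤ a' ∧
          a' + τ ≤ a + (R ^ E j)⁻¹ ∧ ∀ z ∈ Icc a' (a' + τ),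
            (∀ p b : ℤ, 0 < b → b ^ 2 * τ < 4 * R * d → d ≤ b * |b * z - p|) ∧
            ∀ i < I (j + 1), ∃ p : ℤ, |n i * z - x i - p| ≤ 2 * ((2 : ℝ) ^ k i)⁻¹ := by
        rcases hEI j with ⟨h1, h2, h3⟩ | ⟨h1, h2⟩
        · obtain ⟨a', ha1, ha2, hz⟩ := hk₀ (k (I j)) (hk _) a (R ^ E j)⁻¹ (by positivity)
            (inv_le_one_of_one_le₀ (one_le_pow₀ (by linarith)))
            (fun z hz => (ha z hz).1) (n (I j)) (by
              rw [← div_eq_mul_inv, le_div_iff₀ (by positivity), ← pow_add, h1, add_comm]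
              exact hn _) (by
              rw [← div_eq_mul_inv, div_le_iff₀ (by positivity), ← pow_add, h1, add_comm,
                ← add_assoc]
              exact hn' _) (x (I j))
          refine ⟨a', _, ?_, ha1, ha2, fun z hz' => ⟨(hz z hz').2, fun i hi => ?_⟩⟩
          · rw [h2, pow_succ]
            field_simp
            ring
          · rw [h3] at hi
            rcases Nat.lt_succ_iff_lt_or_eq.1 hi with h | rfl
            · refine (ha z ⟨by linarith [hz'.1], by linarith [hz'.2]⟩).2 i h
            · exact (hz z hz').1
        · refine ⟨a, (R ^ E j)⁻¹, ?_, le_rfl, le_rfl, fun z hz => ⟨fun p b hb h => ?_, ?_⟩⟩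
          · rw [h1, pow_succ]; field_simp
          · exact (ha z hz).1 p b hb (h.trans_le hdle)
          · rw [h2]; exact (ha z hz).2
      have hτpos : 0 < τ := by
        have : 0 < τ / R := by rw [hτ]; positivity
        exact (div_pos_iff_of_pos_right hRpos).1 this
      obtain ⟨S, hS, hSsep⟩ := exists_pieces_avoiding_rat K (X := 4 * R * d) hR hτpos a'
      refine ⟨S, fun i hi => ?_, fun i hi i' hi' hne => hτ ▸ hSsep i hi i' hi' hne⟩
      obtain ⟨h1, h2, h3⟩ := hS i hi
      rw [← hτ]
      refine ⟨ha1.trans h1, h2.trans ha2, fun z hz' => ?_⟩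
      have hzm : z ∈ Icc a' (a' + τ) := ⟨by linarith [hz'.1], by linarith [hz'.2]⟩
      refine ⟨fun p b hb h => ?_, (hz z hzm).2⟩
      by_cases hcase : (b : ℝ) ^ 2 * τ < 4 * R * d
      · exact (hz z hzm).1 p b hb hcase
      · have h4 := h3 z hz' p b hb (not_lt.1 hcase) (by
          have e : (b : ℝ) ^ 2 * τ = b ^ 2 * (τ / R) * R := by field_simp
          rw [e, show (1 : ℝ) / 4 = 1 / (4 * R) * R by field_simp]
          gcongr)
        rwa [mul_div_cancel_left₀ _ (by positivity : 4 * R ≠ 0)] at h4)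
  refine ⟨f, E, hEM, fun y hy => ⟨fun p b hb => ?_, fun i => ?_⟩, hfsep⟩
  · obtain ⟨j, hj⟩ := pow_unbounded_of_one_lt ((b : ℝ) ^ 2 * (4 * R)) (by linarith : 1 < R)
    refine ((hf y hy).2 j).1 p b hb ?_
    rw [← div_eq_mul_inv, div_lt_div_iff₀ (by positivity) (by positivity), one_mul]
    exact hj.trans_le (pow_le_pow_right₀ (by linarith) (hEj j))
  · obtain ⟨j, hj⟩ := hI i
    exact ((hf y hy).2 j).2 i hj

theorem pow_mul_le_of_lacunary {n : ℕ → ℕ} {r : ℝ} (hr : 0 ≤ r)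
    (h : ∀ t, 1 ≤ t → r * n t ≤ n (t + 1)) {t : ℕ} (ht : 1 ≤ t) (s : ℕ) :
    r ^ s * n t ≤ n (t + s) := by
  induction s with
  | zero => simp
  | succ s ih =>
    calc r ^ (s + 1) * n t = r * (r ^ s * n t) := by ring
      _ ≤ r * n (t + s) := by gcongr
      _ ≤ n (t + (s + 1)) := h (t + s) (by omega)

/-- The indices at which a lacunary sequence is sampled. -/
def sampleIndex (i : ℕ) : ℕ := i * Nat.log 2 i ^ 2

/-- The scales of a lacunary sequence sampled along `sampleIndex` have gaps growing faster than
any multiple of the logarithm of the index. -/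
theorem exists_log_gap_of_lacunary {n : ℕ → ℕ} (hpos : ∀ t, 1 ≤ t → 0 < n t) {r : ℝ} (hr : 1 < r)
    (hlac : ∀ t, 1 ≤ t → r * n t ≤ n (t + 1)) {B : ℕ} (hB : 2 ≤ B) (M : ℕ) :
    ∃ k₀ : ℕ, ∀ i, k₀ ≤ Nat.log 2 i → Nat.log 2 i ≤ Nat.log B (n (sampleIndex i)) ∧
      Nat.log B (n (sampleIndex i)) + M * Nat.log 2 i ≤ Nat.log B (n (sampleIndex (i + 1))) := by
  obtain ⟨s, hs⟩ := pow_unbounded_of_one_lt (B : ℝ) hr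
  refine ⟨s * (M + 1) + 1, fun i hi => ?_⟩
  obtain ⟨k, hk⟩ : ∃ k, k = Nat.log 2 i := ⟨_, rfl⟩
  rw [← hk] at hi ⊢
  have hi2 : 2 ≤ i := by
    by_contra h
    have : Nat.log 2 i = 0 := Nat.log_eq_zero_iff.2 (Or.inl (by omega))
    omega
  have hksq : s * ((M + 1) * k) ≤ k ^ 2 := by nlinarith
  have hkpos : 1 ≤ k := by omega
  have hgrow : ∀ t, 1 ≤ t → ∀ u, k ^ 2 ≤ u → B ^ ((M + 1) * k) * n t ≤ n (t + u) := by
    intro t ht u hu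
    have h1 := pow_mul_le_of_lacunary (by linarith) hlac ht u
    have h2 : (B : ℝ) ^ ((M + 1) * k) ≤ r ^ u := by
      calc (B : ℝ) ^ ((M + 1) * k) ≤ (r ^ s) ^ ((M + 1) * k) := by gcongr
        _ = r ^ (s * ((M + 1) * k)) := (pow_mul _ _ _).symm
        _ ≤ r ^ u := pow_le_pow_right₀ hr.le (hksq.trans hu)
    have h3 : (B : ℝ) ^ ((M + 1) * k) * n t ≤ n (t + u) :=
      (mul_le_mul_of_nonneg_right h2 (Nat.cast_nonneg _)).trans h1
    exact_mod_cast h3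
  have hidx : sampleIndex i = i * k ^ 2 := by rw [sampleIndex, hk]
  have hk2 : 1 ≤ k ^ 2 := Nat.one_le_pow _ _ hkpos
  have hpos_i : 1 ≤ sampleIndex i := by rw [hidx]; nlinarith
  constructor
  · have h1 := hgrow 1 le_rfl (sampleIndex i - 1) (by
      have : 2 * k ^ 2 ≤ i * k ^ 2 := Nat.mul_le_mul_right _ hi2
      omega)
    rw [Nat.add_sub_cancel' hpos_i] at h1
    refine (Nat.le_log_iff_pow_le (by omega) (hpos _ hpos_i).ne').2 ?_
    calc B ^ k ≤ B ^ ((M + 1) * k) := Nat.pow_le_pow_right (by omega) (by nlinarith)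
      _ ≤ B ^ ((M + 1) * k) * n 1 := Nat.le_mul_of_pos_right _ (hpos 1 le_rfl)
      _ ≤ _ := h1
  · have h2 : sampleIndex i + k ^ 2 ≤ sampleIndex (i + 1) := by
      have : k ≤ Nat.log 2 (i + 1) := hk ▸ Nat.log_mono_right (Nat.le_succ i)
      rw [hidx, sampleIndex]
      calc i * k ^ 2 + k ^ 2 = (i + 1) * k ^ 2 := by ring
        _ ≤ _ := by gcongr
    have h3 := hgrow (sampleIndex i) hpos_i (sampleIndex (i + 1) - sampleIndex i) (by omega)
    rw [Nat.add_sub_cancel' (by omega)] at h3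
    refine (Nat.le_log_iff_pow_le (by omega) (hpos _ (by omega)).ne').2 ?_
    calc B ^ (Nat.log B (n (sampleIndex i)) + M * k)
        = B ^ (M * k) * B ^ Nat.log B (n (sampleIndex i)) := by rw [pow_add, mul_comm]
      _ ≤ B ^ ((M + 1) * k) * n (sampleIndex i) :=
        Nat.mul_le_mul (Nat.pow_le_pow_right (by omega) (by nlinarith))
          (Nat.pow_log_le_self _ (hpos _ hpos_i).ne')
      _ ≤ _ := h3

theorem nint_le (x : ℝ) (p : ℤ) : nint x ≤ |x - p| :=
  ciInf_le ⟨0, by rintro _ ⟨p, rfl⟩; exact abs_nonneg _⟩ p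

theorem le_natCast_mul_nint {c x : ℝ} {m : ℕ} (hm : 1 ≤ m) (h : ∀ p : ℤ, c ≤ m * |x - p|) :
    c ≤ m * nint x := by
  have hmpos : (0 : ℝ) < m := by exact_mod_cast hm
  rw [← div_le_iff₀' hmpos]
  exact le_ciInf fun p => (div_le_iff₀' hmpos).2 (h p)

/-- The dyadic targets: as `i` runs over `[2 ^ k, 2 ^ (k + 1))` they are `2 ^ k` equally spaced
points of the unit interval. -/
noncomputable def dyadicTarget (i : ℕ) : ℝ := i / 2 ^ Nat.log 2 i - 1

theorem infinite_hits {n : ℕ → ℕ} {β : ℝ} {i₀ : ℕ}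
    (h : ∀ i ≥ i₀, ∃ p : ℤ,
      |n (sampleIndex i) * β - dyadicTarget i - p| ≤ 2 * ((2 : ℝ) ^ Nat.log 2 i)⁻¹)
    (δ : ℝ) {ε : ℝ} (hε : 0 < ε) :
    Set.Infinite {t : ℕ | 0 < t ∧ nint (n t * β - δ) < Real.log t ^ ((3 : ℝ) + ε) / t} := by
  refine Set.infinite_of_forall_exists_gt fun a => ?_
  obtain ⟨m, hm⟩ : ∃ m, m = a + i₀ + 50 := ⟨_, rfl⟩
  have h2m : (0 : ℝ) < 2 ^ m := by positivity
  obtain ⟨u, hu⟩ : ∃ u, u = ⌊2 ^ m * Int.fract δ⌋₊ := ⟨_, rfl⟩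
  have hu1 : (u : ℝ) ≤ 2 ^ m * Int.fract δ := by
    rw [hu]; exact Nat.floor_le (mul_nonneg h2m.le (Int.fract_nonneg _))
  have hu2 : 2 ^ m * Int.fract δ < u + 1 := by rw [hu]; exact Nat.lt_floor_add_one _
  have hu3 : u < 2 ^ m := by
    have : (u : ℝ) < 2 ^ m := by nlinarith [Int.fract_lt_one δ]
    exact_mod_cast this
  have hlog : Nat.log 2 (2 ^ m + u) = m :=
    Nat.log_eq_of_pow_le_of_lt_pow (by omega) (by rw [pow_succ]; omega)
  have ham : m < 2 ^ m := Nat.lt_two_pow_self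
  obtain ⟨p, hp⟩ := h (2 ^ m + u) (by omega)
  have htgt : dyadicTarget (2 ^ m + u) = u / 2 ^ m := by
    rw [dyadicTarget, hlog]; push_cast; field_simp; ring
  obtain ⟨t, ht⟩ : ∃ t, t = sampleIndex (2 ^ m + u) := ⟨_, rfl⟩
  have ht' : t = (2 ^ m + u) * m ^ 2 := by rw [ht, sampleIndex, hlog]
  rw [← ht, hlog, htgt] at hp
  have hm1 : 1 ≤ m ^ 2 := Nat.one_le_pow _ _ (by omega)
  have htlow : 2 ^ m ≤ t := by rw [ht']; nlinarith
  have htup : (t : ℝ) ≤ 2 * 2 ^ m * m ^ 2 := by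
    have : t ≤ 2 * 2 ^ m * m ^ 2 := by rw [ht']; gcongr; omega
    exact_mod_cast this
  have htpos : (0 : ℝ) < t := by
    have : 0 < t := by omega
    exact_mod_cast this
  refine ⟨t, ⟨by omega, ?_⟩, by omega⟩
  have hclose : nint (n t * β - δ) ≤ 3 * ((2 : ℝ) ^ m)⁻¹ := by
    have h1 : |u / 2 ^ m - Int.fract δ| ≤ ((2 : ℝ) ^ m)⁻¹ := by
      rw [abs_le, neg_le_sub_iff_le_add, inv_eq_one_div, ← add_div, le_div_iff₀ h2m,
        sub_le_iff_le_add, div_le_iff₀ h2m, add_mul, div_mul_cancel₀ _ h2m.ne']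
      constructor <;> linarith
    calc nint (n t * β - δ) ≤ |n t * β - δ - ((p - ⌊δ⌋ : ℤ) : ℝ)| := nint_le _ _
      _ = |(n t * β - u / 2 ^ m - p) + (u / 2 ^ m - Int.fract δ)| := by
          congr 1; rw [Int.fract]; push_cast; ring
      _ ≤ _ := abs_add_le _ _
      _ ≤ _ := by linarith
  refine hclose.trans_lt ?_
  have hm50 : (50 : ℝ) ≤ m := by exact_mod_cast (by omega : 50 ≤ m)
  have hlogt : (m : ℝ) / 2 ≤ Real.log t := by
    have h1 : Real.log (2 ^ m) ≤ Real.log t := Real.log_le_log h2m (by exact_mod_cast htlow)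
    rw [Real.log_pow] at h1
    nlinarith [Real.log_two_gt_d9]
  have hpow : ((m : ℝ) / 2) ^ 3 ≤ Real.log t ^ ((3 : ℝ) + ε) := by
    calc ((m : ℝ) / 2) ^ 3 ≤ Real.log t ^ 3 := by gcongr
      _ = Real.log t ^ (3 : ℝ) := by norm_cast
      _ ≤ _ := Real.rpow_le_rpow_of_exponent_le (by linarith) (by linarith)
  rw [lt_div_iff₀ htpos]
  refine lt_of_lt_of_le ?_ hpow
  calc 3 * ((2 : ℝ) ^ m)⁻¹ * t ≤ 3 * ((2 : ℝ) ^ m)⁻¹ * (2 * 2 ^ m * m ^ 2) := by gcongr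
    _ = 6 * m ^ 2 := by field_simp; norm_num
    _ < (m / 2) ^ 3 := by nlinarith [sq_nonneg (m : ℝ)]

theorem mul_inv_pow_le_inv_pow_rpow {R γ γ' L K : ℝ} {E j : ℕ} (hR : 1 ≤ R)
    (hK : R ^ γ' ≤ K) (hE : γ * E ≤ γ' * j + γ * L) :
    R ^ (-(γ * L)) * (K ^ j)⁻¹ ≤ ((R ^ E)⁻¹) ^ γ := by
  have hRpos : 0 < R := by linarith
  have h1 : (K ^ j)⁻¹ ≤ R ^ (-(γ' * j)) := by
    rw [Real.rpow_neg hRpos.le, Real.rpow_mul_natCast hRpos.le]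
    have : 0 < R ^ γ' := Real.rpow_pos_of_pos hRpos _
    gcongr
  have h2 : ((R ^ E)⁻¹) ^ γ = R ^ (-(γ * E)) := by
    rw [← Real.rpow_natCast, ← Real.rpow_neg hRpos.le, ← Real.rpow_mul hRpos.le]
    congr 1; ring
  rw [h2]
  calc R ^ (-(γ * L)) * (K ^ j)⁻¹ ≤ R ^ (-(γ * L)) * R ^ (-(γ' * j)) := by
        have := Real.rpow_pos_of_pos hRpos (-(γ * L))
        gcongr
    _ = R ^ (-(γ * L) + -(γ' * j)) := (Real.rpow_add hRpos _ _).symm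
    _ ≤ _ := Real.rpow_le_rpow_of_exponent_le hR (by linarith)

theorem towerConst_le_one {R : ℝ} (hR : 1 ≤ R) : towerConst R ≤ 1 := by
  have h1 : 1 / (32 * R ^ 2) ≤ 1 := by
    rw [div_le_one (by positivity)]; nlinarith
  have h2 : (1 / (32 * R ^ 2)) ^ 2 ≤ 1 := pow_le_one₀ (by positivity) h1
  rw [towerConst, div_le_one (by positivity)]
  linarith

theorem mem_calB {β δ c c' : ℝ} (hc : 0 < c) (hc' : 0 < c')
    (hβ : ∀ p b : ℤ, 0 < b → c ≤ b * |b * β - p|)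
    (hδ : ∀ b p : ℤ, 0 < b → c' ≤ b * |b * β - δ - p|) : (β, δ) ∈ calB := by
  refine ⟨⟨c, hc, fun m hm => le_natCast_mul_nint hm fun p => ?_⟩,
    ⟨c', hc', fun m hm => le_natCast_mul_nint hm fun p => ?_⟩⟩
  · exact_mod_cast hβ p m (by exact_mod_cast hm)
  · exact_mod_cast hδ m p (by exact_mod_cast hm)

theorem ofReal_two_mul_le_dimH {n : ℕ → ℕ} (hpos : ∀ t, 1 ≤ t → 0 < n t) {r : ℝ} (hr : 1 < r)
    (hlac : ∀ t, 1 ≤ t → r * n t ≤ n (t + 1)) {ε γ : ℝ} (hε : 0 < ε) (hγ : 0 < γ) (hγ1 : γ < 1) :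
    ENNReal.ofReal (2 * γ) ≤ dimH {p : ℝ × ℝ | p ∈ calB ∧
      Set.Infinite {t : ℕ | 0 < t ∧
        nint ((n t : ℝ) * p.1 - p.2) < Real.log t ^ ((3 : ℝ) + ε) / t}} := by
  obtain ⟨M, hM⟩ := exists_nat_gt (2 * γ / (1 - γ))
  have h1γ : 0 < 1 - γ := by linarith
  have hMpos : (0 : ℝ) < M := lt_trans (by positivity) hM
  rw [div_lt_iff₀ h1γ] at hM
  obtain ⟨g, hg⟩ := exists_nat_gt (1 / (1 - γ) + 9)
  have hg9 : 9 ≤ g := by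
    have : (9 : ℝ) < g := lt_trans (by simpa using h1γ) hg
    exact_mod_cast this.le
  have hgγ : 1 ≤ g * (1 - γ) := by
    rw [← div_le_iff₀ h1γ]; linarith
  obtain ⟨R, hRg⟩ : ∃ R : ℝ, R = 2 ^ (30 * g) := ⟨_, rfl⟩
  obtain ⟨K, hKdef⟩ : ∃ K : ℕ, 2 * K + 2 = 2 ^ (30 * g) := by
    refine ⟨2 ^ (30 * g - 1) - 1, ?_⟩
    have h1 : 2 ^ (30 * g) = 2 * 2 ^ (30 * g - 1) := by
      rw [← pow_succ']; congr 1; omega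
    have h2 : 0 < 2 ^ (30 * g - 1) := by positivity
    omega
  have hR : R = 2 * K + 2 := by rw [hRg]; exact_mod_cast hKdef.symm
  have h8 : 8 ≤ 2 * K + 2 := by
    rw [hKdef]
    calc 8 = 2 ^ 3 := by norm_num
      _ ≤ 2 ^ (30 * g) := Nat.pow_le_pow_right (by norm_num) (by omega)
  have hK : 2 ≤ K := by omega
  have hK' : (2 : ℝ) ≤ K := by exact_mod_cast hK
  have hR1 : 1 ≤ R := by rw [hR]; linarith
  have hRpos : 0 < R := by linarith
  obtain ⟨γ', hγ'⟩ : ∃ γ', γ' = (1 + γ) / 2 := ⟨_, rfl⟩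
  have hRK : R ^ γ' ≤ K := by
    have h1 : R ^ γ' * R ^ (1 - γ') = R := by
      rw [← Real.rpow_add hRpos, add_sub_cancel, Real.rpow_one]
    have h2 : 4 ≤ R ^ (1 - γ') := by
      rw [hRg, ← Real.rpow_natCast, ← Real.rpow_mul (by norm_num)]
      calc (4 : ℝ) = 2 ^ (2 : ℝ) := by norm_num
        _ ≤ _ := Real.rpow_le_rpow_of_exponent_le (by norm_num) (by
          push_cast; rw [hγ']; nlinarith)
    have h3 : 0 < R ^ γ' := Real.rpow_pos_of_pos hRpos _
    nlinarith
  obtain ⟨k₀, hk₀⟩ := exists_tree_hitting hK hg9 hR hRg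
  obtain ⟨k₁, hk₁⟩ := exists_log_gap_of_lacunary hpos hr hlac (B := 2 ^ (30 * g)) (by omega)
    (5 * M + 5)
  obtain ⟨i₀, hi₀⟩ : ∃ i₀, i₀ = 2 ^ (k₀ + k₁ + 1) := ⟨_, rfl⟩
  have hi₀pos : 0 < i₀ := by rw [hi₀]; positivity
  have hlog : ∀ i, k₀ + k₁ + 1 ≤ Nat.log 2 (i₀ + i) := fun i =>
    (Nat.le_log_iff_pow_le (by norm_num) (by omega)).2 (by rw [← hi₀]; omega)
  have hlog1 : ∀ i, Nat.log 2 (i₀ + (i + 1)) ≤ Nat.log 2 (i₀ + i) + 1 := fun i => by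
    rw [← Nat.log_mul_base (by norm_num) (by omega)]
    exact Nat.log_mono_right (by omega)
  have hRB : R = ((2 ^ (30 * g) : ℕ) : ℝ) := by rw [hRg]; push_cast; rfl
  have hnpos : ∀ i, 0 < n (sampleIndex (i₀ + i)) := fun i => by
    refine hpos _ (Nat.one_le_iff_ne_zero.2 (mul_ne_zero (by omega) (pow_ne_zero _ ?_)))
    have := hlog i
    omega
  obtain ⟨f, E, hE, hf, hfsep⟩ := hk₀ M (fun i => n (sampleIndex (i₀ + i)))
    (fun i => Nat.log 2 (i₀ + i))
    (fun i => Nat.log (2 ^ (30 * g)) (n (sampleIndex (i₀ + i))) - Nat.log 2 (i₀ + i))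
    (fun i => dyadicTarget (i₀ + i)) (fun i => by have := hlog i; omega)
    (fun i => by
      obtain ⟨h1, h2⟩ := hk₁ (i₀ + i) (by have := hlog i; omega)
      obtain ⟨h3, -⟩ := hk₁ (i₀ + (i + 1)) (by have := hlog (i + 1); omega)
      have h4 := hlog1 i
      have h5 := hlog i
      rw [add_assoc] at h2
      have h6 : M * (2 * Nat.log 2 (i₀ + (i + 1)) + 1) ≤ M * (5 * Nat.log 2 (i₀ + i)) :=
        Nat.mul_le_mul_left _ (by omega)
      have h7 : (5 * M + 5) * Nat.log 2 (i₀ + i)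
        = M * (5 * Nat.log 2 (i₀ + i)) + 5 * Nat.log 2 (i₀ + i) := by ring
      omega)
    (fun i => by
      obtain ⟨h1, -⟩ := hk₁ (i₀ + i) (by have := hlog i; omega)
      rw [Nat.sub_add_cancel h1, hRB]
      exact_mod_cast Nat.pow_log_le_self _ (hnpos i).ne')
    (fun i => by
      obtain ⟨h1, -⟩ := hk₁ (i₀ + i) (by have := hlog i; omega)
      rw [Nat.sub_add_cancel h1, hRB]
      exact_mod_cast (Nat.lt_pow_succ_log_self (by omega) _).le)
  have hd := towerConst_pos hRpos
  have hδ : ∀ y, ∃ h : ℝ → ℝ, y ∈ Ico (0 : ℝ) 1 →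
      (∀ v ∈ Ico (0 : ℝ) 1, ∀ b p : ℤ, 0 < b →
        towerConst R / (8 * R ^ 3) ≤ b * |b * f y - h v - p|) ∧
      ∀ v ∈ Ico (0 : ℝ) 1, ∀ v' ∈ Ico (0 : ℝ) 1, ∀ j : ℕ, ((K : ℝ) ^ j)⁻¹ < |v - v'| →
        (R ^ (j + 1))⁻¹ ≤ |h v - h v'| := by
    intro y
    by_cases hy : y ∈ Ico (0 : ℝ) 1
    · obtain ⟨h, h1, h2⟩ := exists_tree_inhomogeneous hK hR hd (towerConst_le_one hR1) (hf y hy).1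
      exact ⟨h, fun _ => ⟨h1, by simpa only [one_div] using h2⟩⟩
    · exact ⟨0, fun h => absurd h hy⟩
  choose h hh using hδ
  obtain ⟨L, hL⟩ : ∃ L : ℕ, L = 2 * Nat.log 2 (i₀ + 0) + 1 := ⟨_, rfl⟩
  have hEγ : ∀ j, γ * E j ≤ γ' * j + γ * L := fun j => by
    have h1 : (M : ℝ) * E j ≤ (M + 1) * j + M * L := by rw [hL]; exact_mod_cast hE j
    refine le_of_mul_le_mul_left ?_ hMpos
    have hj : (0 : ℝ) ≤ j := Nat.cast_nonneg _
    have h2 := mul_le_mul_of_nonneg_left h1 hγ.le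
    have h3 : γ * (M + 1) * j ≤ M * γ' * j := by
      refine mul_le_mul_of_nonneg_right ?_ hj
      rw [hγ']; linarith
    nlinarith
  have hβH := holder_of_separating hK (A := R ^ (-(γ * L))) (Real.rpow_pos_of_pos hRpos _) hγ
    (fun j => (R ^ E j)⁻¹) (fun j => by positivity)
    (fun j => mul_inv_pow_le_inv_pow_rpow hR1 hRK (hEγ j)) f hfsep
  have hδH := fun y hy => holder_of_separating hK (A := R ^ (-(γ * 1)))
    (Real.rpow_pos_of_pos hRpos _) hγ (fun j => (R ^ (j + 1))⁻¹) (fun j => by positivity)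
    (fun j => mul_inv_pow_le_inv_pow_rpow hR1 hRK (by
      push_cast
      have hj : (0 : ℝ) ≤ j := Nat.cast_nonneg _
      rw [hγ']; nlinarith)) (h y) (hh y hy).2
  have hKpos : (0 : ℝ) < K := by linarith
  refine le_dimH_of_holder_fibers (C := max (K / R ^ (-(γ * L))) (K / R ^ (-(γ * 1)))) hγ
    (lt_max_of_lt_left (div_pos hKpos (Real.rpow_pos_of_pos hRpos _))) f h
    (fun y hy y' hy' => (hβH y hy y' hy').trans ?_)
    (fun y hy v hv v' hv' => (hδH y hy v hv v' hv').trans ?_) _ (fun y hy v hv => ⟨?_, ?_⟩)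
  · exact mul_le_mul_of_nonneg_right (le_max_left _ _) (Real.rpow_nonneg (abs_nonneg _) _)
  · exact mul_le_mul_of_nonneg_right (le_max_right _ _) (Real.rpow_nonneg (abs_nonneg _) _)
  · exact mem_calB hd (by positivity) (hf y hy).1 ((hh y hy).1 v hv)
  · refine infinite_hits (i₀ := i₀) (fun i hi => ?_) _ hε
    obtain ⟨p, hp⟩ := (hf y hy).2 (i - i₀)
    rw [Nat.add_sub_cancel' hi] at hp
    exact ⟨p, hp⟩

theorem lacunary_calB (n : ℕ → ℕ) (hpos : ∀ t, 1 ≤ t → 0 < n t)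
    (hlac : ∃ r : ℝ, 1 < r ∧ ∀ t, 1 ≤ t → r * n t ≤ n (t + 1))
    (ε : ℝ) (hε : 0 < ε) :
    ∃ G : Set (ℝ × ℝ), G ⊆ calB ∧ dimH G = 2 ∧
      ∀ p ∈ G,
        Set.Infinite {t : ℕ | 0 < t ∧
          nint ((n t : ℝ) * p.1 - p.2) < Real.log t ^ ((3 : ℝ) + ε) / t} := by
  obtain ⟨r, hr, hlac⟩ := hlac
  refine ⟨{p : ℝ × ℝ | p ∈ calB ∧ Set.Infinite {t : ℕ | 0 < t ∧
    nint ((n t : ℝ) * p.1 - p.2) < Real.log t ^ ((3 : ℝ) + ε) / t}}, fun p hp => hp.1, ?_,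
    fun p hp => hp.2⟩
  apply le_antisymm
  · refine (dimH_mono (subset_univ _)).trans (le_of_eq ?_)
    rw [Real.dimH_univ_eq_finrank]
    simp
  · refine ENNReal.le_of_forall_nnreal_lt fun s hs => ?_
    rcases eq_or_ne s 0 with rfl | h0
    · simp
    have hs2 : (s : ℝ) < 2 := by exact_mod_cast hs
    have hs0 : (0 : ℝ) < s := by exact_mod_cast pos_iff_ne_zero.2 h0
    have := ofReal_two_mul_le_dimH hpos hr hlac (γ := s / 2) hε (by linarith) (by linarith)
    rwa [mul_div_cancel₀ _ two_ne_zero, ENNReal.ofReal_coe_nnreal] at this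
end

section
/- Let r ∈ (1, 2]. Then there exists a constant R = R(r) > 1, depending only on r, with the following property. Let a(1), a(2), … be a sequence of positive integers with a(n+1) > r·a(n) for all n ≥ 1, let s be a positive integer, let Z ≥ Y ≥ 2 be integers with 4s ≤ Z, and let K be a real number with 0 ≤ K ≤ a(Z)/8. Then the number of integer solutions (y_1, …, y_s, z_1, …, z_s) to |y_1·a(z_1) + ⋯ + y_s·a(z_s)| ≤ K with 0 < |y_j| ≤ Y and Z < z_j ≤ 2Z for all 1 ≤ j ≤ s is at most s! · R^s · max{ (Y·Z·log Z)^(s/2), Y^(s−1)·Z·(log Z)^(s−1) }. -/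
open Real MeasureTheory Set

/-- A positive monotone function on `[Z, ∞)` that grows by a factor of at least `16 * M` over every
distance larger than `L`. -/
structure GrowsFast (A : ℕ → ℝ) (M : ℝ) (Z L : ℕ) : Prop where
  pos : ∀ m, Z ≤ m → 0 < A m
  mono : ∀ m n, Z ≤ m → m ≤ n → A m ≤ A n
  gap : ∀ m n, Z ≤ m → m + L < n → 16 * M * A m ≤ A n

/-- A solution `(y, z)` of the inequality `|∑ y j * A (z j)| ≤ A Z / 8` with decreasing `z`. -/
structure IsSortedSol {s : ℕ} (A : ℕ → ℝ) (Y Z : ℕ) (y : Fin s → ℤ) (z : Fin s → ℕ) : Prop where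
  one_le : ∀ j, 1 ≤ |(y j : ℝ)|
  le_Y : ∀ j, |(y j : ℝ)| ≤ Y
  lt_z : ∀ j, Z < z j
  anti : Antitone z
  sum_le : |∑ j, (y j : ℝ) * A (z j)| ≤ A Z / 8

/-- The indices at which a cluster of `z` starts, clusters being separated by gaps larger
than `L`. -/
def clusterStarts {s : ℕ} (L : ℕ) (z : Fin s → ℕ) : Finset (Fin s) :=
  Finset.univ.filter fun j => ∀ i < j, z j + L < z i

/-- The indices at which a cluster of `z` with at least two elements starts. -/
def clusterHeads {s : ℕ} (L : ℕ) (z : Fin s → ℕ) : Finset (Fin s) :=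
  Finset.univ.filter fun j => (∀ i < j, z j + L < z i) ∧ ∃ i, j < i ∧ z j ≤ z i + L

lemma mem_clusterStarts {s L : ℕ} {z : Fin s → ℕ} {j : Fin s} :
    j ∈ clusterStarts L z ↔ ∀ i < j, z j + L < z i := by
  simp [clusterStarts]

lemma mem_clusterHeads {s L : ℕ} {z : Fin s → ℕ} {j : Fin s} :
    j ∈ clusterHeads L z ↔ j ∈ clusterStarts L z ∧ ∃ i, j < i ∧ z j ≤ z i + L := by
  simp [clusterHeads, clusterStarts]

/-- At most half of the indices are heads of clusters. -/
lemma two_mul_card_clusterHeads_le {s L : ℕ} {z : Fin s → ℕ} (hz : Antitone z) :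
    2 * (clusterHeads L z).card ≤ s := by
  have hcard : (clusterHeads L z).card ≤ (clusterHeads L z)ᶜ.card := by
    refine Finset.card_le_card_of_injOn
      (fun j => if h : (j : ℕ) + 1 < s then ⟨j + 1, h⟩ else j) ?_ ?_
    · intro j hj
      obtain ⟨-, i, hji, hi⟩ := mem_clusterHeads.1 hj
      have hlt : (j : ℕ) + 1 < s := by have := i.2; have : (j : ℕ) < i := hji; omega
      simp only [hlt, dite_true, Finset.coe_compl, Set.mem_compl_iff, Finset.mem_coe]
      intro hmem
      have h := mem_clusterStarts.1 (mem_clusterHeads.1 hmem).1 j (by simp [Fin.lt_def])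
      have := hz (show (⟨j + 1, hlt⟩ : Fin s) ≤ i from hji)
      omega
    · intro j hj k hk hjk
      obtain ⟨-, i, hji, -⟩ := mem_clusterHeads.1 hj
      obtain ⟨-, l, hkl, -⟩ := mem_clusterHeads.1 hk
      have h₁ : (j : ℕ) + 1 < s := by have := i.2; have : (j : ℕ) < i := hji; omega
      have h₂ : (k : ℕ) + 1 < s := by have := l.2; have : (k : ℕ) < l := hkl; omega
      simp only [h₁, h₂, dite_true, Fin.mk.injEq, Nat.add_right_cancel_iff] at hjk
      exact Fin.ext hjk
  have := Finset.card_add_card_compl (clusterHeads L z)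
  rw [Fintype.card_fin] at this
  omega

section

variable {s Y Z L : ℕ} {A : ℕ → ℝ} {y y' : Fin s → ℤ} {z z' : Fin s → ℕ}

/-- A term lying more than `L` below `n` is small compared with `A n`. -/
lemma IsSortedSol.abs_term_le (hs : 0 < s) (hA : GrowsFast A (s * Y) Z L)
    (h : IsSortedSol A Y Z y z) {i : Fin s} {n : ℕ} (hi : z i + L < n) :
    |(y i : ℝ) * A (z i)| ≤ A n / (16 * s) := by
  have hpos := hA.pos (z i) (h.lt_z i).le
  have hgap := hA.gap (z i) n (h.lt_z i).le hi
  have hs' : (0 : ℝ) < s := by exact_mod_cast hs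
  rw [abs_mul, abs_of_pos hpos, le_div_iff₀ (by positivity)]
  nlinarith [mul_le_mul_of_nonneg_right (h.le_Y i) (mul_pos hpos hs').le]

/-- Terms bounded by `b / s` contribute at most `b` to a sum. -/
lemma abs_sum_filter_le (hs : 0 < s) {f : Fin s → ℝ} {b : ℝ} (hb : 0 ≤ b) (p : Fin s → Prop)
    [DecidablePred p] (hf : ∀ i, p i → |f i| ≤ b / s) :
    |∑ i with p i, f i| ≤ b := by
  have hs' : (0 : ℝ) < s := by exact_mod_cast hs
  calc |∑ i with p i, f i| ≤ ∑ i with p i, |f i| := Finset.abs_sum_le_sum_abs _ _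
    _ ≤ ∑ i with p i, b / s := Finset.sum_le_sum fun i hi => hf i (Finset.mem_filter.1 hi).2
    _ ≤ ∑ _i : Fin s, b / s := Finset.sum_le_sum_of_subset_of_nonneg (Finset.filter_subset _ _)
        fun _ _ _ => by positivity
    _ = b := by simp; field_simp

lemma sum_eq_lt_add_gt (f : Fin s → ℝ) (j : Fin s) :
    ∑ i, f i = (∑ i with i < j, f i) + f j + ∑ i with j < i, f i := by
  rw [← Finset.sum_filter_add_sum_filter_not Finset.univ (· < j), add_assoc]
  congr 1
  have : Finset.univ.filter (fun i => ¬ i < j) = insert j (Finset.univ.filter (j < ·)) := by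
    ext i; simp [le_iff_eq_or_lt, eq_comm]
  rw [this, Finset.sum_insert (by simp)]

/-- If everything after `j` lies more than `L` below `z j`, then the sum of the terms up to `j`
is small. -/
lemma IsSortedSol.abs_prefix_add_le (hs : 0 < s) (hA : GrowsFast A (s * Y) Z L)
    (h : IsSortedSol A Y Z y z) {j : Fin s} (hj : ∀ i, j < i → z i + L < z j) :
    |(∑ i with i < j, (y i : ℝ) * A (z i)) + y j * A (z j)| ≤ A (z j) / 4 := by
  have hpos := hA.pos (z j) (h.lt_z j).le
  have hmono := hA.mono Z (z j) le_rfl (h.lt_z j).le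
  have htail : |∑ i with j < i, (y i : ℝ) * A (z i)| ≤ A (z j) / 16 :=
    abs_sum_filter_le hs (by positivity) _ fun i hi => by
      rw [div_div]; exact h.abs_term_le hs hA (hj i hi)
  have hsum := h.sum_le
  rw [sum_eq_lt_add_gt _ j] at hsum
  rw [abs_le] at *
  constructor <;> linarith [hsum.1, hsum.2, htail.1, htail.2]

/-- The first cluster has at least two elements. -/
lemma IsSortedSol.clusterHeads_card_pos (hs : 0 < s) (hA : GrowsFast A (s * Y) Z L)
    (h : IsSortedSol A Y Z y z) : 1 ≤ (clusterHeads L z).card := by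
  refine Finset.card_pos.2 ⟨⟨0, hs⟩, mem_clusterHeads.2 ⟨mem_clusterStarts.2 ?_, ?_⟩⟩
  · intro i hi
    simp [Fin.lt_def] at hi
  · by_contra! hcon
    have hle := h.abs_prefix_add_le hs hA hcon
    have hempty : Finset.univ.filter (fun i : Fin s => i < ⟨0, hs⟩) = ∅ := by
      ext i; simp [Fin.lt_def]
    have hpos := hA.pos _ (h.lt_z ⟨0, hs⟩).le
    rw [hempty, Finset.sum_empty, zero_add, abs_mul, abs_of_pos hpos] at hle
    nlinarith [h.one_le ⟨0, hs⟩]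

/-- Two solutions which agree before `j` and have no cluster start at `j` have nearby values
of `z j`. -/
lemma le_add_of_notMem_clusterStarts (hz' : Antitone z') {j : Fin s}
    (hj : j ∉ clusterStarts L z) (hlt : ∀ i < j, z i = z' i) : z' j ≤ z j + L := by
  simp only [mem_clusterStarts, not_forall, not_lt] at hj
  obtain ⟨i, hij, hi⟩ := hj
  have := hz' hij.le
  rw [← hlt i hij] at this
  omega

/-- Two solutions which agree before `j` and both have a singleton cluster at `j` have nearby
values of `z j`. -/
lemma IsSortedSol.le_add_of_singleton (hs : 0 < s) (hY : 0 < Y) (hA : GrowsFast A (s * Y) Z L)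
    (h : IsSortedSol A Y Z y z) (h' : IsSortedSol A Y Z y' z') {j : Fin s}
    (hj : ∀ i, j < i → z i + L < z j) (hj' : ∀ i, j < i → z' i + L < z' j)
    (hlt : ∀ i < j, y i = y' i ∧ z i = z' i) : z' j ≤ z j + L := by
  by_contra! hcon
  have hgap := hA.gap (z j) (z' j) (h.lt_z j).le hcon
  have hle := h.abs_prefix_add_le hs hA hj
  have hle' := h'.abs_prefix_add_le hs hA hj'
  have hpos := hA.pos (z j) (h.lt_z j).le
  have hpos' := hA.pos (z' j) (h'.lt_z j).le
  have hpre : ∑ i with i < j, (y' i : ℝ) * A (z' i) = ∑ i with i < j, (y i : ℝ) * A (z i) :=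
    Finset.sum_congr rfl fun i hi => by
      obtain ⟨h₁, h₂⟩ := hlt i (Finset.mem_filter.1 hi).2
      rw [h₁, h₂]
  rw [hpre] at hle'
  set T := ∑ i with i < j, (y i : ℝ) * A (z i)
  have h₁ : |T| ≤ A (z j) / 4 + Y * A (z j) := by
    have := abs_sub (T + y j * A (z j)) (y j * A (z j))
    rw [add_sub_cancel_right, abs_mul, abs_of_pos hpos] at this
    nlinarith [h.le_Y j]
  have h₂ : A (z' j) ≤ A (z' j) / 4 + |T| := by
    have := abs_sub (T + y' j * A (z' j)) T
    rw [add_sub_cancel_left, abs_mul, abs_of_pos hpos'] at this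
    nlinarith [h'.one_le j]
  have hs' : (1 : ℝ) ≤ s := by exact_mod_cast hs
  have hY' : (1 : ℝ) ≤ Y := by exact_mod_cast hY
  have h₃ : A (z j) ≤ Y * A (z j) := by nlinarith
  have h₄ : Y * A (z j) ≤ s * (Y * A (z j)) := by nlinarith
  nlinarith

/-- A solution is determined by its cluster structure, the values of `z` at the heads of clusters,
and the values of `y` and of `z` modulo `L + 1` at the other indices. -/
lemma IsSortedSol.eq_of_code_eq (hs : 0 < s) (hY : 0 < Y) (hA : GrowsFast A (s * Y) Z L)
    (h : IsSortedSol A Y Z y z) (h' : IsSortedSol A Y Z y' z')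
    (hstart : clusterStarts L z = clusterStarts L z')
    (hhead : clusterHeads L z = clusterHeads L z')
    (hcode : ∀ j ∈ clusterHeads L z, z j = z' j)
    (hcode' : ∀ j ∉ clusterHeads L z, z j % (L + 1) = z' j % (L + 1) ∧ y j = y' j) (j : Fin s) :
    y j = y' j ∧ z j = z' j := by
  have hmod : ∀ m n : ℕ, m ≤ n + L → n ≤ m + L → m % (L + 1) = n % (L + 1) → m = n := by
    have key : ∀ m n : ℕ, m ≤ n → n ≤ m + L → m % (L + 1) = n % (L + 1) → m = n := by
      intro m n h₁ h₂ h₃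
      have hdvd := (Nat.modEq_iff_dvd' h₁).1 h₃
      have := Nat.eq_zero_of_dvd_of_lt hdvd (by omega)
      omega
    intro m n h₁ h₂ h₃
    rcases le_total m n with hmn | hmn
    · exact key m n hmn h₂ h₃
    · exact (key n m hmn h₁ h₃.symm).symm
  have hnonstart : ∀ i ∉ clusterStarts L z, (∀ l < i, z l = z' l) → y i = y' i ∧ z i = z' i := by
    intro i hi hlt
    have hc := hcode' i fun hmem => hi (mem_clusterHeads.1 hmem).1
    exact ⟨hc.2, hmod _ _
      (le_add_of_notMem_clusterStarts h.anti (hstart ▸ hi) fun l hl => (hlt l hl).symm)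
      (le_add_of_notMem_clusterStarts h'.anti hi hlt) hc.1⟩
  induction j using WellFoundedLT.induction with
  | ind j ih =>
  by_cases hj : j ∈ clusterStarts L z
  swap
  · exact hnonstart j hj fun l hl => (ih l hl).2
  have hzj : z j = z' j := by
    by_cases hjh : j ∈ clusterHeads L z
    · exact hcode j hjh
    have hjh' := hhead ▸ hjh
    have hj' := hstart ▸ hj
    simp only [mem_clusterHeads, hj, hj', true_and, not_exists, not_and, not_le] at hjh hjh'
    exact hmod _ _
      (h'.le_add_of_singleton hs hY hA h hjh' hjh fun i hi => ⟨(ih i hi).1.symm, (ih i hi).2.symm⟩)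
      (h.le_add_of_singleton hs hY hA h' hjh hjh' ih) (hcode' j (by simpa [mem_clusterHeads, hj]
        using hjh)).1
  refine ⟨?_, hzj⟩
  have hlinked : ∀ i, j < i → (∀ l, j < l → l ≤ i → l ∉ clusterStarts L z) →
      y i = y' i ∧ z i = z' i := by
    intro i
    induction i using WellFoundedLT.induction with
    | ind i ihi =>
    intro hji hno
    refine hnonstart i (hno i hji le_rfl) fun l hl => ?_
    rcases lt_trichotomy l j with hlj | rfl | hlj
    · exact (ih l hlj).2
    · exact hzj
    · exact (ihi l hl hlj fun m hm hml => hno m hm (hml.trans hl.le)).2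
  have hpos := hA.pos (z j) (h.lt_z j).le
  have hmono := hA.mono Z (z j) le_rfl (h.lt_z j).le
  have htail : |∑ i with j < i, ((y i : ℝ) * A (z i) - y' i * A (z' i))| ≤ A (z j) / 8 := by
    refine abs_sum_filter_le hs (by positivity) _ fun i hi => ?_
    by_cases hno : ∀ l, j < l → l ≤ i → l ∉ clusterStarts L z
    · obtain ⟨h₁, h₂⟩ := hlinked i hi hno
      rw [h₁, h₂, sub_self, abs_zero]
      positivity
    · push Not at hno
      obtain ⟨l, hjl, hli, hl⟩ := hno
      have h₁ := mem_clusterStarts.1 hl j hjl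
      have h₂ := mem_clusterStarts.1 (hstart ▸ hl) j hjl
      have h₃ := h.abs_term_le hs hA (lt_of_le_of_lt (Nat.add_le_add_right (h.anti hli) L) h₁)
      have h₄ := h'.abs_term_le hs hA (lt_of_le_of_lt (Nat.add_le_add_right (h'.anti hli) L) h₂)
      rw [← hzj] at h₄
      calc _ ≤ _ := abs_sub _ _
        _ ≤ A (z j) / (16 * s) + A (z j) / (16 * s) := add_le_add h₃ h₄
        _ = A (z j) / 8 / s := by field_simp; norm_num
  have hpre : ∑ i with i < j, ((y i : ℝ) * A (z i) - y' i * A (z' i)) = 0 :=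
    Finset.sum_eq_zero fun i hi => by
      obtain ⟨h₁, h₂⟩ := ih i (Finset.mem_filter.1 hi).2
      rw [h₁, h₂, sub_self]
  have htotal : |∑ i, ((y i : ℝ) * A (z i) - y' i * A (z' i))| ≤ A Z / 8 + A Z / 8 := by
    rw [Finset.sum_sub_distrib]
    exact (abs_sub _ _).trans (add_le_add h.sum_le h'.sum_le)
  rw [sum_eq_lt_add_gt _ j, hpre, zero_add, ← hzj, ← sub_mul] at htotal
  have hfin : |((y j - y' j : ℤ) : ℝ)| * A (z j) < 1 * A (z j) := by
    rw [← abs_of_pos hpos, ← abs_mul, abs_of_pos hpos]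
    push_cast
    rw [abs_le] at *
    rw [abs_lt]
    constructor <;> linarith [htail.1, htail.2, htotal.1, htotal.2]
  have := lt_of_mul_lt_mul_right hfin hpos.le
  have : |y j - y' j| < 1 := by exact_mod_cast this
  rw [Int.abs_lt_one_iff] at this
  omega

end

/-- The number of sorted solutions with prescribed cluster structure. -/
lemma card_sortedSol_fiber_le {s Y Z L : ℕ} {A : ℕ → ℝ} (hs : 0 < s) (hY : 0 < Y)
    (hA : GrowsFast A (s * Y) Z L) (G : Finset ((Fin s → ℤ) × (Fin s → ℕ)))
    (hG : ∀ p ∈ G, IsSortedSol A Y Z p.1 p.2 ∧ ∀ j, p.2 j ≤ 2 * Z) (S B : Finset (Fin s)) :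
    (G.filter fun p => clusterHeads L p.2 = S ∧ clusterStarts L p.2 = B).card ≤
      Z ^ S.card * ((L + 1) * (2 * Y + 1)) ^ (s - S.card) := by
  set t : Fin s → Finset (ℕ × ℤ) := fun j =>
    if j ∈ S then Finset.Ioc Z (2 * Z) ×ˢ {0}
    else Finset.range (L + 1) ×ˢ Finset.Icc (-(Y : ℤ)) Y with ht
  have hcard : (Fintype.piFinset t).card = Z ^ S.card * ((L + 1) * (2 * Y + 1)) ^ (s - S.card) := by
    have htc : ∀ j, (t j).card = if j ∈ S then Z else (L + 1) * (2 * Y + 1) := by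
      intro j
      simp only [ht]
      split_ifs
      · simp; omega
      · simp; omega
    rw [Fintype.card_piFinset, Finset.prod_congr rfl fun j _ => htc j, Finset.prod_ite,
      Finset.prod_const, Finset.prod_const, Finset.filter_mem_eq_inter, Finset.univ_inter,
      Finset.filter_notMem_eq_sdiff, ← Finset.compl_eq_univ_sdiff, Finset.card_compl,
      Fintype.card_fin]
  rw [← hcard]
  refine Finset.card_le_card_of_injOn
    (fun p j => if j ∈ S then (p.2 j, 0) else (p.2 j % (L + 1), p.1 j)) ?_ ?_
  · intro p hp
    obtain ⟨hpG, -⟩ := Finset.mem_filter.1 hp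
    obtain ⟨hsol, hle⟩ := hG p hpG
    simp only [Finset.mem_coe, Fintype.mem_piFinset]
    intro j
    by_cases hj : j ∈ S
    · simpa [ht, hj] using ⟨hsol.lt_z j, hle j⟩
    · have : |p.1 j| ≤ (Y : ℤ) := by exact_mod_cast hsol.le_Y j
      simpa [ht, hj] using ⟨Nat.lt_succ_iff.1 (Nat.mod_lt _ L.succ_pos), abs_le.1 this⟩
  · intro p hp q hq hpq
    obtain ⟨hpG, hpS, hpB⟩ := Finset.mem_filter.1 hp
    obtain ⟨hqG, hqS, hqB⟩ := Finset.mem_filter.1 hq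
    have hall := (hG p hpG).1.eq_of_code_eq hs hY hA (hG q hqG).1 (hpB.trans hqB.symm)
      (hpS.trans hqS.symm)
      (fun j hj => by simpa [hpS ▸ hj] using congrFun hpq j)
      (fun j hj => by simpa [hpS ▸ hj] using congrFun hpq j)
    exact Prod.ext (funext fun j => (hall j).1) (funext fun j => (hall j).2)

lemma pow_mul_pow_le_max {x v : ℝ} (hx : 0 < x) (hv : 0 < v) {s k : ℕ} (hk : 1 ≤ k)
    (hks : 2 * k ≤ s) :
    x ^ k * v ^ (s - k) ≤ max ((v * x) ^ ((s : ℝ) / 2)) (x * v ^ (s - 1)) := by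
  rcases le_total x v with hxv | hxv
  · refine le_max_of_le_right ?_
    obtain ⟨m, rfl⟩ := Nat.exists_eq_add_of_le' hk
    have : s - 1 = m + (s - (m + 1)) := by omega
    rw [this, pow_succ', pow_add, mul_assoc]
    gcongr
  · refine le_max_of_le_left ?_
    obtain ⟨m, rfl⟩ := Nat.exists_eq_add_of_le hks
    have hsqrt : v ≤ (v * x) ^ ((1 : ℝ) / 2) := by
      rw [← Real.sqrt_eq_rpow]
      exact Real.le_sqrt_of_sq_le (by nlinarith)
    have hexp : (((2 * k + m : ℕ) : ℝ) / 2) = k + 1 / 2 * m := by push_cast; ring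
    rw [hexp, Real.rpow_add (by positivity), Real.rpow_natCast, Real.rpow_mul (by positivity),
      Real.rpow_natCast, mul_pow, show 2 * k + m - k = k + m by omega, pow_add]
    calc x ^ k * (v ^ k * v ^ m) = v ^ k * x ^ k * v ^ m := by ring
      _ ≤ _ := by gcongr

/-- The number of sorted solutions. -/
lemma card_sortedSol_le {s Y Z L : ℕ} {A : ℕ → ℝ} {D V : ℝ} (hs : 0 < s) (hY : 0 < Y) (hZ : 0 < Z)
    (hA : GrowsFast A (s * Y) Z L) (hD : 1 ≤ D) (hV : 0 < V)
    (hDV : ((L + 1 : ℕ) : ℝ) * (2 * Y + 1 : ℕ) ≤ D * V)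
    (G : Finset ((Fin s → ℤ) × (Fin s → ℕ)))
    (hG : ∀ p ∈ G, IsSortedSol A Y Z p.1 p.2 ∧ ∀ j, p.2 j ≤ 2 * Z) :
    (G.card : ℝ) ≤ (4 * D) ^ s * max ((V * Z) ^ ((s : ℝ) / 2)) (Z * V ^ (s - 1)) := by
  have hZ' : (0 : ℝ) < Z := by exact_mod_cast hZ
  set X := max ((V * Z) ^ ((s : ℝ) / 2)) (Z * V ^ (s - 1))
  have hX0 : 0 ≤ X := le_max_of_le_right (by positivity)
  have hfiber : ∀ c : Finset (Fin s) × Finset (Fin s),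
      ((G.filter fun p => (clusterHeads L p.2, clusterStarts L p.2) = c).card : ℝ) ≤ D ^ s * X := by
    rintro ⟨S, B⟩
    simp only [Prod.mk.injEq]
    rcases Finset.eq_empty_or_nonempty
      (G.filter fun p => clusterHeads L p.2 = S ∧ clusterStarts L p.2 = B) with hemp | ⟨p, hp⟩
    · rw [hemp]; simp; positivity
    obtain ⟨hpG, rfl, -⟩ := Finset.mem_filter.1 hp
    have hsol := (hG p hpG).1
    have h₁ := hsol.clusterHeads_card_pos hs hA
    have h₂ := two_mul_card_clusterHeads_le (L := L) hsol.anti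
    set k := (clusterHeads L p.2).card
    calc _ ≤ ((Z ^ k * ((L + 1) * (2 * Y + 1)) ^ (s - k) : ℕ) : ℝ) :=
          Nat.cast_le.2 (card_sortedSol_fiber_le hs hY hA G hG _ B)
      _ = (Z : ℝ) ^ k * (((L + 1 : ℕ) : ℝ) * (2 * Y + 1 : ℕ)) ^ (s - k) := by push_cast; ring
      _ ≤ (Z : ℝ) ^ k * (D * V) ^ (s - k) := by gcongr
      _ = D ^ (s - k) * ((Z : ℝ) ^ k * V ^ (s - k)) := by rw [mul_pow]; ring
      _ ≤ D ^ s * X := mul_le_mul (pow_le_pow_right₀ hD (Nat.sub_le s k))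
          (pow_mul_pow_le_max hZ' hV h₁ h₂) (by positivity) (by positivity)
  rw [Finset.card_eq_sum_card_fiberwise (f := fun p => (clusterHeads L p.2, clusterStarts L p.2))
    (t := Finset.univ) (fun _ _ => by simp), Nat.cast_sum]
  refine (Finset.sum_le_sum fun c _ => hfiber c).trans_eq ?_
  rw [Finset.sum_const, Finset.card_univ, Fintype.card_prod, Fintype.card_finset, Fintype.card_fin,
    nsmul_eq_mul, mul_pow, show (4 : ℝ) = 2 * 2 by norm_num, mul_pow]
  push_cast
  ring

/-- A set of tuples that is stable under permutations of the indices has at most `s!` times as many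
elements as its subset of sorted tuples. -/
lemma card_le_factorial_mul_card_antitone {s : ℕ} (F : Finset ((Fin s → ℤ) × (Fin s → ℕ)))
    (hF : ∀ p ∈ F, ∀ σ : Equiv.Perm (Fin s), (p.1 ∘ σ, p.2 ∘ σ) ∈ F)
    [DecidablePred fun p : (Fin s → ℤ) × (Fin s → ℕ) => Antitone p.2] :
    F.card ≤ s.factorial * (F.filter fun p => Antitone p.2).card := by
  classical
  set G := F.filter fun p => Antitone p.2
  have hsub : F ⊆ (Finset.univ ×ˢ G).image
      fun q : Equiv.Perm (Fin s) × ((Fin s → ℤ) × (Fin s → ℕ)) =>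
        (q.2.1 ∘ q.1.symm, q.2.2 ∘ q.1.symm) := by
    intro p hp
    set σ := Tuple.sort (OrderDual.toDual ∘ p.2)
    refine Finset.mem_image.2 ⟨(σ, (p.1 ∘ σ, p.2 ∘ σ)), ?_, ?_⟩
    · simp only [Finset.mem_product, Finset.mem_univ, true_and]
      refine Finset.mem_filter.2 ⟨hF p hp σ, fun i j hij => ?_⟩
      exact Tuple.monotone_sort (OrderDual.toDual ∘ p.2) hij
    · ext j <;> simp
  calc F.card ≤ _ := Finset.card_le_card hsub
    _ ≤ (Finset.univ ×ˢ G).card := Finset.card_image_le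
    _ = s.factorial * G.card := by
      rw [Finset.card_product, Finset.card_univ, Fintype.card_perm, Fintype.card_fin]

/-- A lacunary sequence grows fast at the scale `3 * log Z / log r`. -/
lemma growsFast_of_lacunary {r : ℝ} (hr : 1 < r) {a : ℕ → ℕ} (ha : ∀ m, 1 ≤ m → 0 < a m)
    (hlac : ∀ m, 1 ≤ m → r * a m < a (m + 1)) {s Y Z L : ℕ} (hs : 0 < s) (hYZ : Y ≤ Z)
    (hsZ : 4 * s ≤ Z) (hL : 3 * Real.log Z ≤ L * Real.log r) :
    GrowsFast (fun m => (a m : ℝ)) (s * Y) Z L := by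
  have hpow : ∀ m, 1 ≤ m → ∀ k : ℕ, r ^ k * (a m : ℝ) ≤ a (m + k) := by
    intro m hm k
    induction k with
    | zero => simp
    | succ k ih =>
      have := hlac (m + k) (by omega)
      rw [pow_succ', mul_assoc, ← add_assoc]
      exact (mul_le_mul_of_nonneg_left ih (by linarith)).trans this.le
  have hmono : ∀ m n, Z ≤ m → m ≤ n → (a m : ℝ) ≤ a n := by
    intro m n hm hmn
    obtain ⟨k, rfl⟩ := Nat.exists_eq_add_of_le hmn
    refine le_trans ?_ (hpow m (by omega) k)
    exact le_mul_of_one_le_left (by positivity) (one_le_pow₀ hr.le)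
  have hZ : (4 : ℝ) ≤ Z := by exact_mod_cast (by omega : 4 ≤ Z)
  have hrL : (Z : ℝ) ^ 3 ≤ r ^ L := by
    rw [← Real.log_le_log_iff (by positivity) (by positivity), Real.log_pow, Real.log_pow]
    exact_mod_cast hL
  have hM : 16 * ((s : ℝ) * Y) ≤ r ^ L := by
    have h₁ : 4 * (s : ℝ) ≤ Z := by exact_mod_cast hsZ
    have h₂ : (Y : ℝ) ≤ Z := by exact_mod_cast hYZ
    have h₃ : 4 * (s : ℝ) * Y ≤ Z * Z := by gcongr
    nlinarith [mul_nonneg (sq_nonneg (Z : ℝ)) (sub_nonneg.2 hZ)]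
  refine ⟨fun m hm => by exact_mod_cast ha m (by omega), hmono, fun m n hm hmn => ?_⟩
  calc 16 * ((s : ℝ) * Y) * a m ≤ r ^ L * a m := by gcongr
    _ ≤ a (m + L) := hpow m (by omega) L
    _ ≤ a n := hmono _ _ (by omega) hmn.le

theorem lacunary_counting (r : ℝ) (hr1 : 1 < r) (hr2 : r ≤ 2) :
    ∃ R : ℝ, 1 < R ∧
    ∀ a : ℕ → ℕ, (∀ m, 1 ≤ m → 0 < a m) →
      (∀ m, 1 ≤ m → r * a m < a (m + 1)) →
      ∀ s : ℕ, 0 < s → ∀ Y Z : ℕ, 2 ≤ Y → Y ≤ Z → 4 * s ≤ Z →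
      ∀ K : ℝ, 0 ≤ K → K ≤ (a Z : ℝ) / 8 →
      (Set.ncard {p : (Fin s → ℤ) × (Fin s → ℕ) |
          (∀ j, 0 < |p.1 j| ∧ |p.1 j| ≤ (Y : ℤ)) ∧
          (∀ j, Z < p.2 j ∧ p.2 j ≤ 2 * Z) ∧
          (|∑ j, p.1 j * (a (p.2 j) : ℤ)| : ℝ) ≤ K} : ℝ) ≤
        (Nat.factorial s) * R ^ s *
          max (((Y : ℝ) * Z * Real.log Z) ^ ((s : ℝ) / 2))
            ((Y : ℝ) ^ (s - 1) * Z * (Real.log Z) ^ (s - 1)) := by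
  classical
  have hlogr : 0 < Real.log r := Real.log_pos hr1
  set C : ℝ := 3 / Real.log r + 2 with hC
  have hC2 : 2 ≤ C := by rw [hC]; linarith [div_pos three_pos hlogr]
  refine ⟨4 * (3 * C), by linarith, ?_⟩
  intro a ha hlac s hs Y Z hY hYZ hsZ K hK hKZ
  have hlogZ : 1 ≤ Real.log Z := by
    have hZ : (4 : ℝ) ≤ Z := by exact_mod_cast (by omega : 4 ≤ Z)
    rw [Real.le_log_iff_exp_le (by linarith)]
    linarith [Real.exp_one_lt_d9]
  set L := ⌈3 * Real.log Z / Real.log r⌉₊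
  have hL : 3 * Real.log Z ≤ L * Real.log r := by
    rw [← div_le_iff₀ hlogr]
    exact Nat.le_ceil _
  have hL' : ((L + 1 : ℕ) : ℝ) ≤ C * Real.log Z := by
    have := Nat.ceil_lt_add_one (show 0 ≤ 3 * Real.log Z / Real.log r by positivity)
    push_cast
    rw [hC, add_mul, div_mul_eq_mul_div]
    linarith
  have hA := growsFast_of_lacunary hr1 ha hlac hs hYZ hsZ hL
  have hY' : (2 : ℝ) ≤ Y := by exact_mod_cast hY
  have hDV : ((L + 1 : ℕ) : ℝ) * (2 * Y + 1 : ℕ) ≤ 3 * C * (Y * Real.log Z) := by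
    calc ((L + 1 : ℕ) : ℝ) * (2 * Y + 1 : ℕ) ≤ C * Real.log Z * (3 * Y) := by
          gcongr
          push_cast
          linarith
      _ = _ := by ring
  set T : Set ((Fin s → ℤ) × (Fin s → ℕ)) := {p |
    (∀ j, 0 < |p.1 j| ∧ |p.1 j| ≤ (Y : ℤ)) ∧ (∀ j, Z < p.2 j ∧ p.2 j ≤ 2 * Z) ∧
      (|∑ j, p.1 j * (a (p.2 j) : ℤ)| : ℝ) ≤ K}
  have hfin : T.Finite := by
    refine (((Fintype.piFinset fun _ => Finset.Icc (-(Y : ℤ)) Y) ×ˢ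
      (Fintype.piFinset fun _ => Finset.Ioc Z (2 * Z)) : Finset _).finite_toSet).subset ?_
    rintro p ⟨h₁, h₂, -⟩
    simp only [Finset.coe_product, Set.mem_prod, Finset.mem_coe, Fintype.mem_piFinset,
      Finset.mem_Icc, Finset.mem_Ioc]
    exact ⟨fun j => abs_le.1 (h₁ j).2, h₂⟩
  rw [Set.ncard_eq_toFinset_card T hfin]
  have hperm := card_le_factorial_mul_card_antitone hfin.toFinset (by
    intro p hp σ
    rw [Set.Finite.mem_toFinset] at hp ⊢
    refine ⟨fun j => hp.1 (σ j), fun j => hp.2.1 (σ j), ?_⟩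
    simp only [Function.comp_apply]
    rw [Equiv.sum_comp σ fun j => (p.1 j : ℝ) * ((a (p.2 j) : ℤ) : ℝ)]
    exact hp.2.2)
  have hsorted := card_sortedSol_le hs (by omega) (by omega) hA (by linarith) (by positivity) hDV
    (hfin.toFinset.filter fun p => Antitone p.2) (by
    intro p hp
    rw [Finset.mem_filter, Set.Finite.mem_toFinset] at hp
    obtain ⟨⟨h₁, h₂, h₃⟩, hanti⟩ := hp
    refine ⟨⟨fun j => ?_, fun j => ?_, fun j => (h₂ j).1, hanti, ?_⟩, fun j => (h₂ j).2⟩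
    · exact_mod_cast Int.add_one_le_iff.2 (h₁ j).1
    · exact_mod_cast (h₁ j).2
    · exact (by simpa using h₃ : _ ≤ K).trans hKZ)
  calc (hfin.toFinset.card : ℝ)
      ≤ (s.factorial : ℝ) * (hfin.toFinset.filter fun p => Antitone p.2).card := by
        exact_mod_cast hperm
    _ ≤ s.factorial * ((4 * (3 * C)) ^ s *
        max ((Y * Real.log Z * Z) ^ ((s : ℝ) / 2)) (Z * (Y * Real.log Z) ^ (s - 1))) := by gcongr
    _ = _ := by
      rw [mul_right_comm (Y : ℝ), mul_pow (Y : ℝ), mul_left_comm (Z : ℝ),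
        ← mul_assoc (s.factorial : ℝ), ← mul_assoc ((Y : ℝ) ^ (s - 1))]
end

section
/- Let α ∈ 𝒦 and γ ∈ ℝ. Then there exists a sequence n_1, n_2, … of positive integers such that for every t ≥ 1: 8^t ≤ n_t ≤ 4·e^(6Λ(α)t), n_t · ‖n_t α − γ‖ ≤ 8, and n_{t+1} > 2·n_t. -/
open Real MeasureTheory Set

theorem nint_le_abs_sub (x : ℝ) (m : ℤ) : nint x ≤ |x - m| :=
  ciInf_le ⟨0, by rintro _ ⟨n, rfl⟩; exact abs_nonneg _⟩ m

/-- If `p / q` is a reduced fraction with `|α - p / q| ≤ 1 / q ^ 2`, then some `n ∈ [q, 2q)`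
approximates `γ` well along the orbit of the rotation by `α`. -/
theorem exists_mul_nint_le_of_isCoprime {α : ℝ} (γ : ℝ) {p q : ℤ} (hq : 0 < q)
    (hpq : IsCoprime p q) (happrox : |α - p / q| ≤ 1 / (q : ℝ) ^ 2) :
    ∃ n : ℕ, q ≤ n ∧ (n : ℤ) < 2 * q ∧ (n : ℝ) * nint ((n : ℝ) * α - γ) ≤ 3 := by
  obtain ⟨u, v, huv⟩ := hpq
  set x : ℝ := q * α - γ with hx
  set r : ℤ := round (-(x * q)) with hr
  set j : ℤ := (r * u) % q with hj
  have hj0 : 0 ≤ j := Int.emod_nonneg _ hq.ne'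
  have hjq : j < q := Int.emod_lt_of_pos _ hq
  obtain ⟨m, hm⟩ : ∃ m : ℤ, j * p = r + q * m := by
    refine ⟨-(r * v) - (r * u / q) * p, ?_⟩
    have h : j = r * u - q * (r * u / q) := by rw [hj, Int.emod_def]
    rw [h]
    linear_combination r * huv
  have hqR : (0 : ℝ) < q := by exact_mod_cast hq
  have hjR0 : (0 : ℝ) ≤ j := by exact_mod_cast hj0
  have hjR : (j : ℝ) < q := by exact_mod_cast hjq
  have hmR : (j : ℝ) * p = r + q * m := by exact_mod_cast hm
  have hcast : (((q + j).toNat : ℕ) : ℤ) = q + j := Int.toNat_of_nonneg (by lia)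
  have hcastR : (((q + j).toNat : ℕ) : ℝ) = q + j := by exact_mod_cast hcast
  refine ⟨(q + j).toNat, by lia, by lia, ?_⟩
  rw [hcastR]
  have hround : |x + r / q| ≤ 1 / 2 / q := by
    have h := abs_sub_round (-(x * q))
    rw [← hr, ← abs_neg] at h
    rw [le_div_iff₀ hqR, ← abs_of_pos hqR, ← abs_mul, abs_of_pos hqR]
    convert h using 2
    field_simp
    ring
  have hdrift : |j * (α - p / q)| ≤ 1 / q := by
    rw [abs_mul, abs_of_nonneg hjR0]
    calc (j : ℝ) * |α - p / q| ≤ q * (1 / (q : ℝ) ^ 2) := by gcongr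
      _ = 1 / q := by field_simp
  have hsplit : ((q : ℝ) + j) * α - γ - m = (x + r / q) + j * (α - p / q) := by
    have : (m : ℝ) = (j * p - r) / q := by rw [hmR]; field_simp; ring
    rw [this, hx]
    ring
  have hnint : nint (((q : ℝ) + j) * α - γ) ≤ 3 / 2 / q := by
    refine (nint_le_abs_sub _ m).trans ?_
    rw [hsplit]
    refine (abs_add_le _ _).trans ((add_le_add hround hdrift).trans_eq ?_)
    ring
  calc ((q : ℝ) + j) * nint (((q : ℝ) + j) * α - γ)
      ≤ (q + j) * (3 / 2 / q) := by gcongr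
    _ ≤ (2 * q) * (3 / 2 / q) := by gcongr; linarith
    _ = 3 := by field_simp

namespace GenContFract

theorem not_terminatedAt_of_irrational {α : ℝ} (hα : Irrational α) (k : ℕ) :
    ¬ (GenContFract.of α).TerminatedAt k := fun h =>
  have ⟨r, hr⟩ := (terminates_iff_rat α).1 ⟨k, h⟩
  hα ⟨r, hr.symm⟩

theorem exists_get?_s_eq_of_irrational {α : ℝ} (hα : Irrational α) (k : ℕ) :
    ∃ b : ℤ, 1 ≤ b ∧ (GenContFract.of α).s.get? k = some ⟨1, b⟩ := by
  obtain ⟨gp, hgp⟩ := Option.ne_none_iff_exists'.1 (not_terminatedAt_of_irrational hα k)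
  obtain ⟨ha, b, hb⟩ := of_partNum_eq_one_and_exists_int_partDen_eq hgp
  have hb1 : 1 ≤ gp.b := of_one_le_get?_partDen (partDen_eq_s_b hgp)
  rw [hb] at hb1
  refine ⟨b, by exact_mod_cast hb1, ?_⟩
  rw [hgp, ← ha, ← hb]

theorem exists_int_eq_nums_dens {α : ℝ} (hα : Irrational α) (k : ℕ) :
    ∃ p q : ℤ, (GenContFract.of α).nums k = p ∧ (GenContFract.of α).dens k = q := by
  induction k using Nat.twoStepInduction with
  | zero => exact ⟨⌊α⌋, 1, by simp, by simp⟩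
  | one =>
    obtain ⟨b, -, hb⟩ := exists_get?_s_eq_of_irrational hα 0
    exact ⟨b * ⌊α⌋ + 1, b, by simp [first_num_eq hb], by simp [first_den_eq hb]⟩
  | more k ih ih' =>
    obtain ⟨p, q, hp, hq⟩ := ih
    obtain ⟨p', q', hp', hq'⟩ := ih'
    obtain ⟨b, -, hb⟩ := exists_get?_s_eq_of_irrational hα (k + 1)
    exact ⟨b * p' + p, b * q' + q, by simp [nums_recurrence hb hp hp'],
      by simp [dens_recurrence hb hq hq']⟩

theorem dens_pos_of_irrational {α : ℝ} (hα : Irrational α) (k : ℕ) :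
    0 < (GenContFract.of α).dens k :=
  lt_of_lt_of_le (by exact_mod_cast Nat.fib_pos.2 k.succ_pos)
    (succ_nth_fib_le_of_nth_den (Or.inr (not_terminatedAt_of_irrational hα (k - 1))))

theorem two_mul_dens_le_dens_add_two {α : ℝ} (hα : Irrational α) (k : ℕ) :
    2 * (GenContFract.of α).dens k ≤ (GenContFract.of α).dens (k + 2) := by
  obtain ⟨b, hb1, hb⟩ := exists_get?_s_eq_of_irrational hα (k + 1)
  rw [dens_recurrence hb rfl rfl]
  have hbR : (1 : ℝ) ≤ b := by exact_mod_cast hb1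
  have hmono : (GenContFract.of α).dens k ≤ (GenContFract.of α).dens (k + 1) := of_den_mono
  nlinarith [dens_pos_of_irrational hα (k + 1)]

theorem eight_mul_dens_le_dens_add_six {α : ℝ} (hα : Irrational α) (k : ℕ) :
    8 * (GenContFract.of α).dens k ≤ (GenContFract.of α).dens (k + 6) := by
  linarith [two_mul_dens_le_dens_add_two hα k, two_mul_dens_le_dens_add_two hα (k + 2),
    two_mul_dens_le_dens_add_two hα (k + 4)]

theorem eight_pow_le_dens_six_mul {α : ℝ} (hα : Irrational α) (t : ℕ) :
    8 ^ t ≤ (GenContFract.of α).dens (6 * t) := by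
  induction t with
  | zero => simp
  | succ t ih =>
    rw [pow_succ', mul_add]
    exact (by gcongr : _ ≤ 8 * (GenContFract.of α).dens (6 * t)).trans
      (eight_mul_dens_le_dens_add_six hα _)

theorem exists_isCoprime_approx {α : ℝ} (hα : Irrational α) (k : ℕ) :
    ∃ p q : ℤ, (GenContFract.of α).dens k = q ∧ IsCoprime p q ∧ |α - p / q| ≤ 1 / (q : ℝ) ^ 2 := by
  obtain ⟨p, q, hp, hq⟩ := exists_int_eq_nums_dens hα k
  obtain ⟨p', q', hp', hq'⟩ := exists_int_eq_nums_dens hα (k + 1)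
  have hterm := not_terminatedAt_of_irrational hα k
  refine ⟨p, q, hq, ?_, ?_⟩
  · have hdet : (GenContFract.of α).nums k * (GenContFract.of α).dens (k + 1) -
        (GenContFract.of α).dens k * (GenContFract.of α).nums (k + 1) = (-1) ^ (k + 1) :=
      (SimpContFract.of α).determinant hterm
    rw [hp, hp', hq, hq'] at hdet
    have hdetZ : p * q' - q * p' = (-1) ^ (k + 1) := by exact_mod_cast hdet
    have hsq : ((-1 : ℤ) ^ (k + 1)) * (-1) ^ (k + 1) = 1 := by
      rw [← mul_pow]; simp
    exact ⟨(-1) ^ (k + 1) * q', -((-1) ^ (k + 1) * p'), by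
      linear_combination (-1 : ℤ) ^ (k + 1) * hdetZ + hsq⟩
  · have hpos : (0 : ℝ) < q := hq ▸ dens_pos_of_irrational hα k
    have hmono : (q : ℝ) ≤ (GenContFract.of α).dens (k + 1) := hq ▸ of_den_mono
    have h := abs_sub_convs_le hterm
    rw [conv_eq_num_div_den, hp, hq] at h
    refine h.trans ?_
    rw [sq]
    gcongr

end GenContFract

theorem contDen_le_exp_Lam_mul {α : ℝ} (hα : memK α) {k : ℕ} (hk : 0 < k) :
    contDen α k ≤ Real.exp (Lam α * k) := by
  have hkR : (0 : ℝ) < k := by exact_mod_cast hk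
  have h : Real.log (contDen α k) / k ≤ Lam α := le_ciSup hα.2 (⟨k, hk⟩ : ℕ+)
  rw [div_le_iff₀ hkR] at h
  exact (Real.log_le_iff_le_exp (GenContFract.dens_pos_of_irrational hα.1 k)).1 h

theorem exists_mul_nint_le_of_contDen {α : ℝ} (hα : Irrational α) (γ : ℝ) (k : ℕ) :
    ∃ n : ℕ, contDen α k ≤ n ∧ n < 2 * contDen α k ∧ (n : ℝ) * nint ((n : ℝ) * α - γ) ≤ 3 := by
  obtain ⟨p, q, hq, hpq, happrox⟩ := GenContFract.exists_isCoprime_approx hα k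
  have hpos : (0 : ℝ) < q := hq ▸ GenContFract.dens_pos_of_irrational hα k
  obtain ⟨n, hqn, hnq, hn⟩ :=
    exists_mul_nint_le_of_isCoprime γ (by exact_mod_cast hpos) hpq happrox
  refine ⟨n, ?_, ?_, hn⟩ <;> rw [contDen, hq]
  · exact_mod_cast hqn
  · exact_mod_cast hnq

theorem three_distance_sequence (α : ℝ) (hα : memK α) (γ : ℝ) :
    ∃ n : ℕ → ℕ, ∀ t : ℕ, 1 ≤ t →
      8 ^ t ≤ n t ∧ (n t : ℝ) ≤ 4 * Real.exp (6 * Lam α * t) ∧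
      (n t : ℝ) * nint ((n t : ℝ) * α - γ) ≤ 8 ∧ 2 * n t < n (t + 1) := by
  choose n hlow hupp hdist using fun t : ℕ => exists_mul_nint_le_of_contDen hα.1 γ (6 * t)
  refine ⟨n, fun t ht => ⟨?_, ?_, ?_, ?_⟩⟩
  · have h : (8 : ℝ) ^ t ≤ n t :=
      (GenContFract.eight_pow_le_dens_six_mul hα.1 t).trans (hlow t)
    exact_mod_cast h
  · have h := contDen_le_exp_Lam_mul hα (k := 6 * t) (by lia)
    have harg : Lam α * ((6 * t : ℕ) : ℝ) = 6 * Lam α * t := by push_cast; ring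
    rw [harg] at h
    linarith [hupp t, Real.exp_pos (6 * Lam α * t)]
  · linarith [hdist t]
  · have hgrow : 8 * contDen α (6 * t) ≤ contDen α (6 * (t + 1)) :=
      GenContFract.eight_mul_dens_le_dens_add_six hα.1 (6 * t)
    have hpos : 0 < contDen α (6 * t) := GenContFract.dens_pos_of_irrational hα.1 _
    have h : (2 : ℝ) * n t < n (t + 1) := by linarith [hupp t, hlow (t + 1)]
    exact_mod_cast h
end
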